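/- There exist nonnegative real coefficients (C_w)_{w∈Λ} such that: C_{0} > 0 (where 0 denotes the one-letter word 0); for every v ∈ Λ, C_v ≤ 10635 and either C_v = 0 or C_v ≥ 4441; and for every v ∈ Λ, (12914/6541)·C_v ≤ min_{a∈A} Σ_{b∈A, vab ∈ S^{≤p}_free} C_{Λ(vab)}, where the sum is over all letters b ∈ A such that vab contains no square of period between 2 and p as a factor. -/

import Mathlib

open scoped Classical

/-- `w` contains a factor that is a square of period between `lo` and `hi`. -/
def HasSq {A : Type*} (lo hi : ℕ) (w : List A) : Prop :=
  ∃ u : List A, lo ≤ u.length ∧ u.length ≤ hi ∧ (u ++ u) <:+: w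

/-- `w` is a square of period between `lo` and `hi`. -/
def IsSq {A : Type*} (lo hi : ℕ) (w : List A) : Prop :=
  ∃ u : List A, lo ≤ u.length ∧ u.length ≤ hi ∧ w = u ++ u

/-- `w` is a minimal square of period between `lo` and `hi`: it is such a square and no
proper factor of it is such a square. -/
def MinSq {A : Type*} (lo hi : ℕ) (w : List A) : Prop :=
  IsSq lo hi w ∧ ∀ f : List A, f <:+: w → f ≠ w → ¬ IsSq lo hi f

/-- A word is normalized if it is lexicographically least among its images under
permutations of the alphabet. -/
def Normalized {A : Type*} [LinearOrder A] (w : List A) : Prop :=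
  ∀ π : Equiv.Perm A, ¬ List.Lex (· < ·) (w.map π) w

/-- `Λ`: the set of normalized words that are proper prefixes of minimal squares of
period between `lo` and `hi`. -/
def Lam {A : Type*} [LinearOrder A] (lo hi : ℕ) : Set (List A) :=
  {w | Normalized w ∧ ∃ s : List A, MinSq lo hi s ∧ w <+: s ∧ w ≠ s}

/-- `Λ(w)`: the longest element of `Λ` that is, up to a permutation of the alphabet,
a suffix of `w`. -/
noncomputable def lamOf {A : Type*} [LinearOrder A] (lo hi : ℕ) (w : List A) : List A :=
  if h : ∃ v : List A,
      (v ∈ Lam lo hi ∧ ∃ π : Equiv.Perm A, v.map π <:+ w) ∧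
      ∀ v' : List A, (v' ∈ Lam lo hi ∧ ∃ π : Equiv.Perm A, v'.map π <:+ w) →
        v'.length ≤ v.length
  then h.choose else []

namespace SF
set_option linter.unusedVariables false

/-- letters -/
inductive A4 | la | lb | lc | ld
  deriving DecidableEq
instance : Fintype A4 := ⟨{.la, .lb, .lc, .ld}, fun x => by cases x <;> simp⟩
/-- indices of letters in order of first occurrence, `u` = not yet seen -/
inductive X | x0 | x1 | x2 | x3 | u
/-- tries -/
inductive Tr | e | n (c0 c1 c2 c3 : Tr) | h (v : ℕ) (t : Tr)
def Tr.a (t : Tr) : Tr := .n t .e .e .e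
def Tr.b (t : Tr) : Tr := .n .e t .e .e
def Tr.c (t : Tr) : Tr := .n .e .e t .e
def Tr.d (t : Tr) : Tr := .n .e .e .e t
def L (v : ℕ) : Tr := .h v .e
def H (v : ℕ) (t : Tr) : Tr := .h v t
def N := Tr.n
def e := Tr.e
inductive Mp | mk (m0 m1 m2 m3 nx : X)
/-- pointers into a trie -/
inductive Pt
  | v (x : ℕ)
  | p (f : ℕ) (c0 c1 c2 c3 : Pt) (b0 b1 b2 b3 : ℕ)
/-- rounds: bounds on the thresholds and sums, for the end of the word and for the next letter -/
inductive Rn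
  | v (h s : ℕ)
  | p (t a b c : Pt)
inductive RL | nil | cons (r : Rn) (m0 m1 m2 m3 nx : X) (l : RL)

noncomputable section

def bi (c t e : Bool) : Bool := Bool.rec (motive := fun _ => Bool) e t c
def nif (c : Bool) (t e : ℕ) : ℕ := Bool.rec (motive := fun _ => ℕ) e t c
def mn (a b : ℕ) : ℕ := nif (Nat.ble a b) a b

def thi (t : Tr) : ℕ → ℕ := Tr.rec (motive := fun _ => ℕ → ℕ) (fun h => h) (fun _ _ _ _ _ _ _ _ h => h)
  (fun v _ ih _ => ih v) t
def tlo (t : Tr) : ℕ → ℕ := Tr.rec (motive := fun _ => ℕ → ℕ) (fun h => h)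
  (fun _ _ _ _ i0 i1 i2 i3 h => mn (i0 h) (mn (i1 h) (mn (i2 h) (i3 h))))
  (fun v _ ih _ => ih v) t

abbrev MF := ℕ → Mp → Pt
/-- selection of the child according to the index of a letter -/
abbrev ZF := MF → MF → MF → MF → ℕ → Mp → X → (X → X → Mp) → Pt
def z0 : ZF := fun x _ _ _ h M _ _ => x h M
def z1 : ZF := fun _ x _ _ h M _ _ => x h M
def z2 : ZF := fun _ _ x _ h M _ _ => x h M
def z3 : ZF := fun _ _ _ x h M _ _ => x h M
def zu : ZF := fun i0 i1 i2 i3 h _ nx bl => X.rec (motive := fun _ => Pt) (i0 h (bl .x0 .x1)) (i1 h (bl .x1 .x2)) (i2 h (bl .x2 .x3)) (i3 h (bl .x3 .u)) (.v h) nx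
abbrev YF := Tr → Tr → Tr → Tr → X → Tr
def y0 : YF := fun x _ _ _ _ => x
def y1 : YF := fun _ x _ _ _ => x
def y2 : YF := fun _ _ x _ _ => x
def y3 : YF := fun _ _ _ x _ => x
def yu : YF := fun c0 c1 c2 c3 nx => X.rec (motive := fun _ => Tr) c0 c1 c2 c3 .e nx
def mla (m1 m2 m3 : X) : X → X → Mp := fun m0 nx => .mk m0 m1 m2 m3 nx
def pa (M : Mp) (i0 i1 i2 i3 : MF) (h : ℕ) : Pt := Mp.rec (motive := fun _ => Pt) (fun m0 m1 m2 m3 nx => X.rec (motive := fun _ => ZF) z0 z1 z2 z3 zu m0 i0 i1 i2 i3 h M nx (mla m1 m2 m3)) M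
def qa (bd : Tr → ℕ → ℕ) (M : Mp) (c0 c1 c2 c3 : Tr) (h : ℕ) : ℕ := bd (Mp.rec (motive := fun _ => Tr) (fun m0 m1 m2 m3 nx => X.rec (motive := fun _ => YF) y0 y1 y2 y3 yu m0 c0 c1 c2 c3 nx) M) h
def mlb (m0 m2 m3 : X) : X → X → Mp := fun m1 nx => .mk m0 m1 m2 m3 nx
def pb (M : Mp) (i0 i1 i2 i3 : MF) (h : ℕ) : Pt := Mp.rec (motive := fun _ => Pt) (fun m0 m1 m2 m3 nx => X.rec (motive := fun _ => ZF) z0 z1 z2 z3 zu m1 i0 i1 i2 i3 h M nx (mlb m0 m2 m3)) M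
def qb (bd : Tr → ℕ → ℕ) (M : Mp) (c0 c1 c2 c3 : Tr) (h : ℕ) : ℕ := bd (Mp.rec (motive := fun _ => Tr) (fun m0 m1 m2 m3 nx => X.rec (motive := fun _ => YF) y0 y1 y2 y3 yu m1 c0 c1 c2 c3 nx) M) h
def mlc (m0 m1 m3 : X) : X → X → Mp := fun m2 nx => .mk m0 m1 m2 m3 nx
def pc (M : Mp) (i0 i1 i2 i3 : MF) (h : ℕ) : Pt := Mp.rec (motive := fun _ => Pt) (fun m0 m1 m2 m3 nx => X.rec (motive := fun _ => ZF) z0 z1 z2 z3 zu m2 i0 i1 i2 i3 h M nx (mlc m0 m1 m3)) M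
def qc (bd : Tr → ℕ → ℕ) (M : Mp) (c0 c1 c2 c3 : Tr) (h : ℕ) : ℕ := bd (Mp.rec (motive := fun _ => Tr) (fun m0 m1 m2 m3 nx => X.rec (motive := fun _ => YF) y0 y1 y2 y3 yu m2 c0 c1 c2 c3 nx) M) h
def mld (m0 m1 m2 : X) : X → X → Mp := fun m3 nx => .mk m0 m1 m2 m3 nx
def pd (M : Mp) (i0 i1 i2 i3 : MF) (h : ℕ) : Pt := Mp.rec (motive := fun _ => Pt) (fun m0 m1 m2 m3 nx => X.rec (motive := fun _ => ZF) z0 z1 z2 z3 zu m3 i0 i1 i2 i3 h M nx (mld m0 m1 m2)) M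
def qd (bd : Tr → ℕ → ℕ) (M : Mp) (c0 c1 c2 c3 : Tr) (h : ℕ) : ℕ := bd (Mp.rec (motive := fun _ => Tr) (fun m0 m1 m2 m3 nx => X.rec (motive := fun _ => YF) y0 y1 y2 y3 yu m3 c0 c1 c2 c3 nx) M) h
def mk (bd : Tr → ℕ → ℕ) (t : Tr) : MF := Tr.rec (motive := fun _ => MF) (fun h _ => .v h)
  (fun c0 c1 c2 c3 i0 i1 i2 i3 h M => Pt.p h (pa M i0 i1 i2 i3 h) (pb M i0 i1 i2 i3 h) (pc M i0 i1 i2 i3 h) (pd M i0 i1 i2 i3 h)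
     (qa bd M c0 c1 c2 c3 h) (qb bd M c0 c1 c2 c3 h) (qc bd M c0 c1 c2 c3 h) (qd bd M c0 c1 c2 c3 h))
  (fun v _ ih _ => ih v) t

def ca (P : Pt) : Pt := Pt.rec (motive := fun _ => Pt) (fun x => .v x) (fun _ c0 _ _ _ _ _ _ _ _ _ _ _ => c0) P
def cb (P : Pt) : Pt := Pt.rec (motive := fun _ => Pt) (fun x => .v x) (fun _ _ c1 _ _ _ _ _ _ _ _ _ _ => c1) P
def cc (P : Pt) : Pt := Pt.rec (motive := fun _ => Pt) (fun x => .v x) (fun _ _ _ c2 _ _ _ _ _ _ _ _ _ => c2) P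
def cd (P : Pt) : Pt := Pt.rec (motive := fun _ => Pt) (fun x => .v x) (fun _ _ _ _ c3 _ _ _ _ _ _ _ _ => c3) P
def ba (P : Pt) : ℕ := Pt.rec (motive := fun _ => ℕ) (fun x => x) (fun _ _ _ _ _ b0 _ _ _ _ _ _ _ => b0) P
def bb (P : Pt) : ℕ := Pt.rec (motive := fun _ => ℕ) (fun x => x) (fun _ _ _ _ _ _ b1 _ _ _ _ _ _ => b1) P
def bc (P : Pt) : ℕ := Pt.rec (motive := fun _ => ℕ) (fun x => x) (fun _ _ _ _ _ _ _ b2 _ _ _ _ _ => b2) P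
def bd (P : Pt) : ℕ := Pt.rec (motive := fun _ => ℕ) (fun x => x) (fun _ _ _ _ _ _ _ _ b3 _ _ _ _ => b3) P
def be (P : Pt) : ℕ := Pt.rec (motive := fun _ => ℕ) (fun x => x) (fun f _ _ _ _ _ _ _ _ _ _ _ _ => f) P

def hs (x : ℕ) : ℕ := Nat.div (Nat.add (Nat.mul x (nat_lit 12914)) (nat_lit 6540)) (nat_lit 6541)
def tr (x : ℕ) : ℕ := Bool.rec (motive := fun _ => ℕ) (nat_lit 0) x (Nat.ble (nat_lit 4441) x)
def nxt (x : ℕ) : ℕ := tr (Nat.div (Nat.mul x (nat_lit 6541)) (nat_lit 12914))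
def s3 (a b c : ℕ) : ℕ := Nat.add (Nat.add a b) c
def cs (t : Pt) : (Bool → Pt → Rn) → Rn := Pt.rec (motive := fun _ => (Bool → Pt → Rn) → Rn) (fun x f => f true (.v x))
  (fun e c0 c1 c2 c3 b0 b1 b2 b3 _ _ _ _ f => f false (.p e c0 c1 c2 c3 b0 b1 b2 b3)) t
def rif (c : Bool) (x y : Rn) : Rn := Bool.rec (motive := fun _ => Rn) y x c
def mkR (t a b c : Pt) : Rn := cs t fun x t => cs a fun y a => cs b fun z b => cs c fun w c =>
  rif (bi x (bi y (bi z w false) false) false) (.v (hs (be t)) (s3 (be a) (be b) (be c))) (.p t a b c)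
def h0 (r : Rn) : ℕ := Rn.rec (motive := fun _ => ℕ) (fun h _ => h) (fun t _ _ _ => hs (ba t)) r
def s0 (r : Rn) : ℕ := Rn.rec (motive := fun _ => ℕ) (fun _ s => s) (fun _ a b c => s3 (ba a) (ba b) (ba c)) r
def c0 (r : Rn) : Rn := Rn.rec (motive := fun _ => Rn) (fun h s => .v h s) (fun t a b c => mkR (ca t) (ca a) (ca b) (ca c)) r
def h1 (r : Rn) : ℕ := Rn.rec (motive := fun _ => ℕ) (fun h _ => h) (fun t _ _ _ => hs (bb t)) r
def s1 (r : Rn) : ℕ := Rn.rec (motive := fun _ => ℕ) (fun _ s => s) (fun _ a b c => s3 (bb a) (bb b) (bb c)) r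
def c1 (r : Rn) : Rn := Rn.rec (motive := fun _ => Rn) (fun h s => .v h s) (fun t a b c => mkR (cb t) (cb a) (cb b) (cb c)) r
def h2 (r : Rn) : ℕ := Rn.rec (motive := fun _ => ℕ) (fun h _ => h) (fun t _ _ _ => hs (bc t)) r
def s2 (r : Rn) : ℕ := Rn.rec (motive := fun _ => ℕ) (fun _ s => s) (fun _ a b c => s3 (bc a) (bc b) (bc c)) r
def c2 (r : Rn) : Rn := Rn.rec (motive := fun _ => Rn) (fun h s => .v h s) (fun t a b c => mkR (cc t) (cc a) (cc b) (cc c)) r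
def h3 (r : Rn) : ℕ := Rn.rec (motive := fun _ => ℕ) (fun h _ => h) (fun t _ _ _ => hs (bd t)) r
def sd (r : Rn) : ℕ := Rn.rec (motive := fun _ => ℕ) (fun _ s => s) (fun _ a b c => s3 (bd a) (bd b) (bd c)) r
def c3 (r : Rn) : Rn := Rn.rec (motive := fun _ => Rn) (fun h s => .v h s) (fun t a b c => mkR (cd t) (cd a) (cd b) (cd c)) r
def he (r : Rn) : ℕ := Rn.rec (motive := fun _ => ℕ) (fun h _ => h) (fun t _ _ _ => hs (be t)) r
def se (r : Rn) : ℕ := Rn.rec (motive := fun _ => ℕ) (fun _ s => s) (fun _ a b c => s3 (be a) (be b) (be c)) r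
def ev (h x : ℕ) (J : ℕ → Bool) : Bool := Bool.rec (motive := fun _ => Bool) (J (nxt x)) true (Nat.ble h x)
abbrev IH := ℕ → (RL → Bool) → Bool
abbrev BL := X → X → Rn → RL → RL
abbrev KF := Rn → ℕ → IH → (RL → Bool) → X → X → BL → Bool
def k0 (r : Rn) (g : ℕ) (ih : IH) (K : RL → Bool) (m nx : X) (bl : BL) : Bool := ev (h0 r) (Nat.add g (s0 r)) fun g => ih g fun rs => K (bl m nx (c0 r) rs)
def k1 (r : Rn) (g : ℕ) (ih : IH) (K : RL → Bool) (m nx : X) (bl : BL) : Bool := ev (h1 r) (Nat.add g (s1 r)) fun g => ih g fun rs => K (bl m nx (c1 r) rs)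
def k2 (r : Rn) (g : ℕ) (ih : IH) (K : RL → Bool) (m nx : X) (bl : BL) : Bool := ev (h2 r) (Nat.add g (s2 r)) fun g => ih g fun rs => K (bl m nx (c2 r) rs)
def k3 (r : Rn) (g : ℕ) (ih : IH) (K : RL → Bool) (m nx : X) (bl : BL) : Bool := ev (h3 r) (Nat.add g (sd r)) fun g => ih g fun rs => K (bl m nx (c3 r) rs)
def u0 (r : Rn) (g : ℕ) (ih : IH) (K : RL → Bool) (bl : BL) : Bool := ev (h0 r) (Nat.add g (s0 r)) fun g => ih g fun rs => K (bl .x0 .x1 (c0 r) rs)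
def u1 (r : Rn) (g : ℕ) (ih : IH) (K : RL → Bool) (bl : BL) : Bool := ev (h1 r) (Nat.add g (s1 r)) fun g => ih g fun rs => K (bl .x1 .x2 (c1 r) rs)
def u2 (r : Rn) (g : ℕ) (ih : IH) (K : RL → Bool) (bl : BL) : Bool := ev (h2 r) (Nat.add g (s2 r)) fun g => ih g fun rs => K (bl .x2 .x3 (c2 r) rs)
def u3 (r : Rn) (g : ℕ) (ih : IH) (K : RL → Bool) (bl : BL) : Bool := ev (h3 r) (Nat.add g (sd r)) fun g => ih g fun rs => K (bl .x3 .u (c3 r) rs)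
def uu (r : Rn) (g : ℕ) (ih : IH) (K : RL → Bool) (_m nx : X) (bl : BL) : Bool :=
  X.rec (motive := fun _ => Rn → ℕ → IH → (RL → Bool) → BL → Bool) u0 u1 u2 u3 (fun _ _ _ _ _ => false) nx r g ih K bl
def bla (m1 m2 m3 : X) : BL := fun m0 nx r rs => .cons r m0 m1 m2 m3 nx rs
def ra (rs : RL) : IH := RL.rec (motive := fun _ => IH) (fun _ K => K .nil)
  (fun r m0 m1 m2 m3 nx _ ih g K => X.rec (motive := fun _ => KF) k0 k1 k2 k3 uu m0 r g ih K m0 nx (bla m1 m2 m3)) rs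
def blb (m0 m2 m3 : X) : BL := fun m1 nx r rs => .cons r m0 m1 m2 m3 nx rs
def rb (rs : RL) : IH := RL.rec (motive := fun _ => IH) (fun _ K => K .nil)
  (fun r m0 m1 m2 m3 nx _ ih g K => X.rec (motive := fun _ => KF) k0 k1 k2 k3 uu m1 r g ih K m1 nx (blb m0 m2 m3)) rs
def blc (m0 m1 m3 : X) : BL := fun m2 nx r rs => .cons r m0 m1 m2 m3 nx rs
def rc (rs : RL) : IH := RL.rec (motive := fun _ => IH) (fun _ K => K .nil)
  (fun r m0 m1 m2 m3 nx _ ih g K => X.rec (motive := fun _ => KF) k0 k1 k2 k3 uu m2 r g ih K m2 nx (blc m0 m1 m3)) rs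
def bld (m0 m1 m2 : X) : BL := fun m3 nx r rs => .cons r m0 m1 m2 m3 nx rs
def rd (rs : RL) : IH := RL.rec (motive := fun _ => IH) (fun _ K => K .nil)
  (fun r m0 m1 m2 m3 nx _ ih g K => X.rec (motive := fun _ => KF) k0 k1 k2 k3 uu m3 r g ih K m3 nx (bld m0 m1 m2)) rs
def re (rs : RL) : ℕ → Bool := RL.rec (motive := fun _ => ℕ → Bool) (fun _ => false)
  (fun r _ _ _ _ _ _ ih g => ev (he r) (Nat.add g (se r)) ih) rs
def nf (r : Rn) (K : Rn → Bool) : Bool := Rn.rec (motive := fun _ => Bool) (fun h s => K (.v h s))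
  (fun t a b c => K (.p t a b c)) r
def nfQ (rs : RL) : (RL → Bool) → Bool := RL.rec (motive := fun _ => (RL → Bool) → Bool) (fun K => K .nil)
  (fun r m0 m1 m2 m3 nx _ ih K => nf r fun r => ih fun l => K (.cons r m0 m1 m2 m3 nx l)) rs
def nfR (rs : RL) : ℕ → (ℕ → RL → Bool) → Bool := RL.rec (motive := fun _ => ℕ → (ℕ → RL → Bool) → Bool) (fun g K => K g .nil)
  (fun r m0 m1 m2 m3 nx l ih g K => Rn.rec (motive := fun _ => Bool) (fun _ s => ih (nxt (Nat.add g s)) K)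
   (fun t a b c => nfQ l fun l => K g (.cons (.p t a b c) m0 m1 m2 m3 nx l)) r) rs

/-- schedules -/
inductive Sch
  | nil
  | s (r : Sch)
  | p (r : Sch)
  | n (r : Sch)
  | w (m : ℕ) (r : Sch)
  | z (r : Sch)
/-- append a round at the end -/
def snoc (rs : RL) (r : Rn) (m0 m1 m2 m3 nx : X) : (RL → Bool) → Bool :=
  RL.rec (motive := fun _ => (RL → Bool) → Bool) (fun K => K (.cons r m0 m1 m2 m3 nx .nil))
    (fun r m0 m1 m2 m3 nx _ ih K => ih fun l => K (.cons r m0 m1 m2 m3 nx l)) rs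
def spa (R0 R1 : Rn) (c : A4) (K : RL → Bool) (rs : RL) : Bool := A4.rec (motive := fun _ => Bool)
  (snoc rs R0 .x0 .u .u .u .x1 K)
  (snoc rs R1 .x0 .x1 .u .u .x2 K)
  (snoc rs R1 .x0 .u .x1 .u .x2 K)
  (snoc rs R1 .x0 .u .u .x1 .x2 K)
  c
def spb (R0 R1 : Rn) (c : A4) (K : RL → Bool) (rs : RL) : Bool := A4.rec (motive := fun _ => Bool)
  (snoc rs R1 .x1 .x0 .u .u .x2 K)
  (snoc rs R0 .u .x0 .u .u .x1 K)
  (snoc rs R1 .u .x0 .x1 .u .x2 K)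
  (snoc rs R1 .u .x0 .u .x1 .x2 K)
  c
def spc (R0 R1 : Rn) (c : A4) (K : RL → Bool) (rs : RL) : Bool := A4.rec (motive := fun _ => Bool)
  (snoc rs R1 .x1 .u .x0 .u .x2 K)
  (snoc rs R1 .u .x1 .x0 .u .x2 K)
  (snoc rs R0 .u .u .x0 .u .x1 K)
  (snoc rs R1 .u .u .x0 .x1 .x2 K)
  c
def spd (R0 R1 : Rn) (c : A4) (K : RL → Bool) (rs : RL) : Bool := A4.rec (motive := fun _ => Bool)
  (snoc rs R1 .x1 .u .u .x0 .x2 K)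
  (snoc rs R1 .u .x1 .u .x0 .x2 K)
  (snoc rs R1 .u .u .x1 .x0 .x2 K)
  (snoc rs R0 .u .u .u .x0 .x1 K)
  c
def spw (R0 R1 : Rn) (e c : A4) (K : RL → Bool) (rs : RL) : Bool := A4.rec (motive := fun _ => Rn → Rn → A4 → (RL → Bool) → RL → Bool) spa spb spc spd e R0 R1 c K rs

abbrev BF := A4 → (RL → IH) → X → Bool
def brs (mx : X) : BF → Bool :=
  X.rec (motive := fun _ => BF → Bool)
    (fun B => B .la ra .x1)
    (fun B => bi (B .la ra .x1) (B .lb rb .x2) false)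
    (fun B => bi (B .la ra .x2) (bi (B .lb rb .x2) (B .lc rc .x3) false) false)
    (fun B => bi (B .la ra .x3) (bi (B .lb rb .x3) (bi (B .lc rc .x3) (B .ld rd .u) false) false) false)
    (fun B => bi (B .la ra .u) (bi (B .lb rb .u) (bi (B .lc rc .u) (B .ld rd .u) false) false) false) mx

/-- all continuations, at most `n` letters -/
def free (n : ℕ) : ℕ → RL → Bool := Nat.rec (motive := fun _ => ℕ → RL → Bool) (fun _ _ => false)
  (fun _ ih g rs => bi (re rs g) (bi (ra rs g (ih g)) (bi (rb rs g (ih g)) (bi (rc rs g (ih g)) (rd rs g (ih g)) false) false) false) false) n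

/-- continue along a given word -/
def walk (m : ℕ) (l : List A4) : ℕ → RL → Bool := List.rec (motive := fun _ => ℕ → RL → Bool) (free m)
  (fun x _ ih g rs => A4.rec (motive := fun _ => RL → IH) ra rb rc rd x rs g fun rs => nfR rs g ih) l

def rv (l : List A4) : List A4 → List A4 := List.rec (motive := fun _ => List A4 → List A4) (fun a => a) (fun x _ ih a => ih (x :: a)) l
def pat (l : List A4) : List A4 := List.rec (motive := fun _ => List A4) [] (fun _ t _ => rv t []) l

abbrev DF := List A4 → A4 → X → ℕ → RL → Bool
def dfs (R0 R1 R2 : Rn) (S : Sch) : DF := Sch.rec (motive := fun _ => DF)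
  (fun _ _ _ _ _ => true)
  (fun _ ih w _ mx g rs => brs mx fun l r mx => r rs g (ih (l :: w) l mx g))
  (fun _ ih w e mx g rs => brs mx fun l r mx => r rs g (spw R0 R1 e l (ih (l :: w) l mx g)))
  (fun _ ih w e mx g rs => nfR rs g (ih w e mx))
  (fun m _ ih w e mx g rs => bi (walk m (pat w) g rs) (ih w e mx g rs) false)
  (fun _ ih w e mx g rs => snoc rs R2 .u .u .u .u .x0 (ih w e mx g))
  S

def rt (t : Tr) : Pt := mk thi t (nat_lit 10635) (.mk .u .u .u .u .x0)
def rS (t : Tr) : Pt := mk tlo t (nat_lit 10635) (.mk .u .u .u .u .x0)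
def goB (S : Sch) (t : Tr) : Bool :=
  dfs (mkR (rt t) (ca (cb (rS t))) (ca (cc (rS t))) (ca (cd (rS t))))
    (mkR (rt t) (cb (cb (rS t))) (cb (cc (rS t))) (cb (cd (rS t)))) (.v (nat_lit 30000) (nat_lit 0)) S [] .la .x0 (nat_lit 0) .nil
/-- well-formedness of a trie -/
def wf (t : Tr) : ℕ → Bool := Tr.rec (motive := fun _ => ℕ → Bool) (fun _ => true)
  (fun _ _ _ _ i0 i1 i2 i3 h => bi (i0 h) (bi (i1 h) (bi (i2 h) (i3 h) false) false) false)
  (fun v _ ih h => bi (Nat.ble v h) (bi (bi (Nat.ble v (nat_lit 0)) true (Nat.ble (nat_lit 4441) v)) (ih v) false) false) t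

def nP (P : Pt) (K : Pt → Bool) : Bool := Pt.rec (motive := fun _ => Bool) (fun x => K (.v x))
  (fun e c0 c1 c2 c3 b0 b1 b2 b3 _ _ _ _ => K (.p e c0 c1 c2 c3 b0 b1 b2 b3)) P
abbrev CF := A4 → (Pt → Pt) → (Pt → ℕ) → X → Bool
def brA (mx : X) : CF → Bool :=
  X.rec (motive := fun _ => CF → Bool)
    (fun B => B .la ca ba .x1)
    (fun B => bi (B .la ca ba .x1) (B .lb cb bb .x2) false)
    (fun B => bi (B .la ca ba .x2) (bi (B .lb cb bb .x2) (B .lc cc bc .x3) false) false)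
    (fun B => bi (B .la ca ba .x3) (bi (B .lb cb bb .x3) (bi (B .lc cc bc .x3) (B .ld cd bd .u) false) false) false)
    (fun B => bi (B .la ca ba .u) (bi (B .lb cb bb .u) (bi (B .lc cc bc .u) (B .ld cd bd .u) false) false) false) mx
def leA (f : Pt → ℕ) (t a b c d : Pt) : Bool := Nat.ble (hs (f t)) (Nat.add (s3 (f a) (f b) (f c)) (f d))
def dA (n : ℕ) : X → Pt → Pt → Pt → Pt → Pt → Bool := Nat.rec (motive := fun _ => X → Pt → Pt → Pt → Pt → Pt → Bool)
  (fun _ _ _ _ _ _ => false)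
  (fun _ ih mx t a b c d => bi (leA be t a b c d)
    (brA mx fun _ C f mx => bi (leA f t a b c d) true
      (nP (C t) fun t => nP (C a) fun a => nP (C b) fun b => nP (C c) fun c => nP (C d) fun d => ih mx t a b c d)) false) n
def goA (t : Tr) : Bool := dA (nat_lit 60) .x1 (rt t) (ca (ca (rS t))) (ca (cb (rS t))) (ca (cc (rS t))) (ca (cd (rS t)))
def goD (S : Sch) (t : Tr) : Bool :=
  dfs (.v (nat_lit 30000) (nat_lit 0)) (.v (nat_lit 30000) (nat_lit 0))
    (mkR (rt t) (.v (nat_lit 0)) (.v (nat_lit 0)) (.v (nat_lit 0))) S [] .la .x0 (nat_lit 0) .nil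
def goW (t : Tr) : Bool := wf t (nat_lit 10635)
end


/-! ### Semantics of tries and pointers -/

noncomputable section

/-- value of a word (letters renamed in order of first occurrence) -/
def look : Tr → ℕ → (A4 → X) → X → List A4 → ℕ
  | .e, h, _, _, _ => h
  | .h v t, _, f, nx, w => look t v f nx w
  | .n _ _ _ _, h, _, _, [] => h
  | .n c0 c1 c2 c3, h, f, nx, a :: w =>
    match f a with
    | .x0 => look c0 h f nx w
    | .x1 => look c1 h f nx w
    | .x2 => look c2 h f nx w
    | .x3 => look c3 h f nx w
    | .u =>
      match nx with
      | .x0 => look c0 h (Function.update f a .x0) .x1 w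
      | .x1 => look c1 h (Function.update f a .x1) .x2 w
      | .x2 => look c2 h (Function.update f a .x2) .x3 w
      | .x3 => look c3 h (Function.update f a .x3) .u w
      | .u => h

@[simp] theorem bi_eq (c t e : Bool) : bi c t e = bif c then t else e := by cases c <;> rfl
theorem and_of_bi {c t : Bool} (h : bi c t false = true) : c = true ∧ t = true := by
  cases c <;> simp_all
@[simp] theorem mn_eq (a b : ℕ) : mn a b = min a b := by
  unfold mn nif
  rcases h : Nat.ble a b with _ | _
  · have : ¬ a ≤ b := by
      intro h'; rw [Nat.ble_eq_true_of_le h'] at h; cases h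
    simp only [min_def, if_neg this]
  · have := Nat.le_of_ble_eq_true h
    simp only [min_def, if_pos this]

theorem wf_n {c0 c1 c2 c3 : Tr} {h : ℕ} (H : wf (.n c0 c1 c2 c3) h = true) :
    wf c0 h = true ∧ wf c1 h = true ∧ wf c2 h = true ∧ wf c3 h = true := by
  have H' : bi (wf c0 h) (bi (wf c1 h) (bi (wf c2 h) (wf c3 h) false) false) false = true := H
  obtain ⟨h0, H'⟩ := and_of_bi H'
  obtain ⟨h1, H'⟩ := and_of_bi H'
  obtain ⟨h2, H'⟩ := and_of_bi H'
  exact ⟨h0, h1, h2, H'⟩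

theorem wf_h {v h : ℕ} {t : Tr} (H : wf (.h v t) h = true) :
    v ≤ h ∧ (v = 0 ∨ 4441 ≤ v) ∧ wf t v = true := by
  have H' : bi (Nat.ble v h) (bi (bi (Nat.ble v 0) true (Nat.ble 4441 v)) (wf t v) false) false = true := H
  obtain ⟨h0, H'⟩ := and_of_bi H'
  obtain ⟨h1, H'⟩ := and_of_bi H'
  refine ⟨Nat.le_of_ble_eq_true h0, ?_, H'⟩
  rcases h : Nat.ble v 0 with _ | _
  · rw [h] at h1
    exact Or.inr (Nat.le_of_ble_eq_true h1)
  · exact Or.inl (Nat.le_zero.mp (Nat.le_of_ble_eq_true h))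

theorem look_le (t : Tr) : ∀ (h : ℕ) (f : A4 → X) (nx : X) (w : List A4), wf t h = true →
    look t h f nx w ≤ h := by
  induction t with
  | e => intro h f nx w _; simp [look]
  | h v t ih => intro h f nx w H; obtain ⟨h1, _, h3⟩ := wf_h H; exact (ih v f nx w h3).trans h1
  | n c0 c1 c2 c3 i0 i1 i2 i3 =>
    intro h f nx w H
    obtain ⟨h0, h1, h2, h3⟩ := wf_n H
    cases w with
    | nil => simp [look]
    | cons a w =>
      simp only [look]
      split
      · exact i0 _ _ _ _ h0
      · exact i1 _ _ _ _ h1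
      · exact i2 _ _ _ _ h2
      · exact i3 _ _ _ _ h3
      · split
        · exact i0 _ _ _ _ h0
        · exact i1 _ _ _ _ h1
        · exact i2 _ _ _ _ h2
        · exact i3 _ _ _ _ h3
        · exact le_rfl

theorem look_anti (t : Tr) : ∀ (h : ℕ) (f : A4 → X) (nx : X) (w y : List A4), wf t h = true →
    look t h f nx (w ++ y) ≤ look t h f nx w := by
  induction t with
  | e => intro h f nx w y _; simp [look]
  | h v t ih => intro h f nx w y H; exact ih v f nx w y (wf_h H).2.2
  | n c0 c1 c2 c3 i0 i1 i2 i3 =>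
    intro h f nx w y H
    obtain ⟨h0, h1, h2, h3⟩ := wf_n H
    cases w with
    | nil => exact look_le _ _ _ _ _ H
    | cons a w =>
      simp only [look, List.cons_append]
      split
      · exact i0 _ _ _ _ _ h0
      · exact i1 _ _ _ _ _ h1
      · exact i2 _ _ _ _ _ h2
      · exact i3 _ _ _ _ _ h3
      · split
        · exact i0 _ _ _ _ _ h0
        · exact i1 _ _ _ _ _ h1
        · exact i2 _ _ _ _ _ h2
        · exact i3 _ _ _ _ _ h3
        · exact le_rfl

theorem look_range (t : Tr) : ∀ (h : ℕ) (f : A4 → X) (nx : X) (w : List A4), wf t h = true →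
    (h = 0 ∨ 4441 ≤ h) → (look t h f nx w = 0 ∨ 4441 ≤ look t h f nx w) := by
  induction t with
  | e => intro h f nx w _; simp [look]
  | h v t ih => intro h f nx w H _; exact ih v f nx w (wf_h H).2.2 (wf_h H).2.1
  | n c0 c1 c2 c3 i0 i1 i2 i3 =>
    intro h f nx w H hh
    obtain ⟨h0, h1, h2, h3⟩ := wf_n H
    cases w with
    | nil => exact hh
    | cons a w =>
      simp only [look]
      split
      · exact i0 _ _ _ _ h0 hh
      · exact i1 _ _ _ _ h1 hh
      · exact i2 _ _ _ _ h2 hh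
      · exact i3 _ _ _ _ h3 hh
      · split
        · exact i0 _ _ _ _ h0 hh
        · exact i1 _ _ _ _ h1 hh
        · exact i2 _ _ _ _ h2 hh
        · exact i3 _ _ _ _ h3 hh
        · exact hh

theorem look_perm (t : Tr) : ∀ (h : ℕ) (f f' : A4 → X) (nx : X) (w : List A4) (π : Equiv.Perm A4),
    (∀ a, f' (π a) = f a) → look t h f' nx (w.map π) = look t h f nx w := by
  induction t with
  | e => intro h f f' nx w π _; simp [look]
  | h v t ih => intro h f f' nx w π H; exact ih v f f' nx w π H
  | n c0 c1 c2 c3 i0 i1 i2 i3 =>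
    intro h f f' nx w π H
    have H' : ∀ a x b, Function.update f' (π a) x (π b) = Function.update f a x b := by
      intro a x b
      by_cases hb : b = a
      · subst hb; simp
      · rw [Function.update_of_ne hb, Function.update_of_ne (fun h => hb (π.injective h)), H]
    cases w with
    | nil => rfl
    | cons a w =>
      simp only [look, List.map_cons, H a]
      split
      · exact i0 _ _ _ _ _ _ H
      · exact i1 _ _ _ _ _ _ H
      · exact i2 _ _ _ _ _ _ H
      · exact i3 _ _ _ _ _ _ H
      · split
        · exact i0 _ _ _ _ _ _ (H' a _)
        · exact i1 _ _ _ _ _ _ (H' a _)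
        · exact i2 _ _ _ _ _ _ (H' a _)
        · exact i3 _ _ _ _ _ _ (H' a _)
        · rfl

theorem thi_spec (t : Tr) : ∀ (h : ℕ) (f : A4 → X) (nx : X) (w : List A4), wf t h = true →
    look t h f nx w ≤ thi t h := by
  induction t with
  | e => intro h f nx w _; exact le_rfl
  | h v t ih => intro h f nx w H; exact ih v f nx w (wf_h H).2.2
  | n c0 c1 c2 c3 _ _ _ _ => intro h f nx w H; exact look_le _ _ _ _ _ H

theorem tlo_n (c0 c1 c2 c3 : Tr) (h : ℕ) :
    tlo (.n c0 c1 c2 c3) h = min (tlo c0 h) (min (tlo c1 h) (min (tlo c2 h) (tlo c3 h))) := by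
  change mn (tlo c0 h) (mn (tlo c1 h) (mn (tlo c2 h) (tlo c3 h))) = _
  simp only [mn_eq]

theorem tlo_le (t : Tr) : ∀ h : ℕ, wf t h = true → tlo t h ≤ h := by
  induction t with
  | e => intro h _; exact le_rfl
  | h v t ih => intro h H; exact (ih v (wf_h H).2.2).trans (wf_h H).1
  | n c0 c1 c2 c3 i0 _ _ _ =>
    intro h H
    rw [tlo_n]
    exact (min_le_left _ _).trans (i0 h (wf_n H).1)

theorem tlo_spec (t : Tr) : ∀ (h : ℕ) (f : A4 → X) (nx : X) (w : List A4), wf t h = true →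
    tlo t h ≤ look t h f nx w := by
  induction t with
  | e => intro h f nx w _; exact le_rfl
  | h v t ih => intro h f nx w H; exact ih v f nx w (wf_h H).2.2
  | n c0 c1 c2 c3 i0 i1 i2 i3 =>
    intro h f nx w H
    obtain ⟨h0, h1, h2, h3⟩ := wf_n H
    cases w with
    | nil => exact tlo_le _ _ H
    | cons a w =>
      rw [tlo_n]
      have e0 : ∀ x, tlo c0 h ≤ x → min (tlo c0 h) (min (tlo c1 h) (min (tlo c2 h) (tlo c3 h))) ≤ x :=
        fun x hx => by omega
      have e1 : ∀ x, tlo c1 h ≤ x → min (tlo c0 h) (min (tlo c1 h) (min (tlo c2 h) (tlo c3 h))) ≤ x :=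
        fun x hx => by omega
      have e2 : ∀ x, tlo c2 h ≤ x → min (tlo c0 h) (min (tlo c1 h) (min (tlo c2 h) (tlo c3 h))) ≤ x :=
        fun x hx => by omega
      have e3 : ∀ x, tlo c3 h ≤ x → min (tlo c0 h) (min (tlo c1 h) (min (tlo c2 h) (tlo c3 h))) ≤ x :=
        fun x hx => by omega
      simp only [look]
      split
      · exact e0 _ (i0 _ _ _ _ h0)
      · exact e1 _ (i1 _ _ _ _ h1)
      · exact e2 _ (i2 _ _ _ _ h2)
      · exact e3 _ (i3 _ _ _ _ h3)
      · split
        · exact e0 _ (i0 _ _ _ _ h0)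
        · exact e1 _ (i1 _ _ _ _ h1)
        · exact e2 _ (i2 _ _ _ _ h2)
        · exact e3 _ (i3 _ _ _ _ h3)
        · exact e0 _ (tlo_le _ _ h0)

/-- a pointer bounds a function on words -/
def BD (R : ℕ → ℕ → Prop) : Pt → (List A4 → ℕ) → Prop
  | .v x, f => ∀ w, R (f w) x
  | .p e c0 c1 c2 c3 b0 b1 b2 b3, f => R (f []) e ∧
      ((∀ w, R (f (.la :: w)) b0) ∧ (∀ w, R (f (.lb :: w)) b1) ∧ (∀ w, R (f (.lc :: w)) b2) ∧
        (∀ w, R (f (.ld :: w)) b3)) ∧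
      BD R c0 (fun w => f (.la :: w)) ∧ BD R c1 (fun w => f (.lb :: w)) ∧
      BD R c2 (fun w => f (.lc :: w)) ∧ BD R c3 (fun w => f (.ld :: w))

/-- child of a pointer -/
def pch : A4 → Pt → Pt | .la => ca | .lb => cb | .lc => cc | .ld => cd
/-- bound of a pointer -/
def pbd : A4 → Pt → ℕ | .la => ba | .lb => bb | .lc => bc | .ld => bd

theorem BD.ch {R : ℕ → ℕ → Prop} {P : Pt} {f : List A4 → ℕ} (h : BD R P f) (a : A4) :
    BD R (pch a P) (fun w => f (a :: w)) := by
  cases P with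
  | v x => cases a <;> exact fun w => h _
  | p e c0 c1 c2 c3 b0 b1 b2 b3 =>
    obtain ⟨_, _, h0, h1, h2, h3⟩ := h
    cases a <;> assumption

theorem BD.bd {R : ℕ → ℕ → Prop} {P : Pt} {f : List A4 → ℕ} (h : BD R P f) (a : A4) (w : List A4) :
    R (f (a :: w)) (pbd a P) := by
  cases P with
  | v x => cases a <;> exact h _
  | p e c0 c1 c2 c3 b0 b1 b2 b3 =>
    obtain ⟨_, ⟨h0, h1, h2, h3⟩, _⟩ := h
    cases a
    · exact h0 w
    · exact h1 w
    · exact h2 w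
    · exact h3 w

theorem BD.be {R : ℕ → ℕ → Prop} {P : Pt} {f : List A4 → ℕ} (h : BD R P f) : R (f []) (be P) := by
  cases P with
  | v x => exact h _
  | p e c0 c1 c2 c3 b0 b1 b2 b3 => exact h.1

def Mp.f : Mp → A4 → X | .mk m0 m1 m2 m3 _ => fun a => match a with | .la => m0 | .lb => m1 | .lc => m2 | .ld => m3
def Mp.nx : Mp → X | .mk _ _ _ _ nx => nx

theorem mk_BD {R : ℕ → ℕ → Prop} {bd : Tr → ℕ → ℕ} (hR : ∀ x, R x x)
    (hbd : ∀ (t : Tr) (h : ℕ) (f : A4 → X) (nx : X) (w : List A4), wf t h = true → R (look t h f nx w) (bd t h))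
    (hbe : ∀ h, R h (bd .e h)) (t : Tr) :
    ∀ (h : ℕ) (M : Mp), wf t h = true → BD R (mk bd t h M) (look t h M.f M.nx) := by
  induction t with
  | e => intro h M _ w; exact hR _
  | h v t ih => intro h M H; exact ih v M (wf_h H).2.2
  | n c0 c1 c2 c3 i0 i1 i2 i3 =>
    intro h M H
    obtain ⟨h0, h1, h2, h3⟩ := wf_n H
    obtain ⟨m0, m1, m2, m3, nx⟩ := M
    have u0 : ∀ x y z u v x' v', Function.update (Mp.mk x y z u v).f .la x' = (Mp.mk x' y z u v').f := by
      intros; funext a; cases a <;> rfl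
    have u1 : ∀ x y z u v x' v', Function.update (Mp.mk x y z u v).f .lb x' = (Mp.mk x x' z u v').f := by
      intros; funext a; cases a <;> rfl
    have u2 : ∀ x y z u v x' v', Function.update (Mp.mk x y z u v).f .lc x' = (Mp.mk x y x' u v').f := by
      intros; funext a; cases a <;> rfl
    have u3 : ∀ x y z u v x' v', Function.update (Mp.mk x y z u v).f .ld x' = (Mp.mk x y z x' v').f := by
      intros; funext a; cases a <;> rfl
    refine ⟨hR _, ⟨?_, ?_, ?_, ?_⟩, ?_, ?_, ?_, ?_⟩
    · intro w
      cases m0 <;> first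
        | exact hbd c0 h _ _ w h0
        | exact hbd c1 h _ _ w h1
        | exact hbd c2 h _ _ w h2
        | exact hbd c3 h _ _ w h3
        | (cases nx <;> first
            | exact hbd c0 h _ _ w h0
            | exact hbd c1 h _ _ w h1
            | exact hbd c2 h _ _ w h2
            | exact hbd c3 h _ _ w h3
            | exact hbe h)
    · intro w
      cases m1 <;> first
        | exact hbd c0 h _ _ w h0
        | exact hbd c1 h _ _ w h1
        | exact hbd c2 h _ _ w h2
        | exact hbd c3 h _ _ w h3
        | (cases nx <;> first
            | exact hbd c0 h _ _ w h0
            | exact hbd c1 h _ _ w h1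
            | exact hbd c2 h _ _ w h2
            | exact hbd c3 h _ _ w h3
            | exact hbe h)
    · intro w
      cases m2 <;> first
        | exact hbd c0 h _ _ w h0
        | exact hbd c1 h _ _ w h1
        | exact hbd c2 h _ _ w h2
        | exact hbd c3 h _ _ w h3
        | (cases nx <;> first
            | exact hbd c0 h _ _ w h0
            | exact hbd c1 h _ _ w h1
            | exact hbd c2 h _ _ w h2
            | exact hbd c3 h _ _ w h3
            | exact hbe h)
    · intro w
      cases m3 <;> first
        | exact hbd c0 h _ _ w h0
        | exact hbd c1 h _ _ w h1
        | exact hbd c2 h _ _ w h2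
        | exact hbd c3 h _ _ w h3
        | (cases nx <;> first
            | exact hbd c0 h _ _ w h0
            | exact hbd c1 h _ _ w h1
            | exact hbd c2 h _ _ w h2
            | exact hbd c3 h _ _ w h3
            | exact hbe h)
    · cases m0
      · exact i0 h _ h0
      · exact i1 h _ h1
      · exact i2 h _ h2
      · exact i3 h _ h3
      · cases nx
        · have := i0 h (.mk .x0 m1 m2 m3 .x1) h0
          rw [← u0 .u m1 m2 m3 .x0 .x0 .x1] at this; exact this
        · have := i1 h (.mk .x1 m1 m2 m3 .x2) h1
          rw [← u0 .u m1 m2 m3 .x1 .x1 .x2] at this; exact this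
        · have := i2 h (.mk .x2 m1 m2 m3 .x3) h2
          rw [← u0 .u m1 m2 m3 .x2 .x2 .x3] at this; exact this
        · have := i3 h (.mk .x3 m1 m2 m3 .u) h3
          rw [← u0 .u m1 m2 m3 .x3 .x3 .u] at this; exact this
        · exact fun w => hR _
    · cases m1
      · exact i0 h _ h0
      · exact i1 h _ h1
      · exact i2 h _ h2
      · exact i3 h _ h3
      · cases nx
        · have := i0 h (.mk m0 .x0 m2 m3 .x1) h0
          rw [← u1 m0 .u m2 m3 .x0 .x0 .x1] at this; exact this
        · have := i1 h (.mk m0 .x1 m2 m3 .x2) h1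
          rw [← u1 m0 .u m2 m3 .x1 .x1 .x2] at this; exact this
        · have := i2 h (.mk m0 .x2 m2 m3 .x3) h2
          rw [← u1 m0 .u m2 m3 .x2 .x2 .x3] at this; exact this
        · have := i3 h (.mk m0 .x3 m2 m3 .u) h3
          rw [← u1 m0 .u m2 m3 .x3 .x3 .u] at this; exact this
        · exact fun w => hR _
    · cases m2
      · exact i0 h _ h0
      · exact i1 h _ h1
      · exact i2 h _ h2
      · exact i3 h _ h3
      · cases nx
        · have := i0 h (.mk m0 m1 .x0 m3 .x1) h0
          rw [← u2 m0 m1 .u m3 .x0 .x0 .x1] at this; exact this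
        · have := i1 h (.mk m0 m1 .x1 m3 .x2) h1
          rw [← u2 m0 m1 .u m3 .x1 .x1 .x2] at this; exact this
        · have := i2 h (.mk m0 m1 .x2 m3 .x3) h2
          rw [← u2 m0 m1 .u m3 .x2 .x2 .x3] at this; exact this
        · have := i3 h (.mk m0 m1 .x3 m3 .u) h3
          rw [← u2 m0 m1 .u m3 .x3 .x3 .u] at this; exact this
        · exact fun w => hR _
    · cases m3
      · exact i0 h _ h0
      · exact i1 h _ h1
      · exact i2 h _ h2
      · exact i3 h _ h3
      · cases nx
        · have := i0 h (.mk m0 m1 m2 .x0 .x1) h0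
          rw [← u3 m0 m1 m2 .u .x0 .x0 .x1] at this; exact this
        · have := i1 h (.mk m0 m1 m2 .x1 .x2) h1
          rw [← u3 m0 m1 m2 .u .x1 .x1 .x2] at this; exact this
        · have := i2 h (.mk m0 m1 m2 .x2 .x3) h2
          rw [← u3 m0 m1 m2 .u .x2 .x2 .x3] at this; exact this
        · have := i3 h (.mk m0 m1 m2 .x3 .u) h3
          rw [← u3 m0 m1 m2 .u .x3 .x3 .u] at this; exact this
        · exact fun w => hR _

/-- the weight of a word given by a trie -/
def TW (t : Tr) (w : List A4) : ℕ := look t 10635 (fun _ => .u) .x0 w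

theorem Mp_f0 : (Mp.mk .u .u .u .u .x0).f = fun _ => X.u := by funext a; cases a <;> rfl

theorem rt_BD {t : Tr} (H : goW t = true) : BD (fun x y => x ≤ y) (rt t) (TW t) := by
  have := mk_BD (R := fun x y => x ≤ y) (bd := thi) (fun _ => le_rfl)
    (fun t h f nx w => thi_spec t h f nx w) (fun _ => le_rfl) t 10635 (.mk .u .u .u .u .x0) H
  rw [Mp_f0] at this
  exact this
theorem rS_BD {t : Tr} (H : goW t = true) : BD (fun x y => y ≤ x) (rS t) (TW t) := by
  have := mk_BD (R := fun x y => y ≤ x) (bd := tlo) (fun _ => le_rfl)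
    (fun t h f nx w => tlo_spec t h f nx w) (fun _ => le_rfl) t 10635 (.mk .u .u .u .u .x0) H
  rw [Mp_f0] at this
  exact this
theorem TW_perm (t : Tr) (w : List A4) (π : Equiv.Perm A4) : TW t (w.map π) = TW t w :=
  look_perm t _ _ _ _ _ _ fun _ => rfl
theorem TW_anti {t : Tr} (H : goW t = true) (w y : List A4) : TW t (w ++ y) ≤ TW t w :=
  look_anti t _ _ _ _ _ H
theorem TW_le {t : Tr} (H : goW t = true) (w : List A4) : TW t w ≤ 10635 :=
  look_le t _ _ _ _ H
theorem TW_range {t : Tr} (H : goW t = true) (w : List A4) : TW t w = 0 ∨ 4441 ≤ TW t w :=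
  look_range t _ _ _ _ H (Or.inr (by norm_num))
end


/-! ### Semantics of rounds -/

noncomputable section

theorem hs_eq (x : ℕ) : hs x = (x * 12914 + 6540) / 6541 := rfl
theorem tr_eq (x : ℕ) : tr x = if 4441 ≤ x then x else 0 := by
  unfold tr
  rcases h : Nat.ble 4441 x with _ | _
  · have : ¬ 4441 ≤ x := by
      intro h'; rw [Nat.ble_eq_true_of_le h'] at h; cases h
    rw [if_neg this]
  · rw [if_pos (Nat.le_of_ble_eq_true h)]
theorem nxt_eq (x : ℕ) : nxt x = if 4441 ≤ x * 6541 / 12914 then x * 6541 / 12914 else 0 := tr_eq _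
theorem nxt_mono {x y : ℕ} (h : x ≤ y) : nxt x ≤ nxt y := by
  rw [nxt_eq, nxt_eq]
  have : x * 6541 / 12914 ≤ y * 6541 / 12914 := Nat.div_le_div_right (Nat.mul_le_mul_right _ h)
  split_ifs <;> omega
theorem hs_mono {x y : ℕ} (h : x ≤ y) : hs x ≤ hs y := by
  rw [hs_eq, hs_eq]; exact Nat.div_le_div_right (by omega)

/-- a round bounds two functions -/
def RB : Rn → (List A4 → ℕ) → (List A4 → ℕ) → Prop
  | .v h s, F, G => (∀ w, hs (F w) ≤ h) ∧ ∀ w, s ≤ G w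
  | .p t a b c, F, G => BD (fun x y => x ≤ y) t F ∧ ∃ fa fb fc : List A4 → ℕ,
      BD (fun x y => y ≤ x) a fa ∧ BD (fun x y => y ≤ x) b fb ∧ BD (fun x y => y ≤ x) c fc ∧
      ∀ w, G w = fa w + fb w + fc w

/-- child, threshold, sum of a round -/
def rch : A4 → Rn → Rn | .la => c0 | .lb => c1 | .lc => c2 | .ld => c3
def rth : A4 → Rn → ℕ | .la => h0 | .lb => h1 | .lc => h2 | .ld => h3
def rsm : A4 → Rn → ℕ | .la => s0 | .lb => s1 | .lc => s2 | .ld => sd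

theorem cs_spec (t : Pt) (f : Bool → Pt → Rn) : ∃ x, cs t f = f x t := by
  cases t
  · exact ⟨true, rfl⟩
  · exact ⟨false, rfl⟩
theorem cs_spec' (t : Pt) (f : Bool → Pt → Rn) : (cs t f = f true t ∧ ∃ x, t = .v x) ∨ cs t f = f false t := by
  cases t
  · exact Or.inl ⟨rfl, _, rfl⟩
  · exact Or.inr rfl

theorem mkR_RB {t a b c : Pt} {F G fa fb fc : List A4 → ℕ} (ht : BD (fun x y => x ≤ y) t F)
    (ha : BD (fun x y => y ≤ x) a fa) (hb : BD (fun x y => y ≤ x) b fb) (hc : BD (fun x y => y ≤ x) c fc)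
    (hG : ∀ w, G w = fa w + fb w + fc w) : RB (mkR t a b c) F G := by
  have hp : RB (.p t a b c) F G := ⟨ht, fa, fb, fc, ha, hb, hc, hG⟩
  unfold mkR
  rcases cs_spec' t (fun x t => cs a fun y a => cs b fun z b => cs c fun w c =>
    rif (bi x (bi y (bi z w false) false) false) (.v (hs (be t)) (s3 (be a) (be b) (be c))) (.p t a b c))
    with ⟨h, x, rfl⟩ | h
  swap
  · rw [h]
    obtain ⟨_, h⟩ := cs_spec a (fun y a => cs b fun z b => cs c fun w c =>
      rif (bi false (bi y (bi z w false) false) false) (.v (hs (be t)) (s3 (be a) (be b) (be c))) (.p t a b c))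
    rw [h]
    obtain ⟨_, h⟩ := cs_spec b (fun z b => cs c fun w c =>
      rif (bi false (bi _ (bi z w false) false) false) (.v (hs (be t)) (s3 (be a) (be b) (be c))) (.p t a b c))
    rw [h]
    obtain ⟨_, h⟩ := cs_spec c (fun w c =>
      rif (bi false (bi _ (bi _ w false) false) false) (.v (hs (be t)) (s3 (be a) (be b) (be c))) (.p t a b c))
    rw [h]
    exact hp
  rw [h]
  rcases cs_spec' a (fun y a => cs b fun z b => cs c fun w c =>
    rif (bi true (bi y (bi z w false) false) false) (.v (hs (be (.v x))) (s3 (be a) (be b) (be c))) (.p (.v x) a b c))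
    with ⟨h, xa, rfl⟩ | h
  swap
  · rw [h]
    obtain ⟨_, h⟩ := cs_spec b (fun z b => cs c fun w c =>
      rif (bi true (bi false (bi z w false) false) false) (.v (hs (be (.v x))) (s3 (be a) (be b) (be c))) (.p (.v x) a b c))
    rw [h]
    obtain ⟨_, h⟩ := cs_spec c (fun w c =>
      rif (bi true (bi false (bi _ w false) false) false) (.v (hs (be (.v x))) (s3 (be a) (be b) (be c))) (.p (.v x) a b c))
    rw [h]
    exact hp
  rw [h]
  rcases cs_spec' b (fun z b => cs c fun w c =>
    rif (bi true (bi true (bi z w false) false) false) (.v (hs (be (.v x))) (s3 (be (.v xa)) (be b) (be c))) (.p (.v x) (.v xa) b c))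
    with ⟨h, xb, rfl⟩ | h
  swap
  · rw [h]
    obtain ⟨_, h⟩ := cs_spec c (fun w c =>
      rif (bi true (bi true (bi false w false) false) false) (.v (hs (be (.v x))) (s3 (be (.v xa)) (be b) (be c))) (.p (.v x) (.v xa) b c))
    rw [h]
    exact hp
  rw [h]
  rcases cs_spec' c (fun w c =>
    rif (bi true (bi true (bi true w false) false) false) (.v (hs (be (.v x))) (s3 (be (.v xa)) (be (.v xb)) (be c))) (.p (.v x) (.v xa) (.v xb) c))
    with ⟨h, xc, rfl⟩ | h
  swap
  · rw [h]
    exact hp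
  rw [h]
  refine ⟨fun w => hs_mono (ht w), fun w => ?_⟩
  rw [hG]
  exact Nat.add_le_add (Nat.add_le_add (ha w) (hb w)) (hc w)

theorem RB.ch {r : Rn} {F G : List A4 → ℕ} (h : RB r F G) (a : A4) :
    RB (rch a r) (fun w => F (a :: w)) (fun w => G (a :: w)) := by
  cases r with
  | v x s => cases a <;> exact ⟨fun w => h.1 _, fun w => h.2 _⟩
  | p t pa pb pc =>
    obtain ⟨ht, fa, fb, fc, ha, hb, hc, hG⟩ := h
    have := mkR_RB (ht.ch a) (ha.ch a) (hb.ch a) (hc.ch a) (fun w => hG (a :: w))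
    cases a <;> exact this

theorem RB.th {r : Rn} {F G : List A4 → ℕ} (h : RB r F G) (a : A4) (w : List A4) :
    hs (F (a :: w)) ≤ rth a r := by
  cases r with
  | v x s => cases a <;> exact h.1 _
  | p t pa pb pc =>
    obtain ⟨ht, fa, fb, fc, ha, hb, hc, hG⟩ := h
    have := hs_mono (ht.bd a w)
    cases a <;> exact this

theorem RB.sm {r : Rn} {F G : List A4 → ℕ} (h : RB r F G) (a : A4) (w : List A4) :
    rsm a r ≤ G (a :: w) := by
  cases r with
  | v x s => cases a <;> exact h.2 _
  | p t pa pb pc =>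
    obtain ⟨ht, fa, fb, fc, ha, hb, hc, hG⟩ := h
    have := Nat.add_le_add (Nat.add_le_add (ha.bd a w) (hb.bd a w)) (hc.bd a w)
    rw [hG]
    cases a <;> exact this

theorem RB.eth {r : Rn} {F G : List A4 → ℕ} (h : RB r F G) : hs (F []) ≤ he r := by
  cases r with
  | v x s => exact h.1 _
  | p t pa pb pc => exact hs_mono h.1.be

theorem RB.esm {r : Rn} {F G : List A4 → ℕ} (h : RB r F G) : se r ≤ G [] := by
  cases r with
  | v x s => exact h.2 _
  | p t pa pb pc =>
    obtain ⟨ht, fa, fb, fc, ha, hb, hc, hG⟩ := h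
    rw [hG]
    exact Nat.add_le_add (Nat.add_le_add ha.be hb.be) hc.be

def A4.nn : A4 → ℕ | .la => 0 | .lb => 1 | .lc => 2 | .ld => 3
def X.nn : X → ℕ | .x0 => 0 | .x1 => 1 | .x2 => 2 | .x3 => 3 | .u => 4
def X.lt : X → A4 | .x0 => .la | .x1 => .lb | .x2 => .lc | .x3 => .ld | .u => .la
def X.sc : X → X | .x0 => .x1 | .x1 => .x2 | .x2 => .x3 | .x3 => .u | .u => .u
theorem A4.nn_inj {a b : A4} (h : a.nn = b.nn) : a = b := by
  cases a <;> cases b <;> first | rfl | cases h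
theorem X.nn_lt {x : X} (h : x ≠ .u) : x.lt.nn = x.nn := by cases x <;> first | rfl | exact absurd rfl h
theorem X.nn_sc {x : X} (h : x ≠ .u) : x.sc.nn = x.nn + 1 := by cases x <;> first | rfl | exact absurd rfl h

def Mf (m0 m1 m2 m3 : X) : A4 → X | .la => m0 | .lb => m1 | .lc => m2 | .ld => m3
theorem Mf_eta (f : A4 → X) : Mf (f .la) (f .lb) (f .lc) (f .ld) = f := by funext a; cases a <;> rfl
def consf (r : Rn) (f : A4 → X) (nx : X) (l : RL) : RL := .cons r (f .la) (f .lb) (f .lc) (f .ld) nx l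

/-- step of all rounds by a letter -/
def stp : A4 → RL → IH | .la => ra | .lb => rb | .lc => rc | .ld => rd

theorem stp_nil (a : A4) (g : ℕ) (K : RL → Bool) : stp a .nil g K = K .nil := by cases a <;> rfl

theorem stp_seen (a : A4) (r : Rn) (f : A4 → X) (nx : X) (l : RL) (g : ℕ) (K : RL → Bool) (h : f a ≠ .u) :
    stp a (consf r f nx l) g K = ev (rth (f a).lt r) (Nat.add g (rsm (f a).lt r)) fun g =>
      stp a l g fun rs => K (consf (rch (f a).lt r) f nx rs) := by
  unfold consf
  cases a
  · generalize f .la = m at *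
    cases m <;> first | exact absurd rfl h | rfl
  · generalize f .lb = m at *
    cases m <;> first | exact absurd rfl h | rfl
  · generalize f .lc = m at *
    cases m <;> first | exact absurd rfl h | rfl
  · generalize f .ld = m at *
    cases m <;> first | exact absurd rfl h | rfl

theorem stp_new (a : A4) (r : Rn) (f : A4 → X) (nx : X) (l : RL) (g : ℕ) (K : RL → Bool) (h : f a = .u)
    (hn : nx ≠ .u) :
    stp a (consf r f nx l) g K = ev (rth nx.lt r) (Nat.add g (rsm nx.lt r)) fun g =>
      stp a l g fun rs => K (consf (rch nx.lt r) (Function.update f a nx) nx.sc rs) := by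
  unfold consf
  cases a <;> rw [h] <;> cases nx <;> first | exact absurd rfl hn | rfl

theorem stp_bad (a : A4) (r : Rn) (f : A4 → X) (l : RL) (g : ℕ) (K : RL → Bool) (h : f a = .u) :
    stp a (consf r f .u l) g K = false := by
  unfold consf
  cases a <;> rw [h] <;> rfl

theorem ev_spec {h x : ℕ} {J : ℕ → Bool} (H : ev h x J = true) : h ≤ x ∨ J (nxt x) = true := by
  unfold ev at H
  rcases h' : Nat.ble h x with _ | _
  · rw [h'] at H; exact Or.inr H
  · exact Or.inl (Nat.le_of_ble_eq_true h')

section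
variable (F G : List A4 → ℕ)

/-- lossless at one of the rounds with the given offsets -/
def Lz (z : List A4) : ℕ → List ℕ → Prop
  | _, [] => False
  | g, o :: os => hs (F (z.drop o)) ≤ g + G (z.drop o) ∨ Lz z (nxt (g + G (z.drop o))) os

variable {F G}
theorem Lz_mono {z : List A4} : ∀ {os : List ℕ} {g g' : ℕ}, g ≤ g' → Lz F G z g os → Lz F G z g' os
  | [], _, _, _, h => h
  | o :: os, g, g', hg, h => by
    rcases h with h | h
    · exact Or.inl (h.trans (by omega))
    · exact Or.inr (Lz_mono (nxt_mono (by omega)) h)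
theorem Lz_app {z : List A4} : ∀ {os : List ℕ} (os' : List ℕ) {g : ℕ}, Lz F G z g os → Lz F G z g (os ++ os')
  | [], _, _, h => h.elim
  | o :: os, os', g, h => by
    rcases h with h | h
    · exact Or.inl h
    · exact Or.inr (Lz_app os' h)

variable (F G)
/-- correctness of a round with letter map `f`, next index `nx`, after the word `q` -/
def RI (r : Rn) (f : A4 → X) (nx : X) (q : List A4) : Prop :=
  ∃ π : Equiv.Perm A4, (∀ a, f a ≠ .u → π a = (f a).lt ∧ (f a).nn < nx.nn) ∧ (∀ a, f a = .u → a ∉ q) ∧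
    RB r (fun w => F (q.map π ++ w)) (fun w => G (q.map π ++ w))

variable {F G} (hF : ∀ (π : Equiv.Perm A4) w, F (w.map π) = F w) (hG : ∀ (π : Equiv.Perm A4) w, G (w.map π) = G w)
include hF hG

theorem RI_bounds {r : Rn} {q : List A4} {π : Equiv.Perm A4} {a b : A4} (hab : π a = b)
    (h : RB r (fun w => F (q.map π ++ w)) (fun w => G (q.map π ++ w))) :
    RB (rch b r) (fun w => F ((q ++ [a]).map π ++ w)) (fun w => G ((q ++ [a]).map π ++ w)) ∧
    ∀ y, hs (F (q ++ a :: y)) ≤ rth b r ∧ rsm b r ≤ G (q ++ a :: y) := by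
  subst hab
  refine ⟨?_, fun y => ?_⟩
  · have := h.ch (π a)
    simpa [List.map_append, List.append_assoc] using this
  · have h1 := h.th (π a) (y.map π)
    have h2 := h.sm (π a) (y.map π)
    have e : q.map π ++ π a :: y.map π = (q ++ a :: y).map π := by simp
    simp only [e, hF, hG] at h1 h2
    exact ⟨h1, h2⟩

theorem RI_seen {r : Rn} {f : A4 → X} {nx : X} {q : List A4} {a : A4} (ha : f a ≠ .u) (h : RI F G r f nx q) :
    RI F G (rch (f a).lt r) f nx (q ++ [a]) ∧
    ∀ y, hs (F (q ++ a :: y)) ≤ rth (f a).lt r ∧ rsm (f a).lt r ≤ G (q ++ a :: y) := by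
  obtain ⟨π, h1, h2, h3⟩ := h
  obtain ⟨k1, k2⟩ := RI_bounds hF hG (h1 a ha).1 h3
  refine ⟨⟨π, h1, fun b hb => ?_, k1⟩, k2⟩
  have := h2 b hb
  rw [List.mem_append, List.mem_singleton]
  rintro (h | rfl)
  · exact this h
  · exact ha hb

theorem RI_new {r : Rn} {f : A4 → X} {nx : X} {q : List A4} {a : A4} (ha : f a = .u) (hn : nx ≠ .u)
    (h : RI F G r f nx q) :
    RI F G (rch nx.lt r) (Function.update f a nx) nx.sc (q ++ [a]) ∧
    ∀ y, hs (F (q ++ a :: y)) ≤ rth nx.lt r ∧ rsm nx.lt r ≤ G (q ++ a :: y) := by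
  obtain ⟨π, h1, h2, h3⟩ := h
  have hagree : ∀ b, f b ≠ .u → (Equiv.swap (π a) nx.lt) (π b) = π b := by
    intro b hb
    apply Equiv.swap_apply_of_ne_of_ne
    · intro hh
      have := π.injective hh
      subst this
      exact hb ha
    · intro hh
      have h4 := h1 b hb
      have h5 := X.nn_lt hn
      rw [← hh, h4.1, X.nn_lt hb] at h5
      omega
  let π' : Equiv.Perm A4 := π.trans (Equiv.swap (π a) nx.lt)
  have hπ' : ∀ b, f b ≠ .u → π' b = π b := hagree
  have hq : q.map π' = q.map π := by
    apply List.map_congr_left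
    intro b hb
    apply hπ'
    intro hb'
    exact h2 b hb' hb
  have hπa : π' a = nx.lt := by simp [π']
  rw [← hq] at h3
  obtain ⟨k1, k2⟩ := RI_bounds hF hG hπa h3
  refine ⟨⟨π', fun b hb => ?_, fun b hb => ?_, k1⟩, k2⟩
  · by_cases hba : b = a
    · subst hba
      rw [Function.update_self]
      exact ⟨hπa, by rw [X.nn_sc hn]; omega⟩
    · rw [Function.update_of_ne hba] at hb ⊢
      refine ⟨(hπ' b hb).trans (h1 b hb).1, ?_⟩
      rw [X.nn_sc hn]
      have := (h1 b hb).2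
      omega
  · by_cases hba : b = a
    · subst hba
      rw [Function.update_self] at hb
      exact absurd hb hn
    · rw [Function.update_of_ne hba] at hb
      rw [List.mem_append, List.mem_singleton]
      rintro (h | h)
      · exact h2 b hb h
      · exact hba h

omit hF hG
variable (F G)
/-- correctness of a list of rounds -/
inductive RLI (p : List A4) : RL → List ℕ → Prop
  | nil : RLI p .nil []
  | cons {r : Rn} {f : A4 → X} {nx : X} {l : RL} {o : ℕ} {os : List ℕ} (ho : o ≤ p.length)
      (hr : RI F G r f nx (p.drop o)) (h : RLI p l os) : RLI p (consf r f nx l) (o :: os)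
variable {F G}
include hF hG

theorem stp_spec {p : List A4} (a : A4) (y : List A4) {rs : RL} {os : List ℕ} (h : RLI F G p rs os) :
    ∀ (g : ℕ) (K : RL → Bool), stp a rs g K = true →
      Lz F G (p ++ a :: y) g os ∨ ∃ rs', RLI F G (p ++ [a]) rs' os ∧ K rs' = true := by
  induction h with
  | nil => intro g K hK; rw [stp_nil] at hK; exact Or.inr ⟨_, .nil, hK⟩
  | @cons r f nx l o os ho hr h ih =>
    intro g K hK
    have hd : ∀ y, (p ++ y).drop o = p.drop o ++ y := fun y => List.drop_append_of_le_length ho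
    have key : ∀ (r' : Rn) (f' : A4 → X) (nx' : X) (b : A4),
        (RI F G r' f' nx' (p.drop o ++ [a]) ∧
          ∀ y, hs (F (p.drop o ++ a :: y)) ≤ rth b r ∧ rsm b r ≤ G (p.drop o ++ a :: y)) →
        (ev (rth b r) (Nat.add g (rsm b r)) fun g => stp a l g fun rs => K (consf r' f' nx' rs)) = true →
        Lz F G (p ++ a :: y) g (o :: os) ∨ ∃ rs', RLI F G (p ++ [a]) rs' (o :: os) ∧ K rs' = true := by
      intro r' f' nx' b ⟨k1, k2⟩ H
      have k3 := k2 y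
      rw [← hd] at k3
      rcases ev_spec H with H | H
      · refine Or.inl (Or.inl ?_)
        exact k3.1.trans (H.trans (Nat.add_le_add_left k3.2 g))
      · rcases ih _ _ H with H | ⟨rs', H1, H2⟩
        · refine Or.inl (Or.inr (Lz_mono (nxt_mono ?_) H))
          exact Nat.add_le_add_left k3.2 g
        · refine Or.inr ⟨_, .cons (o := o) ?_ ?_ H1, H2⟩
          · rw [List.length_append]; omega
          · rw [hd]; exact k1
    by_cases ha : f a = .u
    · by_cases hn : nx = .u
      · subst hn
        rw [stp_bad _ _ _ _ _ _ ha] at hK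
        cases hK
      · rw [stp_new _ _ _ _ _ _ _ ha hn] at hK
        exact key _ _ _ _ (RI_new hF hG ha hn hr) hK
    · rw [stp_seen _ _ _ _ _ _ _ ha] at hK
      exact key _ _ _ _ (RI_seen hF hG ha hr) hK

theorem re_spec {p : List A4} {rs : RL} {os : List ℕ} (h : RLI F G p rs os) :
    ∀ g : ℕ, re rs g = true → Lz F G p g os := by
  induction h with
  | nil => intro g hg; cases hg
  | @cons r f nx l o os ho hr h ih =>
    intro g hg
    have hg' : ev (he r) (Nat.add g (se r)) (re l) = true := hg
    obtain ⟨π, _, _, h3⟩ := hr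
    have e1 := h3.eth
    have e2 := h3.esm
    simp only [List.append_nil, hF, hG] at e1 e2
    rcases ev_spec hg' with H | H
    · exact Or.inl (e1.trans (H.trans (Nat.add_le_add_left e2 g)))
    · exact Or.inr (Lz_mono (nxt_mono (Nat.add_le_add_left e2 g)) (ih _ H))

omit hF hG in
theorem nfQ_spec (rs : RL) : ∀ K, nfQ rs K = K rs := by
  induction rs with
  | nil => intro K; rfl
  | cons r m0 m1 m2 m3 nx l ih =>
    intro K
    have : nfQ (.cons r m0 m1 m2 m3 nx l) K = nf r fun r => nfQ l fun l => K (.cons r m0 m1 m2 m3 nx l) := rfl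
    rw [this]
    cases r
    · exact ih _
    · exact ih _

variable (F G) in
/-- the invariant of the search at the prefix `p` -/
def Inv (Goal : List A4 → Prop) (p : List A4) (g : ℕ) (rs : RL) (fut : List ℕ) : Prop :=
  ∃ os, RLI F G p rs os ∧ ∀ z, p <+: z → Lz F G z g (os ++ fut) → Goal z

variable {Goal : List A4 → Prop}

theorem Inv_stp {p : List A4} {g : ℕ} {rs : RL} {fut : List ℕ} (h : Inv F G Goal p g rs fut) (a : A4)
    {K : RL → Bool} (hK : stp a rs g K = true) (y : List A4) :
    Goal (p ++ a :: y) ∨ ∃ rs', Inv F G Goal (p ++ [a]) g rs' fut ∧ K rs' = true := by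
  obtain ⟨os, h1, h2⟩ := h
  rcases stp_spec hF hG a y h1 g K hK with h | ⟨rs', h3, h4⟩
  · exact Or.inl (h2 _ (List.prefix_append _ _) (Lz_app _ h))
  · exact Or.inr ⟨rs', ⟨os, h3, fun z hz => h2 z ((List.prefix_append _ _).trans hz)⟩, h4⟩

theorem Inv_re {p : List A4} {g : ℕ} {rs : RL} {fut : List ℕ} (h : Inv F G Goal p g rs fut)
    (hK : re rs g = true) : Goal p := by
  obtain ⟨os, h1, h2⟩ := h
  exact h2 _ (List.prefix_refl _) (Lz_app _ (re_spec hF hG h1 g hK))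

theorem Inv_nfR {p : List A4} {fut : List ℕ} {K : ℕ → RL → Bool} (rs : RL) :
    ∀ g : ℕ, Inv F G Goal p g rs fut → nfR rs g K = true →
      ∃ g' rs', Inv F G Goal p g' rs' fut ∧ K g' rs' = true := by
  induction rs with
  | nil => intro g h hK; exact ⟨g, _, h, hK⟩
  | cons r m0 m1 m2 m3 nx l ih =>
    intro g h hK
    cases r with
    | v x s =>
      have hK' : nfR l (nxt (Nat.add g s)) K = true := hK
      refine ih _ ?_ hK'
      obtain ⟨os, h1, h2⟩ := h
      cases h1 with
      | @cons _ f _ _ o os ho hr h =>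
        refine ⟨os, h, fun z hz hL => h2 z hz (Or.inr (Lz_mono (nxt_mono ?_) hL))⟩
        obtain ⟨π, _, _, h3⟩ := hr
        obtain ⟨y, rfl⟩ := hz
        rw [List.drop_append_of_le_length ho, ← hG π, List.map_append]
        exact Nat.add_le_add_left (h3.2 _) g
    | p t a b c =>
      have hK' : nfQ l (fun l => K g (.cons (.p t a b c) m0 m1 m2 m3 nx l)) = true := hK
      rw [nfQ_spec] at hK'
      exact ⟨g, _, h, hK'⟩

omit hF hG in
theorem snoc_spec {p : List A4} {rs : RL} {os : List ℕ} (h : RLI F G p rs os) {r : Rn} {f : A4 → X} {nx : X}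
    {o : ℕ} (ho : o ≤ p.length) (hr : RI F G r f nx (p.drop o)) :
    ∀ K, snoc rs r (f .la) (f .lb) (f .lc) (f .ld) nx K = true → ∃ rs', RLI F G p rs' (os ++ [o]) ∧ K rs' = true := by
  induction h with
  | nil => intro K hK; exact ⟨_, .cons ho hr .nil, hK⟩
  | @cons r' f' nx' l o' os ho' hr' h ih =>
    intro K hK
    obtain ⟨rs', h1, h2⟩ := ih _ hK
    exact ⟨_, .cons ho' hr' h1, h2⟩

omit hF hG in
theorem Inv_snoc {p : List A4} {g : ℕ} {rs : RL} {fut : List ℕ} {r : Rn} {f : A4 → X} {nx : X}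
    {o : ℕ} (h : Inv F G Goal p g rs (o :: fut)) (ho : o ≤ p.length) (hr : RI F G r f nx (p.drop o))
    {K : RL → Bool} (hK : snoc rs r (f .la) (f .lb) (f .lc) (f .ld) nx K = true) :
    ∃ rs', Inv F G Goal p g rs' fut ∧ K rs' = true := by
  obtain ⟨os, h1, h2⟩ := h
  obtain ⟨rs', h3, h4⟩ := snoc_spec h1 ho hr K hK
  exact ⟨rs', ⟨_, h3, by simpa using h2⟩, h4⟩

theorem free_spec {fut : List ℕ} (n : ℕ) : ∀ (p : List A4) (g : ℕ) (rs : RL), Inv F G Goal p g rs fut →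
    free n g rs = true → ∀ y, Goal (p ++ y) := by
  induction n with
  | zero => intro p g rs _ h; cases h
  | succ n ih =>
    intro p g rs hI h y
    have h' : bi (re rs g) (bi (ra rs g (free n g)) (bi (rb rs g (free n g))
      (bi (rc rs g (free n g)) (rd rs g (free n g)) false) false) false) false = true := h
    obtain ⟨k, h'⟩ := and_of_bi h'
    obtain ⟨k0, h'⟩ := and_of_bi h'
    obtain ⟨k1, h'⟩ := and_of_bi h'
    obtain ⟨k2, k3⟩ := and_of_bi h'
    cases y with
    | nil => rw [List.append_nil]; exact Inv_re hF hG hI k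
    | cons a y =>
      have hs : stp a rs g (free n g) = true := by cases a <;> assumption
      rcases Inv_stp hF hG hI a hs y with h | ⟨rs', h1, h2⟩
      · exact h
      · have := ih _ _ _ h1 h2 y
        simpa using this

theorem walk_spec {fut : List ℕ} (m : ℕ) (l : List A4) : ∀ (p : List A4) (g : ℕ) (rs : RL),
    Inv F G Goal p g rs fut → walk m l g rs = true → ∀ y, Goal (p ++ l ++ y) := by
  induction l with
  | nil => intro p g rs hI h y; rw [List.append_nil]; exact free_spec hF hG m p g rs hI h y
  | cons a l ih =>
    intro p g rs hI h y
    have h' : stp a rs g (fun rs => nfR rs g (walk m l)) = true := by cases a <;> exact h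
    rcases Inv_stp hF hG hI a h' (l ++ y) with h | ⟨rs', h1, h2⟩
    · simpa using h
    · obtain ⟨g', rs', h3, h4⟩ := Inv_nfR hF hG rs' g h1 h2
      have := ih _ _ _ h3 h4 y
      simpa using this

end
end


/-! ### Soundness of the search -/

noncomputable section

/-- offsets of the rounds created by a schedule -/
def Sch.fut : Sch → ℕ → List ℕ
  | .nil, _ => []
  | .s r, k => r.fut (k + 1)
  | .p r, k => (k - 1) :: r.fut (k + 1)
  | .n r, k => r.fut k
  | .w _ r, k => r.fut k
  | .z r, k => k :: r.fut k
/-- periods treated by a schedule -/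
def Sch.dep : Sch → ℕ → List ℕ
  | .nil, _ => []
  | .s r, k => r.dep (k + 1)
  | .p r, k => r.dep (k + 1)
  | .n r, k => r.dep k
  | .w _ r, k => k :: r.dep k
  | .z r, k => r.dep k
def Sch.ok : Sch → ℕ → Prop
  | .nil, _ => True
  | .s r, k => r.ok (k + 1)
  | .p r, k => 1 ≤ k ∧ r.ok (k + 1)
  | .n r, k => r.ok k
  | .w _ r, k => r.ok k
  | .z r, k => r.ok k

theorem Sch.le_dep (S : Sch) : ∀ (k q : ℕ), q ∈ S.dep k → k ≤ q := by
  induction S with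
  | nil => intro k q h; cases h
  | s r ih => intro k q h; have := ih (k + 1) q h; omega
  | p r ih => intro k q h; have := ih (k + 1) q h; omega
  | n r ih => intro k q h; exact ih k q h
  | w m r ih =>
    intro k q h
    rcases List.mem_cons.mp h with rfl | h
    · exact le_rfl
    · exact ih k q h
  | z r ih => intro k q h; exact ih k q h

def PerW (q : ℕ) (z : List A4) : Prop := ∃ p y : List A4, p.length = q ∧ z = p ++ p.dropLast ++ y

theorem PerW.map {q : ℕ} {z : List A4} (h : PerW q z) (π : Equiv.Perm A4) : PerW q (z.map π) := by
  obtain ⟨p, y, h1, rfl⟩ := h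
  exact ⟨p.map π, y.map π, by simpa using h1, by simp [List.map_dropLast]⟩

theorem PerW.length {q : ℕ} {z : List A4} (h : PerW q z) : 2 * q ≤ z.length + 1 := by
  obtain ⟨p, y, h1, rfl⟩ := h
  simp
  omega

theorem rv_eq (l : List A4) : ∀ a, rv l a = l.reverse ++ a := by
  induction l with
  | nil => intro a; rfl
  | cons x l ih =>
    intro a
    have : rv (x :: l) a = rv l (x :: a) := rfl
    rw [this, ih]
    simp

theorem pat_eq (p : List A4) : pat p.reverse = p.dropLast := by
  rcases List.eq_nil_or_concat p with rfl | ⟨l, a, rfl⟩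
  · rfl
  · have : pat (a :: l.reverse) = rv l.reverse [] := rfl
    simp [this, rv_eq]

theorem brs_spec {mx : X} {B : BF} (h : brs mx B = true) (l : A4) (hl : l.nn ≤ mx.nn) :
    ∃ mx' : X, B l (stp l) mx' = true ∧ mx.nn ≤ mx'.nn ∧ l.nn < mx'.nn := by
  cases mx
  · cases l
    · exact ⟨.x1, h, by decide, by decide⟩
    all_goals exact absurd hl (by decide)
  · have h' : bi (B .la ra .x1) (B .lb rb .x2) false = true := h
    obtain ⟨h0, h1⟩ := and_of_bi h'
    cases l
    · exact ⟨_, h0, by decide, by decide⟩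
    · exact ⟨_, h1, by decide, by decide⟩
    all_goals exact absurd hl (by decide)
  · have h' : bi (B .la ra .x2) (bi (B .lb rb .x2) (B .lc rc .x3) false) false = true := h
    obtain ⟨h0, h'⟩ := and_of_bi h'
    obtain ⟨h1, h2⟩ := and_of_bi h'
    cases l
    · exact ⟨_, h0, by decide, by decide⟩
    · exact ⟨_, h1, by decide, by decide⟩
    · exact ⟨_, h2, by decide, by decide⟩
    · exact absurd hl (by decide)
  · have h' : bi (B .la ra .x3) (bi (B .lb rb .x3) (bi (B .lc rc .x3) (B .ld rd .u) false) false) false = true := h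
    obtain ⟨h0, h'⟩ := and_of_bi h'
    obtain ⟨h1, h'⟩ := and_of_bi h'
    obtain ⟨h2, h3⟩ := and_of_bi h'
    cases l
    · exact ⟨_, h0, by decide, by decide⟩
    · exact ⟨_, h1, by decide, by decide⟩
    · exact ⟨_, h2, by decide, by decide⟩
    · exact ⟨_, h3, by decide, by decide⟩
  · have h' : bi (B .la ra .u) (bi (B .lb rb .u) (bi (B .lc rc .u) (B .ld rd .u) false) false) false = true := h
    obtain ⟨h0, h'⟩ := and_of_bi h'
    obtain ⟨h1, h'⟩ := and_of_bi h'
    obtain ⟨h2, h3⟩ := and_of_bi h'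
    cases l
    · exact ⟨_, h0, by decide, by decide⟩
    · exact ⟨_, h1, by decide, by decide⟩
    · exact ⟨_, h2, by decide, by decide⟩
    · exact ⟨_, h3, by decide, by decide⟩

/-- restriction to words whose letters appear in order -/
theorem rg_spec {P : List A4 → Prop} (hP : ∀ (π : Equiv.Perm A4) z, P (z.map π) → P z) {p : List A4} {mx : X}
    (hmx : ∀ a ∈ p, a.nn < mx.nn) (h : ∀ a y, a.nn ≤ mx.nn → P (p ++ a :: y)) (a : A4) (y : List A4) :
    P (p ++ a :: y) := by
  by_cases ha : a.nn ≤ mx.nn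
  · exact h a y ha
  · have hu : mx ≠ .u := by
      rintro rfl
      apply ha
      cases a <;> decide
    apply hP (Equiv.swap a mx.lt)
    have hp : p.map (Equiv.swap a mx.lt) = p := by
      conv_rhs => rw [← List.map_id p]
      apply List.map_congr_left
      intro b hb
      apply Equiv.swap_apply_of_ne_of_ne
      · rintro rfl
        have := hmx _ hb
        omega
      · rintro rfl
        have := hmx _ hb
        rw [X.nn_lt hu] at this
        omega
    rw [List.map_append, hp, List.map_cons, Equiv.swap_apply_left]
    exact h _ _ (X.nn_lt hu).le

def spf (e l : A4) : A4 → X := if e = l then Function.update (fun _ => .u) e .x0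
  else Function.update (Function.update (fun _ => .u) e .x0) l .x1
theorem spw_eq (R0 R1 : Rn) (e l : A4) (K : RL → Bool) (rs : RL) :
    spw R0 R1 e l K rs = snoc rs (if e = l then R0 else R1) (spf e l .la) (spf e l .lb) (spf e l .lc) (spf e l .ld)
      (if e = l then .x1 else .x2) K := by
  cases e <;> cases l <;> rfl

theorem exists_perm2 {e l : A4} (h : e ≠ l) : ∃ π : Equiv.Perm A4, π e = .la ∧ π l = .lb := by
  refine ⟨(Equiv.swap e .la).trans (Equiv.swap (Equiv.swap e .la l) .lb), ?_, ?_⟩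
  · rw [Equiv.trans_apply, Equiv.swap_apply_left]
    apply Equiv.swap_apply_of_ne_of_ne
    · intro hh
      rw [← Equiv.swap_apply_left e A4.la] at hh
      exact h ((Equiv.swap e A4.la).injective (by simpa using hh))
    · decide
  · simp

section
variable {F G : List A4 → ℕ} (hF : ∀ (π : Equiv.Perm A4) w, F (w.map π) = F w)
  (hG : ∀ (π : Equiv.Perm A4) w, G (w.map π) = G w)
  {Goal : List A4 → Prop} (hGoal : ∀ (π : Equiv.Perm A4) z, Goal (z.map π) → Goal z)
  {R0 R1 R2 : Rn} (hR0 : RB R0 (fun w => F (.la :: .la :: w)) (fun w => G (.la :: .la :: w)))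
  (hR1 : RB R1 (fun w => F (.la :: .lb :: w)) (fun w => G (.la :: .lb :: w)))
  (hR2 : RB R2 F G)
include hR0 hR1

theorem sp_RI (e l : A4) :
    RI F G (if e = l then R0 else R1) (spf e l) (if e = l then .x1 else .x2) [e, l] := by
  unfold spf
  by_cases h : e = l
  · subst h
    simp only [if_true]
    refine ⟨Equiv.swap e .la, fun a ha => ?_, fun a ha => ?_, ?_⟩
    · by_cases hae : a = e
      · subst hae; simp [X.lt, X.nn]
      · rw [Function.update_of_ne hae] at ha; exact absurd rfl ha
    · by_cases hae : a = e
      · subst hae; simp at ha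
      · simp [hae]
    · simpa using hR0
  · simp only [if_neg h]
    obtain ⟨π, h1, h2⟩ := exists_perm2 h
    refine ⟨π, fun a ha => ?_, fun a ha => ?_, ?_⟩
    · by_cases hal : a = l
      · subst hal; simp [X.lt, X.nn, h2]
      · rw [Function.update_of_ne hal] at ha ⊢
        by_cases hae : a = e
        · subst hae; simp [X.lt, X.nn, h1]
        · rw [Function.update_of_ne hae] at ha; exact absurd rfl ha
    · by_cases hal : a = l
      · subst hal; simp at ha
      · by_cases hae : a = e
        · subst hae; rw [Function.update_of_ne hal] at ha; simp at ha
        · simp [hae, hal]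
    · simpa [h1, h2] using hR1

include hF hG hGoal hR2
theorem dfs_spec (S : Sch) : ∀ (p : List A4) (e : A4) (mx : X) (g : ℕ) (rs : RL),
    Inv F G Goal p g rs (S.fut p.length) → (∀ x ∈ p.getLast?, x = e) → (∀ a ∈ p, a.nn < mx.nn) →
    S.ok p.length → dfs R0 R1 R2 S p.reverse e mx g rs = true →
    ∀ q ∈ S.dep p.length, ∀ z, p <+: z → PerW q z → Goal z := by
  induction S with
  | nil => intro p e mx g rs _ _ _ _ _ q hq; cases hq
  | s r ih =>
    intro p e mx g rs hI he hmx hok h q hq z hz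
    have h' : brs mx (fun l st mx => st rs g (dfs R0 R1 R2 r (l :: p.reverse) l mx g)) = true := h
    have hqk := Sch.le_dep r _ _ hq
    obtain ⟨y, rfl⟩ := hz
    cases y with
    | nil => intro hper; have := hper.length; simp at this; omega
    | cons a y =>
      refine rg_spec (P := fun z => PerW q z → Goal z) (fun π z hz hp => hGoal π z (hz (hp.map π))) hmx ?_ a y
      intro a y ha hper
      obtain ⟨mx', k1, k2, k3⟩ := brs_spec h' a ha
      rcases Inv_stp hF hG hI a k1 y with hg | ⟨rs', hI', h''⟩
      · exact hg
      · refine ih (p ++ [a]) a mx' g rs' (by simpa [Sch.fut] using hI') (by simp) ?_ (by simpa [Sch.ok] using hok)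
          (by simpa using h'') q (by simpa [Sch.dep] using hq) _ (by simp) hper
        intro b hb
        rcases List.mem_append.mp hb with hb | hb
        · exact (hmx b hb).trans_le k2
        · rw [List.mem_singleton.mp hb]; exact k3
  | p r ih =>
    intro p e mx g rs hI he hmx hok h q hq z hz
    have h' : brs mx (fun l st mx => st rs g (spw R0 R1 e l (dfs R0 R1 R2 r (l :: p.reverse) l mx g))) = true := h
    have hqk := Sch.le_dep r _ _ hq
    obtain ⟨y, rfl⟩ := hz
    cases y with
    | nil => intro hper; have := hper.length; simp at this; omega
    | cons a y =>
      refine rg_spec (P := fun z => PerW q z → Goal z) (fun π z hz hp => hGoal π z (hz (hp.map π))) hmx ?_ a y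
      intro a y ha hper
      obtain ⟨mx', k1, k2, k3⟩ := brs_spec h' a ha
      rcases Inv_stp hF hG hI a k1 y with hg | ⟨rs', hI', h''⟩
      · exact hg
      · rw [spw_eq] at h''
        obtain ⟨hk, hok⟩ := hok
        obtain ⟨p', rfl⟩ : ∃ p', p = p' ++ [e] := by
          rcases List.eq_nil_or_concat p with rfl | ⟨p', b, rfl⟩
          · simp at hk
          · exact ⟨p', by rw [he b (by simp)]; simp⟩
        have hdrop : (p' ++ [e] ++ [a]).drop ((p' ++ [e]).length - 1) = [e, a] := by simp
        obtain ⟨rs'', hI'', h3⟩ := Inv_snoc hI' (by simp) (hdrop.symm ▸ sp_RI hR0 hR1 e a) h''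
        refine ih (p' ++ [e] ++ [a]) a mx' g rs'' (by simpa using hI'') (by simp) ?_ (by simpa using hok)
          (by simpa using h3) q (by simpa [Sch.dep] using hq) _ (by simp) hper
        intro b hb
        rcases List.mem_append.mp hb with hb | hb
        · exact (hmx b hb).trans_le k2
        · rw [List.mem_singleton.mp hb]; exact k3
  | n r ih =>
    intro p e mx g rs hI he hmx hok h q hq z hz
    obtain ⟨g', rs', hI', h'⟩ := Inv_nfR hF hG rs g hI h
    exact ih p e mx g' rs' hI' he hmx hok h' q hq z hz
  | w m r ih =>
    intro p e mx g rs hI he hmx hok h q hq z hz hper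
    have h' : bi (walk m (pat p.reverse) g rs) (dfs R0 R1 R2 r p.reverse e mx g rs) false = true := h
    obtain ⟨h1, h2⟩ := and_of_bi h'
    rcases List.mem_cons.mp hq with rfl | hq
    · obtain ⟨p', y, hp', rfl⟩ := hper
      have : p = p' := by
        rw [List.append_assoc] at hz
        exact (List.prefix_of_prefix_length_le hz (List.prefix_append _ _) hp'.ge).eq_of_length hp'.symm
      subst this
      rw [pat_eq] at h1
      exact walk_spec hF hG m _ p g rs hI h1 y
    · exact ih p e mx g rs hI he hmx hok h2 q hq z hz hper
  | z r ih =>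
    intro p e mx g rs hI he hmx hok h q hq z hz
    have hRI : RI F G R2 (fun _ => .u) .x0 (p.drop p.length) := by
      rw [List.drop_length]
      exact ⟨Equiv.refl _, fun a ha => absurd rfl ha, fun a _ => by simp, by simpa using hR2⟩
    obtain ⟨rs', hI', h'⟩ := Inv_snoc hI le_rfl hRI h
    exact ih p e mx g rs' hI' he hmx hok h' q hq z hz
end
end


/-! ### What the searches prove about the weights -/

noncomputable section

theorem sumA4 (f : A4 → ℕ) : ∑ b, f b = f .la + f .lb + f .lc + f .ld := by
  have : (Finset.univ : Finset A4) = {.la, .lb, .lc, .ld} := rfl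
  rw [this, Finset.sum_insert (by simp), Finset.sum_insert (by simp), Finset.sum_insert (by simp),
    Finset.sum_singleton]
  omega

theorem brA_spec {mx : X} {B : CF} (h : brA mx B = true) (l : A4) (hl : l.nn ≤ mx.nn) :
    ∃ mx' : X, B l (pch l) (pbd l) mx' = true ∧ mx.nn ≤ mx'.nn ∧ l.nn < mx'.nn := by
  cases mx
  · cases l
    · exact ⟨.x1, h, by decide, by decide⟩
    all_goals exact absurd hl (by decide)
  · have h' : bi (B .la ca ba .x1) (B .lb cb bb .x2) false = true := h
    obtain ⟨h0, h1⟩ := and_of_bi h'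
    cases l
    · exact ⟨_, h0, by decide, by decide⟩
    · exact ⟨_, h1, by decide, by decide⟩
    all_goals exact absurd hl (by decide)
  · have h' : bi (B .la ca ba .x2) (bi (B .lb cb bb .x2) (B .lc cc bc .x3) false) false = true := h
    obtain ⟨h0, h'⟩ := and_of_bi h'
    obtain ⟨h1, h2⟩ := and_of_bi h'
    cases l
    · exact ⟨_, h0, by decide, by decide⟩
    · exact ⟨_, h1, by decide, by decide⟩
    · exact ⟨_, h2, by decide, by decide⟩
    · exact absurd hl (by decide)
  · have h' : bi (B .la ca ba .x3) (bi (B .lb cb bb .x3) (bi (B .lc cc bc .x3) (B .ld cd bd .u) false) false) false = true := h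
    obtain ⟨h0, h'⟩ := and_of_bi h'
    obtain ⟨h1, h'⟩ := and_of_bi h'
    obtain ⟨h2, h3⟩ := and_of_bi h'
    cases l
    · exact ⟨_, h0, by decide, by decide⟩
    · exact ⟨_, h1, by decide, by decide⟩
    · exact ⟨_, h2, by decide, by decide⟩
    · exact ⟨_, h3, by decide, by decide⟩
  · have h' : bi (B .la ca ba .u) (bi (B .lb cb bb .u) (bi (B .lc cc bc .u) (B .ld cd bd .u) false) false) false = true := h
    obtain ⟨h0, h'⟩ := and_of_bi h'
    obtain ⟨h1, h'⟩ := and_of_bi h'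
    obtain ⟨h2, h3⟩ := and_of_bi h'
    cases l
    · exact ⟨_, h0, by decide, by decide⟩
    · exact ⟨_, h1, by decide, by decide⟩
    · exact ⟨_, h2, by decide, by decide⟩
    · exact ⟨_, h3, by decide, by decide⟩

theorem nP_eq (P : Pt) (K : Pt → Bool) : nP P K = K P := by cases P <;> rfl

section
variable {T : List A4 → ℕ}

/-- the inequality without corrections -/
def QA (T : List A4 → ℕ) (z : List A4) : Prop := hs (T z.tail) ≤ ∑ b, T (b :: z)

theorem QA_perm (hT : ∀ (π : Equiv.Perm A4) w, T (w.map π) = T w) (π : Equiv.Perm A4) (z : List A4)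
    (h : QA T (z.map π)) : QA T z := by
  unfold QA at *
  rw [← List.map_tail, hT] at h
  refine h.trans (le_of_eq ?_)
  rw [← Equiv.sum_comp π]
  apply Finset.sum_congr rfl
  intro b _
  rw [← List.map_cons, hT]

theorem leA_spec {f : Pt → ℕ} {t a b c d : Pt} (h : leA f t a b c d = true) :
    hs (f t) ≤ f a + f b + f c + f d := Nat.le_of_ble_eq_true h

theorem dA_spec (hT : ∀ (π : Equiv.Perm A4) w, T (w.map π) = T w) (n : ℕ) :
    ∀ (s : List A4) (mx : X) (t a b c d : Pt), (∀ x ∈ A4.la :: s, x.nn < mx.nn) →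
    BD (fun x y => x ≤ y) t (fun w => T (s ++ w)) →
    BD (fun x y => y ≤ x) a (fun w => T (.la :: .la :: (s ++ w))) →
    BD (fun x y => y ≤ x) b (fun w => T (.lb :: .la :: (s ++ w))) →
    BD (fun x y => y ≤ x) c (fun w => T (.lc :: .la :: (s ++ w))) →
    BD (fun x y => y ≤ x) d (fun w => T (.ld :: .la :: (s ++ w))) →
    dA n mx t a b c d = true → ∀ y, QA T (.la :: (s ++ y)) := by
  induction n with
  | zero => intro s mx t a b c d _ _ _ _ _ _ h; cases h
  | succ n ih =>
    intro s mx t a b c d hmx ht ha hb hc hd h y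
    have h' : bi (leA be t a b c d)
      (brA mx fun _ C f mx => bi (leA f t a b c d) true
      (nP (C t) fun t => nP (C a) fun a => nP (C b) fun b => nP (C c) fun c => nP (C d) fun d =>
        dA n mx t a b c d)) false = true := h
    obtain ⟨h1, h2⟩ := and_of_bi h'
    cases y with
    | nil =>
      have e := leA_spec h1
      have e1 := hs_mono ht.be
      have e2 := ha.be
      have e3 := hb.be
      have e4 := hc.be
      have e5 := hd.be
      unfold QA
      rw [sumA4]
      rw [List.tail_cons]
      omega
    | cons x y =>
      refine rg_spec (P := QA T) (p := .la :: s) (QA_perm hT) hmx ?_ x y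
      intro x y hx
      obtain ⟨mx', k1, k2, k3⟩ := brA_spec h2 x hx
      cases hl : leA (pbd x) t a b c d
      · rw [hl] at k1
        simp only [bi_eq, cond_false, nP_eq] at k1
        have hr : ∀ w : List A4, s ++ x :: w = s ++ [x] ++ w := by simp
        have := ih (s ++ [x]) mx' _ _ _ _ _ ?_ (by simpa using ht.ch x) (by simpa using ha.ch x)
          (by simpa using hb.ch x) (by simpa using hc.ch x) (by simpa using hd.ch x) k1 y
        · simpa using this
        · intro z hz
          rw [← List.cons_append] at hz
          rcases List.mem_append.mp hz with hz | hz
          · exact (hmx z hz).trans_le k2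
          · rw [List.mem_singleton.mp hz]; exact k3
      · have e := leA_spec hl
        have e1 := hs_mono (ht.bd x y)
        have e2 := ha.bd x y
        have e3 := hb.bd x y
        have e4 := hc.bd x y
        have e5 := hd.bd x y
        unfold QA
        rw [sumA4]
        rw [List.cons_append, List.tail_cons]
        omega

end

theorem goA_spec {t : Tr} (H : goW t = true) (h : goA t = true) (a : A4) (s : List A4) :
    hs (TW t s) ≤ ∑ b, TW t (b :: a :: s) := by
  have hT : ∀ (π : Equiv.Perm A4) w, TW t (w.map π) = TW t w := fun π w => TW_perm t w π
  have hA : ∀ s, QA (TW t) (.la :: s) := by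
    intro s
    have hS := rS_BD H
    exact dA_spec hT 60 [] .x1 _ _ _ _ _ (by simp [A4.nn, X.nn]) (rt_BD H)
      ((hS.ch .la).ch .la) ((hS.ch .lb).ch .la) ((hS.ch .lc).ch .la) ((hS.ch .ld).ch .la) h s
  have := hA (s.map (Equiv.swap a .la))
  have h2 := QA_perm hT (Equiv.swap a .la) (a :: s) (by simpa using this)
  exact h2

/-- sum over the other letters -/
def GS (T : List A4 → ℕ) : List A4 → ℕ
  | [] => 0
  | b :: x => ∑ c, if c = b then 0 else T (c :: x)

theorem GS_perm {T : List A4 → ℕ} (hT : ∀ (π : Equiv.Perm A4) w, T (w.map π) = T w) (π : Equiv.Perm A4)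
    (w : List A4) : GS T (w.map π) = GS T w := by
  cases w with
  | nil => rfl
  | cons b x =>
    simp only [List.map_cons, GS]
    rw [← Equiv.sum_comp π]
    apply Finset.sum_congr rfl
    intro c _
    rw [← List.map_cons, hT]
    simp only [π.injective.eq_iff]

theorem Lz_perm {F G : List A4 → ℕ} (hF : ∀ (π : Equiv.Perm A4) w, F (w.map π) = F w)
    (hG : ∀ (π : Equiv.Perm A4) w, G (w.map π) = G w) (π : Equiv.Perm A4) (z : List A4) (os : List ℕ) :
    ∀ g, Lz F G (z.map π) g os → Lz F G z g os := by
  induction os with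
  | nil => intro g h; exact h
  | cons o os ih =>
    intro g h
    simp only [Lz, ← List.map_drop, hF, hG] at h
    exact h.imp id (ih _)

theorem hs_30000 {x : ℕ} (h : x ≤ 10635) : hs x ≤ 30000 := by
  rw [hs_eq]; omega

theorem Inv_nil {F G : List A4 → ℕ} (fut : List ℕ) :
    Inv F G (fun z => Lz F G z 0 fut) [] 0 .nil fut := ⟨[], .nil, fun _ _ h => h⟩

theorem goB_spec {t : Tr} (H : goW t = true) {S : Sch} (h : goB S t = true) (hok : S.ok 0) {q : ℕ}
    (hq : q ∈ S.dep 0) {z : List A4} (hz : PerW q z) :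
    Lz (fun w => TW t (w.drop 2)) (GS (TW t)) z 0 (S.fut 0) := by
  have hT : ∀ (π : Equiv.Perm A4) w, TW t (w.map π) = TW t w := fun π w => TW_perm t w π
  have hF : ∀ (π : Equiv.Perm A4) (w : List A4), TW t ((w.map π).drop 2) = TW t (w.drop 2) := by
    intro π w; rw [← List.map_drop, hT]
  have hG := GS_perm hT
  have hS := rS_BD H
  have hR0 : RB (mkR (rt t) (ca (cb (rS t))) (ca (cc (rS t))) (ca (cd (rS t))))
      (fun w => TW t ((A4.la :: .la :: w).drop 2)) (fun w => GS (TW t) (.la :: .la :: w)) :=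
    mkR_RB (rt_BD H) ((hS.ch .lb).ch .la) ((hS.ch .lc).ch .la) ((hS.ch .ld).ch .la)
      (fun w => by simp [GS, sumA4])
  have hR1 : RB (mkR (rt t) (cb (cb (rS t))) (cb (cc (rS t))) (cb (cd (rS t))))
      (fun w => TW t ((A4.la :: .lb :: w).drop 2)) (fun w => GS (TW t) (.la :: .lb :: w)) :=
    mkR_RB (rt_BD H) ((hS.ch .lb).ch .lb) ((hS.ch .lc).ch .lb) ((hS.ch .ld).ch .lb)
      (fun w => by simp [GS, sumA4])
  have hR2 : RB (.v 30000 0) (fun w => TW t (w.drop 2)) (GS (TW t)) :=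
    ⟨fun w => hs_30000 (TW_le H _), fun w => Nat.zero_le _⟩
  exact dfs_spec hF hG (Goal := fun z => Lz (fun w => TW t (w.drop 2)) (GS (TW t)) z 0 (S.fut 0))
    (fun π z h => Lz_perm hF hG π z _ 0 h) hR0 hR1 hR2 S [] .la .x0 0 .nil (Inv_nil _) (by simp) (by simp)
    hok h q hq z (List.nil_prefix) hz

theorem Lz_zero {F : List A4 → ℕ} {z : List A4} : ∀ os : List ℕ, Lz F (fun _ => 0) z 0 os → ∃ o ∈ os, F (z.drop o) = 0
  | [], h => h.elim
  | o :: os, h => by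
    rcases h with h | h
    · refine ⟨o, by simp, ?_⟩
      have h' : hs (F (z.drop o)) ≤ 0 := h
      rw [hs_eq] at h'
      omega
    · have h0 : nxt 0 = 0 := by rw [nxt_eq]; norm_num
      have h : Lz F (fun _ => 0) z (nxt 0) os := h
      rw [h0] at h
      obtain ⟨o', h1, h2⟩ := Lz_zero os h
      exact ⟨o', by simp [h1], h2⟩

theorem goD_spec {t : Tr} (H : goW t = true) {S : Sch} (h : goD S t = true) (hok : S.ok 0) {q : ℕ}
    (hq : q ∈ S.dep 0) {z : List A4} (hz : PerW q z) :
    ∃ o ∈ S.fut 0, TW t (z.drop o) = 0 := by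
  have hT : ∀ (π : Equiv.Perm A4) w, TW t (w.map π) = TW t w := fun π w => TW_perm t w π
  have hR0 : ∀ f : List A4 → List A4, RB (.v 30000 0) (fun w => TW t (f w)) (fun _ => 0) :=
    fun f => ⟨fun w => hs_30000 (TW_le H _), fun w => Nat.zero_le _⟩
  have h0 : BD (fun x y => y ≤ x) (.v 0) (fun _ => 0) := fun _ => le_rfl
  have hR2 : RB (mkR (rt t) (.v 0) (.v 0) (.v 0)) (TW t) (fun _ => 0) :=
    mkR_RB (rt_BD H) h0 h0 h0 (fun w => rfl)
  have hG : ∀ (π : Equiv.Perm A4) (w : List A4), (fun _ : List A4 => 0) (w.map π) = (fun _ : List A4 => 0) w :=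
    fun _ _ => rfl
  exact Lz_zero _ (dfs_spec hT hG (Goal := fun z => Lz (TW t) (fun _ => 0) z 0 (S.fut 0))
    (fun π z h => Lz_perm hT hG π z _ 0 h) (hR0 _) (hR0 _) hR2 S [] .la .x0 0 .nil (Inv_nil _) (by simp) (by simp)
    hok h q hq z (List.nil_prefix) hz)
end


/-! ### The corrected weights -/

noncomputable section

/-- consecutive even offsets -/
def offs : ℕ → ℕ → List ℕ
  | _, 0 => []
  | j, m + 1 => (2 * j) :: offs (j + 1) m

/-- number of rounds for a period -/
def kq (q : ℕ) : ℕ := if q ≤ 10 then 2 else if q ≤ 12 then 4 else 5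

/-- the properties of the weights that are used -/
structure Hy (T : List A4 → ℕ) : Prop where
  perm : ∀ (π : Equiv.Perm A4) w, T (w.map π) = T w
  anti : ∀ w y, T (w ++ y) ≤ T w
  le : ∀ w, T w ≤ 10635
  range : ∀ w, T w = 0 ∨ 4441 ≤ T w
  hA : ∀ a s, hs (T s) ≤ ∑ b, T (b :: a :: s)
  hB : ∀ q z, 9 ≤ q → q ≤ 15 → PerW q z → Lz (fun w => T (w.drop 2)) (GS T) z 0 (offs 0 (kq q))
  hD : ∀ q z, 2 ≤ q → q ≤ 8 → PerW q z → ∃ i, T (z.drop (2 * i)) = 0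
  pos : 0 < T [.la]

/-- the first `m` letters agree with those at distance `q` -/
def Mt (q m : ℕ) (s : List A4) : Prop := q + m ≤ s.length ∧ ∀ i < m, s[i]? = s[i + q]?

theorem Mt.le {q m m' : ℕ} {s : List A4} (h : Mt q m s) (hm : m' ≤ m) : Mt q m' s :=
  ⟨by have := h.1; omega, fun i hi => h.2 i (by omega)⟩

theorem Mt.drop {q m : ℕ} {s : List A4} (h : Mt q m s) (k : ℕ) : Mt q (m - k) (s.drop k) ∨ m < k := by
  by_cases hk : k ≤ m
  · refine Or.inl ⟨?_, fun i hi => ?_⟩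
    · have := h.1
      rw [List.length_drop]; omega
    · rw [List.getElem?_drop, List.getElem?_drop, h.2 _ (by omega)]
      congr 1; omega
  · exact Or.inr (by omega)

theorem Mt.app {q m : ℕ} {s : List A4} (h : Mt q m s) (y : List A4) : Mt q m (s ++ y) := by
  refine ⟨?_, fun i hi => ?_⟩
  · have := h.1
    rw [List.length_append]; omega
  · have := h.1
    rw [List.getElem?_append_left (by omega), List.getElem?_append_left (by omega), h.2 i hi]

theorem Mt.map {q m : ℕ} {s : List A4} (h : Mt q m s) (π : Equiv.Perm A4) : Mt q m (s.map π) := by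
  refine ⟨by simpa using h.1, fun i hi => ?_⟩
  rw [List.getElem?_map, List.getElem?_map, h.2 i hi]

theorem Mt.perW {q : ℕ} {z : List A4} (h : Mt q (q - 1) z) (hq : 1 ≤ q) : PerW q z := by
  obtain ⟨h1, h2⟩ := h
  refine ⟨z.take q, z.drop (q + (q - 1)), ?_, ?_⟩
  · rw [List.length_take]; omega
  · have e : (z.take q).dropLast = (z.drop q).take (q - 1) := by
      apply List.ext_getElem?
      intro i
      rw [List.dropLast_eq_take, List.length_take, List.take_take, List.getElem?_take, List.getElem?_take,
        List.getElem?_drop]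
      have e1 : min (min q z.length - 1) q = q - 1 := by omega
      rw [e1]
      by_cases hi : i < q - 1
      · rw [if_pos hi, if_pos hi, h2 i hi]
        congr 1; omega
      · rw [if_neg hi, if_neg hi]
    rw [e, ← List.take_add, List.take_append_drop]

section
variable {T : List A4 → ℕ}

variable (T) in
/-- correction along a periodic word -/
def Gz (z : List A4) : ℕ → ℕ
  | 0 => 0
  | j + 1 => min (T (z.drop (2 * j + 2))) (nxt (Gz z j + GS T (z.drop (2 * j))))

variable (h : Hy T)
include h

theorem nxt_of_hs {t x : ℕ} (ht : t = 0 ∨ 4441 ≤ t) (hx : hs t ≤ x) : t ≤ nxt x := by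
  rcases ht with rfl | ht
  · exact Nat.zero_le _
  · rw [hs_eq] at hx
    rw [nxt_eq]
    have : t ≤ x * 6541 / 12914 := by omega
    rw [if_pos (by omega)]
    exact this

theorem lossless {z : List A4} (m : ℕ) : ∀ (j g : ℕ), g ≤ Gz T z j →
    Lz (fun w => T (w.drop 2)) (GS T) z g (offs j m) → ∃ i < j + m, Gz T z (i + 1) = T (z.drop (2 * i + 2)) := by
  induction m with
  | zero => intro j g _ hL; exact hL.elim
  | succ m ih =>
    intro j g hg hL
    by_cases hT : T (z.drop (2 * j + 2)) ≤ nxt (Gz T z j + GS T (z.drop (2 * j)))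
    · exact ⟨j, by omega, min_eq_left hT⟩
    · rcases hL with hL | hL
      · exfalso
        apply hT
        apply nxt_of_hs h (h.range _)
        simp only [List.drop_drop] at hL
        omega
      · have hle : nxt (g + GS T (z.drop (2 * j))) ≤ Gz T z (j + 1) := by
          have e : Gz T z (j + 1) = nxt (Gz T z j + GS T (z.drop (2 * j))) := min_eq_right (by omega)
          rw [e]
          exact nxt_mono (by omega)
        obtain ⟨i, hi, hi'⟩ := ih (j + 1) _ hle hL
        exact ⟨i, by omega, hi'⟩

theorem sum_GS (b : A4) (x : List A4) : ∑ c, T (c :: x) = T (b :: x) + GS T (b :: x) := by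
  rw [GS, ← Finset.add_sum_erase _ _ (Finset.mem_univ b)]
  congr 1
  rw [← Finset.sum_erase (s := Finset.univ) (a := b) (f := fun c => if c = b then 0 else T (c :: x)) (by simp)]
  apply Finset.sum_congr rfl
  intro c hc
  rw [if_neg (Finset.ne_of_mem_erase hc)]

theorem persist {z : List A4} {i : ℕ} (hi : 2 * i + 2 ≤ z.length) (hz : Gz T z i = T (z.drop (2 * i))) :
    Gz T z (i + 1) = T (z.drop (2 * i + 2)) := by
  rw [Gz]
  apply min_eq_left
  apply nxt_of_hs h (h.range _)
  obtain ⟨b, a, s, hs⟩ : ∃ b a s, z.drop (2 * i) = b :: a :: s := by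
    have hl : (z.drop (2 * i)).length = z.length - 2 * i := List.length_drop
    match hd : z.drop (2 * i) with
    | [] => rw [hd] at hl; simp at hl; omega
    | [b] => rw [hd] at hl; simp at hl; omega
    | b :: a :: s => exact ⟨b, a, s, rfl⟩
  have hs2 : z.drop (2 * i + 2) = s := by
    rw [← List.drop_drop, hs]; rfl
  rw [hz, hs2, hs, ← sum_GS h]
  exact h.hA a s

theorem Gz_eq {q : ℕ} {z : List A4} (h9 : 9 ≤ q) (h15 : q ≤ 15) (hM : Mt q (q - 1) z) {k : ℕ} (hk : kq q ≤ k)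
    (hl : 2 * k ≤ z.length) : Gz T z k = T (z.drop (2 * k)) := by
  obtain ⟨i, hi, hi'⟩ := lossless h (kq q) 0 0 (Nat.zero_le _) (h.hB q z h9 h15 (hM.perW (by omega)))
  have : ∀ k, i + 1 ≤ k → 2 * k ≤ z.length → Gz T z k = T (z.drop (2 * k)) := by
    intro k hk
    induction k, hk using Nat.le_induction with
    | base => intro _; exact hi'
    | succ k hk ih => intro hl; exact persist h (by omega) (ih (by omega))
  exact this k (by omega) hl

omit h
variable (T) in
def alive (s : List A4) : Prop := ∀ i, T (s.drop (2 * i)) ≠ 0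
variable (T) in
def Cand (s : List A4) (x : ℕ) : Prop := ∃ (q k : ℕ) (z : List A4), 9 ≤ q ∧ q ≤ 15 ∧ 2 * k + 1 ≤ q ∧
  z.drop (2 * k) = s ∧ Mt q (q - 1) z ∧ x = Gz T z k
variable (T) in
/-- the corrected weight -/
def gw (s : List A4) : ℕ := if alive T s then sInf {x | x = T s ∨ Cand T s x} else 0

theorem gw_mem {s : List A4} (hs : alive T s) : gw T s = T s ∨ Cand T s (gw T s) := by
  rw [gw, if_pos hs]
  exact Nat.sInf_mem (s := {x | x = T s ∨ Cand T s x}) ⟨T s, Or.inl rfl⟩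
theorem gw_le_T (s : List A4) : gw T s ≤ T s := by
  rw [gw]
  split_ifs
  · exact Nat.sInf_le (Or.inl rfl)
  · exact Nat.zero_le _
theorem gw_le_cand {s : List A4} {x : ℕ} (hx : Cand T s x) : gw T s ≤ x := by
  rw [gw]
  split_ifs
  · exact Nat.sInf_le (Or.inr hx)
  · exact Nat.zero_le _
theorem alive_of_gw {s : List A4} (hs : gw T s ≠ 0) : alive T s := by
  by_contra hh
  exact hs (if_neg hh)
theorem alive_drop {s : List A4} (hs : alive T s) (j : ℕ) : alive T (s.drop (2 * j)) := by
  intro i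
  have := hs (j + i)
  rwa [List.drop_drop, ← mul_add]

include h
theorem gw_range (s : List A4) : gw T s = 0 ∨ 4441 ≤ gw T s := by
  by_cases hs : alive T s
  · rcases gw_mem hs with hx | ⟨q, k, z, _, _, _, _, _, hx⟩
    · rw [hx]; exact h.range s
    · rw [hx]
      cases k with
      | zero => exact Or.inl rfl
      | succ k =>
        rw [Gz]
        have h1 := h.range (z.drop (2 * k + 2))
        have h2 := nxt_eq (Gz T z k + GS T (z.drop (2 * k)))
        split_ifs at h2 <;> omega
  · exact Or.inl (if_neg hs)

theorem T_nil_pos : 0 < T [] := h.pos.trans_le (h.anti [] [.la])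

theorem alive_app {s y : List A4} (hs : alive T (s ++ y)) : alive T s := by
  intro i hi
  by_cases hl : 2 * i ≤ s.length
  · apply hs i
    rw [List.drop_append_of_le_length hl]
    have := h.anti (s.drop (2 * i)) y
    omega
  · rw [List.drop_eq_nil_of_le (by omega)] at hi
    have := T_nil_pos h
    omega

theorem Gz_app (z y : List A4) (j : ℕ) : 2 * j ≤ z.length → Gz T (z ++ y) j ≤ Gz T z j := by
  induction j with
  | zero => intro _; exact le_rfl
  | succ j ih =>
    intro hj
    rw [Gz, Gz, List.drop_append_of_le_length (by omega), List.drop_append_of_le_length (by omega)]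
    refine min_le_min (h.anti _ _) (nxt_mono (Nat.add_le_add (ih (by omega)) ?_))
    have hl : (z.drop (2 * j)).length = z.length - 2 * j := List.length_drop
    cases hd : z.drop (2 * j) with
    | nil => rw [hd] at hl; simp at hl; omega
    | cons b x =>
      rw [List.cons_append, GS, GS]
      apply Finset.sum_le_sum
      intro c _
      split_ifs
      · exact le_rfl
      · exact h.anti (c :: x) y

theorem gw_app (s y : List A4) : gw T (s ++ y) ≤ gw T s := by
  by_cases hs : alive T (s ++ y)
  · rcases gw_mem (alive_app h hs) with hx | ⟨q, k, z, h1, h2, h3, h4, h5, hx⟩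
    · rw [hx]; exact (gw_le_T _).trans (h.anti _ _)
    · have hl : 2 * k ≤ z.length := by have := h5.1; omega
      rw [hx]
      refine (gw_le_cand ⟨q, k, z ++ y, h1, h2, h3, ?_, h5.app y, rfl⟩).trans (Gz_app h z y k hl)
      rw [List.drop_append_of_le_length hl, h4]
  · rw [gw, if_neg hs]; exact Nat.zero_le _

theorem Gz_perm (z : List A4) (π : Equiv.Perm A4) (j : ℕ) : Gz T (z.map π) j = Gz T z j := by
  induction j with
  | zero => rfl
  | succ j ih => rw [Gz, Gz, ih, ← List.map_drop, ← List.map_drop, h.perm, GS_perm h.perm]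

theorem gw_perm (s : List A4) (π : Equiv.Perm A4) : gw T (s.map π) ≤ gw T s := by
  by_cases hs : alive T s
  · rcases gw_mem hs with hx | ⟨q, k, z, h1, h2, h3, h4, h5, hx⟩
    · rw [hx, ← h.perm π s]; exact gw_le_T _
    · rw [hx, ← Gz_perm h z π k]
      exact gw_le_cand ⟨q, k, z.map π, h1, h2, h3, by rw [← List.map_drop, h4], h5.map π, rfl⟩
  · have : ¬ alive T (s.map π) := by
      intro h'
      apply hs
      intro i
      have := h' i
      rwa [← List.map_drop, h.perm] at this
    rw [gw, if_neg this]; exact Nat.zero_le _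

theorem gw_single (x : A4) : 0 < gw T [x] := by
  have hx : 0 < T [x] := by
    have := h.perm (Equiv.swap x .la) [x]
    simp at this
    rw [← this]; exact h.pos
  have ha : alive T [x] := by
    intro i
    cases i with
    | zero => exact hx.ne'
    | succ i =>
      rw [List.drop_eq_nil_of_le (by simp; omega)]
      exact (T_nil_pos h).ne'
  rcases gw_mem ha with hx' | ⟨q, k, z, h1, h2, h3, h4, h5, _⟩
  · omega
  · exfalso
    have e := congrArg List.length h4
    rw [List.length_drop] at e
    have := h5.1
    simp at e
    omega

theorem dead_of_Mt {s : List A4} {d j : ℕ} (h2 : 2 ≤ d) (h8 : d ≤ 8) (hM : Mt d (d - 1) (s.drop (2 * j))) :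
    ¬ alive T s := by
  intro hs
  obtain ⟨i, hi⟩ := h.hD d _ h2 h8 (hM.perW (by omega))
  exact alive_drop hs j i hi

theorem gw_zero {s : List A4} {q : ℕ} (h2 : 2 ≤ q) (h15 : q ≤ 15) (hM : Mt q (q - 1) s) : gw T s = 0 := by
  by_cases h8 : q ≤ 8
  · exact if_neg (dead_of_Mt h (j := 0) h2 h8 hM)
  · exact Nat.le_zero.mp (gw_le_cand ⟨q, 0, s, by omega, h15, by omega, rfl, hM, rfl⟩)

omit h in
/-- no squares -/
def NSq (s : List A4) : Prop := ∀ q o, 2 ≤ q → q ≤ 15 → ¬ Mt q q (s.drop o)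

theorem gw_notfree {s : List A4} {a b : A4} (hs : NSq s) (hg : gw T s ≠ 0) (hn : ¬ NSq (b :: a :: s)) :
    gw T (b :: a :: s) = 0 := by
  unfold NSq at hn
  push Not at hn
  obtain ⟨q, o, h2, h15, hM⟩ := hn
  match o with
  | 0 => exact gw_zero h h2 h15 (hM.le (by omega))
  | 1 =>
    exfalso
    apply hg
    rcases hM.drop 1 with hM | hM
    · exact gw_zero h h2 h15 hM
    · omega
  | o + 2 => exact absurd hM (hs q o h2 h15)

/-- a lossy successor -/
theorem lossy_spec {s : List A4} {a b : A4} (hs : alive T s) (hb : gw T (b :: a :: s) ≠ T (b :: a :: s)) :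
    ∃ q, 9 ≤ q ∧ q ≤ 15 ∧ Mt q (q + 1 - 2 * kq q) (b :: a :: s) ∧
      gw T s ≤ nxt (gw T (b :: a :: s) + GS T (b :: a :: s)) := by
  have hal : alive T (b :: a :: s) := by
    by_contra hh
    apply hb
    have : T (b :: a :: s) = 0 := by
      by_contra h0
      apply hh
      intro i
      cases i with
      | zero => exact h0
      | succ i => exact hs i
    rw [this, gw, if_neg hh]
  rcases gw_mem hal with hx | ⟨q, k, z, h1, h2, h3, h4, h5, hx⟩
  · exact absurd hx hb
  · have hl := h5.1
    have hk : k < kq q := by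
      by_contra hk
      apply hb
      rw [hx, Gz_eq h h1 h2 h5 (by omega) (by omega), h4]
    have hkq : 2 * kq q + 1 ≤ q := by
      unfold kq
      split_ifs <;> omega
    refine ⟨q, h1, h2, ?_, ?_⟩
    · rcases h5.drop (2 * k) with h6 | h6
      · rw [h4] at h6
        exact h6.le (by omega)
      · omega
    · refine (gw_le_cand ⟨q, k + 1, z, h1, h2, by omega, ?_, h5, rfl⟩).trans ?_
      · rw [mul_add, mul_one, ← List.drop_drop, h4]; rfl
      · rw [Gz, ← hx, h4]
        exact min_le_right _ _

omit h in
theorem Mt_sub {x : List A4} {b c : A4} {q1 q2 m1 m2 m : ℕ} (h1 : Mt q1 m1 (b :: x)) (h2 : Mt q2 m2 (c :: x))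
    (hq : q1 < q2) (hm1 : m + 1 ≤ m1) (hm2 : m + 1 ≤ m2) : Mt (q2 - q1) m (x.drop q1) := by
  refine ⟨?_, fun i hi => ?_⟩
  · have := h2.1
    rw [List.length_cons] at this
    rw [List.length_drop]; omega
  · have e1 := h1.2 (i + 1) (by omega)
    have e2 := h2.2 (i + 1) (by omega)
    rw [show i + 1 + q1 = (i + q1) + 1 by omega, List.getElem?_cons_succ, List.getElem?_cons_succ] at e1
    rw [show i + 1 + q2 = (i + q2) + 1 by omega, List.getElem?_cons_succ, List.getElem?_cons_succ] at e2
    rw [List.getElem?_drop, List.getElem?_drop, show q1 + i = i + q1 by omega, ← e1,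
      show q1 + (i + (q2 - q1)) = i + q2 by omega, e2]

omit h in
theorem Mt_one {x : List A4} {m : ℕ} (h1 : Mt 1 m x) (hm : 2 ≤ m) : Mt 2 1 x := by
  refine ⟨by have := h1.1; omega, fun i hi => ?_⟩
  have e1 := h1.2 0 (by omega)
  have e2 := h1.2 1 (by omega)
  obtain rfl : i = 0 := by omega
  rw [e1, e2]

theorem two_lossy_lt {s : List A4} {a b c : A4} (hs : alive T s) {q1 q2 : ℕ} (h9 : 9 ≤ q1) (h15 : q2 ≤ 15)
    (hq : q1 < q2) (h1 : Mt q1 (q1 + 1 - 2 * kq q1) (b :: a :: s)) (h2 : Mt q2 (q2 + 1 - 2 * kq q2) (c :: a :: s)) :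
    False := by
  have key : ∀ m, m + 1 ≤ q1 + 1 - 2 * kq q1 → m + 1 ≤ q2 + 1 - 2 * kq q2 → Mt (q2 - q1) m ((a :: s).drop q1) :=
    fun m hm1 hm2 => Mt_sub h1 h2 hq hm1 hm2
  have fin : ∀ j m, Mt (q2 - q1) m (s.drop (2 * j)) → ((q2 - q1 = 1 ∧ 2 ≤ m) ∨ (2 ≤ q2 - q1 ∧ q2 - q1 ≤ m + 1)) → False := by
    intro j m hM hc
    rcases hc with ⟨hd, hm⟩ | ⟨hd, hm⟩
    · rw [hd] at hM
      exact dead_of_Mt h le_rfl (by omega) (Mt_one hM hm) hs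
    · exact dead_of_Mt h hd (by omega) (hM.le (by omega)) hs
  have hm : ∃ m, m + 1 ≤ q1 + 1 - 2 * kq q1 ∧ m + 1 ≤ q2 + 1 - 2 * kq q2 ∧
      ((q1 % 2 = 1 ∧ ((q2 - q1 = 1 ∧ 2 ≤ m) ∨ (2 ≤ q2 - q1 ∧ q2 - q1 ≤ m + 1))) ∨
        (q1 % 2 = 0 ∧ ((q2 - q1 = 1 ∧ 2 ≤ m - 1) ∨ (2 ≤ q2 - q1 ∧ q2 - q1 ≤ m - 1 + 1)) ∧ 1 ≤ m)) := by
    refine ⟨min (q1 - 2 * kq q1) (q2 - 2 * kq q2), ?_⟩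
    have hq1 : q1 ≤ 15 := by omega
    have hq2 : 9 ≤ q2 := by omega
    unfold kq
    interval_cases q1 <;> interval_cases q2 <;> simp_all
  obtain ⟨m, hm1, hm2, ⟨ho, hm⟩ | ⟨he, hm, hm0⟩⟩ := hm
  · have hM := key m hm1 hm2
    obtain ⟨j, hj⟩ : ∃ j, q1 = 2 * j + 1 := ⟨q1 / 2, by omega⟩
    have hd : (a :: s).drop q1 = s.drop (2 * j) := by rw [hj]; rfl
    rw [hd] at hM
    exact fin j m hM hm
  · have hM := key m hm1 hm2
    obtain ⟨j, hj⟩ : ∃ j, q1 = 2 * j := ⟨q1 / 2, by omega⟩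
    rcases hM.drop 1 with hM | hM
    · have hd : ((a :: s).drop q1).drop 1 = s.drop (2 * j) := by rw [List.drop_drop, ← hj]; rfl
      rw [hd] at hM
      exact fin j _ hM hm
    · omega

theorem two_lossy {s : List A4} {a b c : A4} (hs : alive T s) {q1 q2 : ℕ} (h9 : 9 ≤ q1) (h15 : q1 ≤ 15)
    (h9' : 9 ≤ q2) (h15' : q2 ≤ 15)
    (h1 : Mt q1 (q1 + 1 - 2 * kq q1) (b :: a :: s)) (h2 : Mt q2 (q2 + 1 - 2 * kq q2) (c :: a :: s)) :
    b = c := by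
  rcases lt_trichotomy q1 q2 with hq | hq | hq
  · exact (two_lossy_lt h hs h9 h15' hq h1 h2).elim
  · subst hq
    have hk : 0 < q1 + 1 - 2 * kq q1 := by
      unfold kq
      split_ifs <;> omega
    have e1 := h1.2 0 hk
    have e2 := h2.2 0 hk
    obtain ⟨n, rfl⟩ : ∃ n, q1 = n + 1 := ⟨q1 - 1, by omega⟩
    rw [Nat.zero_add, List.getElem?_cons_succ] at e1 e2
    rw [← e2] at e1
    simpa using e1
  · exact (two_lossy_lt h hs h9' h15 hq h2 h1).elim

theorem main_ineq {s : List A4} (hs : NSq s) (a : A4) :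
    12914 * gw T s ≤ 6541 * ∑ b, if NSq (b :: a :: s) then gw T (b :: a :: s) else 0 := by
  by_cases hg : gw T s = 0
  · rw [hg]; simp
  have hal := alive_of_gw hg
  have e : ∑ b, (if NSq (b :: a :: s) then gw T (b :: a :: s) else 0) = ∑ b, gw T (b :: a :: s) := by
    apply Finset.sum_congr rfl
    intro b _
    split_ifs with hb
    · rfl
    · rw [gw_notfree h hs hg hb]
  rw [e]
  by_cases hl : ∃ b, gw T (b :: a :: s) ≠ T (b :: a :: s)
  · obtain ⟨b, hb⟩ := hl
    obtain ⟨q, h9, h15, hM, hle⟩ := lossy_spec h hal hb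
    have hother : ∀ c, c ≠ b → gw T (c :: a :: s) = T (c :: a :: s) := by
      intro c hc
      by_contra hc'
      obtain ⟨q', h9', h15', hM', _⟩ := lossy_spec h hal hc'
      exact hc (two_lossy h hal h9' h15' h9 h15 hM' hM)
    have hsum : ∑ c, gw T (c :: a :: s) = gw T (b :: a :: s) + GS T (b :: a :: s) := by
      have e3 : GS T (b :: a :: s) = ∑ c ∈ Finset.univ.erase b, gw T (c :: a :: s) := by
        rw [GS, ← Finset.sum_erase (s := Finset.univ) (a := b)
          (f := fun c => if c = b then 0 else T (c :: a :: s)) (by simp)]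
        apply Finset.sum_congr rfl
        intro c hc
        rw [if_neg (Finset.ne_of_mem_erase hc), hother c (Finset.ne_of_mem_erase hc)]
      rw [e3, Finset.add_sum_erase _ (fun c => gw T (c :: a :: s)) (Finset.mem_univ b)]
    rw [← hsum, nxt_eq] at hle
    split_ifs at hle <;> omega
  · push Not at hl
    have h1 := h.hA a s
    have h2 := gw_le_T (T := T) s
    have h3 : ∑ b, gw T (b :: a :: s) = ∑ b, T (b :: a :: s) := Finset.sum_congr rfl fun b _ => hl b
    rw [h3]
    rw [hs_eq] at h1
    omega
end
end


/-! ### Transfer to the alphabet `Fin 4` -/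

noncomputable section

theorem HasSq_map {A B : Type*} (f : A → B) {lo hi : ℕ} {w : List A} (h : HasSq lo hi w) :
    HasSq lo hi (w.map f) := by
  obtain ⟨u, h1, h2, h3⟩ := h
  refine ⟨u.map f, by simpa using h1, by simpa using h2, ?_⟩
  rw [← List.map_append]
  exact h3.map f

theorem HasSq_reverse {A : Type*} {lo hi : ℕ} {w : List A} (h : HasSq lo hi w) :
    HasSq lo hi w.reverse := by
  obtain ⟨u, h1, h2, h3⟩ := h
  refine ⟨u.reverse, by simpa using h1, by simpa using h2, ?_⟩
  rw [← List.reverse_append]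
  exact List.reverse_infix.mpr h3

theorem not_NSq_of_HasSq {s : List A4} (h : HasSq 2 15 s) : ¬ NSq s := by
  obtain ⟨u, h1, h2, l, r, rfl⟩ := h
  intro hN
  refine hN u.length l.length h1 h2 ?_
  have : (l ++ (u ++ u) ++ r).drop l.length = u ++ (u ++ r) := by simp
  rw [this]
  refine ⟨by simp, fun i hi => ?_⟩
  rw [List.getElem?_append_left hi, List.getElem?_append_right (by omega), Nat.add_sub_cancel,
    List.getElem?_append_left hi]

theorem HasSq_of_not_NSq {s : List A4} (h : ¬ NSq s) : HasSq 2 15 s := by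
  unfold NSq at h
  push Not at h
  obtain ⟨q, o, h2, h15, hl, hM⟩ := h
  have hlen : ((s.drop o).take q).length = q := by rw [List.length_take]; omega
  refine ⟨(s.drop o).take q, by omega, by omega, s.take o, (s.drop o).drop (q + q), ?_⟩
  have e : (s.drop o).take q = ((s.drop o).drop q).take q := by
    apply List.ext_getElem?
    intro i
    rw [List.getElem?_take, List.getElem?_take]
    by_cases hi : i < q
    · rw [if_pos hi, if_pos hi, hM i hi, List.getElem?_drop (xs := s.drop o), Nat.add_comm]
    · rw [if_neg hi, if_neg hi]
  have e2 : (s.drop o).take q ++ (s.drop o).take q = (s.drop o).take (q + q) := by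
    rw [List.take_add, ← e]
  rw [e2, List.append_assoc, List.take_append_drop, List.take_append_drop]

/-- letters -/
def e4 : Fin 4 ≃ A4 where
  toFun i := match i with | 0 => .la | 1 => .lb | 2 => .lc | 3 => .ld
  invFun a := match a with | .la => 0 | .lb => 1 | .lc => 2 | .ld => 3
  left_inv i := by fin_cases i <;> rfl
  right_inv a := by cases a <;> rfl

/-- newest letter first -/
def tow (v : List (Fin 4)) : List A4 := (v.map e4).reverse

theorem NSq_tow (v : List (Fin 4)) : NSq (tow v) ↔ ¬ HasSq 2 15 v := by
  constructor
  · intro h h'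
    exact not_NSq_of_HasSq (HasSq_reverse (HasSq_map e4 h')) h
  · intro h
    by_contra h'
    apply h
    have := HasSq_map e4.symm (HasSq_reverse (HasSq_of_not_NSq h'))
    simpa [tow] using this

theorem Lam_free {v : List (Fin 4)} (hv : v ∈ Lam 2 15) : ¬ HasSq 2 15 v := by
  obtain ⟨_, s, hs, hp, hne⟩ := hv
  rintro ⟨u, h1, h2, h3⟩
  refine hs.2 (u ++ u) (h3.trans hp.isInfix) ?_ ⟨u, h1, h2, rfl⟩
  intro he
  have l1 := h3.length_le
  have l2 := hp.length_le
  rw [he] at l1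
  exact hne (hp.eq_of_length (by omega))

theorem gw_lamOf {T : List A4 → ℕ} (h : Hy T) (w : List (Fin 4)) :
    gw T (tow w) ≤ gw T (tow (lamOf 2 15 w)) := by
  unfold lamOf
  split_ifs with hex
  · obtain ⟨⟨_, π, l, hl⟩, _⟩ := hex.choose_spec
    generalize hex.choose = v at hl
    subst hl
    have e1 : tow (l ++ v.map π) = (tow v).map ((e4.symm.trans π).trans e4) ++ tow l := by
      simp [tow, Function.comp_def]
    rw [e1]
    exact (gw_app h _ _).trans (gw_perm h _ _)
  · exact gw_app h [] (tow w)

theorem final {T : List A4 → ℕ} (h : Hy T) :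
    ∃ C : List (Fin 4) → ℝ,
      (∀ v ∈ Lam 2 15, 0 ≤ C v) ∧
      0 < C [0] ∧
      (∀ v ∈ Lam 2 15, C v ≤ 10635 ∧ (C v = 0 ∨ 4441 ≤ C v)) ∧
      (∀ v ∈ Lam 2 15, ∀ a : Fin 4,
        (12914 / 6541 : ℝ) * C v ≤
          ∑ b : Fin 4,
            if ¬ HasSq 2 15 (v ++ [a, b]) then C (lamOf 2 15 (v ++ [a, b])) else 0) := by
  refine ⟨fun v => (gw T (tow v) : ℝ), fun v _ => Nat.cast_nonneg _, ?_, fun v _ => ⟨?_, ?_⟩, fun v hv a => ?_⟩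
  · exact Nat.cast_pos.mpr (gw_single h _)
  · show (gw T (tow v) : ℝ) ≤ 10635
    exact_mod_cast (gw_le_T (tow v)).trans (h.le _)
  · show (gw T (tow v) : ℝ) = 0 ∨ (4441:ℝ) ≤ (gw T (tow v) : ℝ)
    exact_mod_cast gw_range h (tow v)
  · have h1 := main_ineq h ((NSq_tow v).mpr (Lam_free hv)) (e4 a)
    rw [← Equiv.sum_comp e4] at h1
    have e1 : ∀ b, e4 b :: e4 a :: tow v = tow (v ++ [a, b]) := by intro b; simp [tow]
    have h2 : ∑ b : Fin 4, (if NSq (e4 b :: e4 a :: tow v) then gw T (e4 b :: e4 a :: tow v) else 0) ≤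
        ∑ b : Fin 4, if ¬ HasSq 2 15 (v ++ [a, b]) then gw T (tow (lamOf 2 15 (v ++ [a, b]))) else 0 := by
      apply Finset.sum_le_sum
      intro b _
      rw [e1 b]
      by_cases hb : HasSq 2 15 (v ++ [a, b])
      · rw [if_neg (fun hh => (NSq_tow _).mp hh hb)]; exact Nat.zero_le _
      · rw [if_pos ((NSq_tow _).mpr hb), if_pos hb]
        exact gw_lamOf h _
    have h3 : 12914 * gw T (tow v) ≤
        6541 * ∑ b : Fin 4, if ¬ HasSq 2 15 (v ++ [a, b]) then gw T (tow (lamOf 2 15 (v ++ [a, b]))) else 0 :=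
      h1.trans (Nat.mul_le_mul_left _ h2)
    have h4 : (12914 : ℝ) * gw T (tow v) ≤ 6541 * ∑ b : Fin 4,
        if ¬ HasSq 2 15 (v ++ [a, b]) then (gw T (tow (lamOf 2 15 (v ++ [a, b]))) : ℝ) else 0 := by
      exact_mod_cast h3
    rw [div_mul_eq_mul_div, div_le_iff₀ (by norm_num)]
    linarith

section
open Sch
theorem mkHy {t : Tr} (W : goW t = true) (A : goA t = true)
    (D : goD (z <| s <| s <| z <| n <| w 20 <| s <| n <| w 20 <| s <| z <| n <| w 20 <| s <| n <| w 20 <| s <| z <| n <| w 20 <| s <| n <| w 20 <| s <| n <| w 20 <| nil) t = true)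
    (B1 : goB (s <| p <| s <| p <| n <| s <| s <| n <| s <| s <| n <| s <| n <| w 6 <| s <| n <| w 6 <| nil) t = true)
    (B2 : goB (s <| p <| s <| p <| n <| s <| p <| n <| s <| p <| n <| s <| s <| n <| s <| n <| w 6 <| s <| n <| w 6 <| nil) t = true)
    (B3 : goB (s <| p <| s <| p <| n <| s <| p <| n <| s <| p <| n <| s <| p <| n <| s <| s <| n <| s <| n <| w 6 <| s <| n <| w 6 <| s <| n <| w 6 <| nil) t = true)
    (hp : 0 < TW t [.la]) : Hy (TW t) where
  perm π w := TW_perm t w π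
  anti := TW_anti W
  le := TW_le W
  range := TW_range W
  hA := goA_spec W A
  hB q z h9 h15 hz := by
    by_cases h10 : q ≤ 10
    · have e : kq q = 2 := if_pos h10
      rw [e]
      exact goB_spec W B1 (by simp [Sch.ok]) (by simp [Sch.dep]; omega) hz
    · by_cases h12 : q ≤ 12
      · have e : kq q = 4 := by rw [kq, if_neg h10, if_pos h12]
        rw [e]
        exact goB_spec W B2 (by simp [Sch.ok]) (by simp [Sch.dep]; omega) hz
      · have e : kq q = 5 := by rw [kq, if_neg h10, if_neg h12]
        rw [e]
        exact goB_spec W B3 (by simp [Sch.ok]) (by simp [Sch.dep]; omega) hz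
  hD q z h2 h8 hz := by
    obtain ⟨o, ho, h0⟩ := goD_spec W D (by simp [Sch.ok]) (q := q) (by simp [Sch.dep]; omega) hz
    have : 2 ∣ o := by
      simp [Sch.fut] at ho
      omega
    obtain ⟨i, rfl⟩ := this
    exact ⟨i, h0⟩
  pos := hp
end
end

set_option maxRecDepth 100000
def trie : Tr :=
  (N (N (L 0) (N (N (L 0) (N (N (N (L 10217).b.a.b.a.a.d.c e (L 10217).a.b.a.a.d e) (N (L 
  10187).b.a.b.a.a.d.c e (L 10173).a.b.a.a.d.b.a.c.b.d.c e) (L 10173).b.a.b.a.a.d.b.a e) (N (N (L 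
  10217).b.a.b.a.a.d.c e (L 10187).a.b.a.a.d e) (N (L 10187).b.a.b.a.a.d.c e (N (L 
  10173).a.b.a.a.c.b.a.d.b.b e (L 10173).a.b.a.a.d.b.a.c.b.d e) e) (N (N e (N e (L 
  10173).b.a.a.c.b.a.d e (L 10123).b.a.a) e (L 10173).a.b.a.a.c.b.a.d.b.c) e (L 
  10173).b.a.a.d.b.a.c.b.d e) e) (N (N (N e e (L 10217).b.a.b.a.a.d (L 10217).b.a.b.a.a.c) (L 
  10173).a.b.a.a.d e (L 10173).b.a.a.c.b.a.d.b.c) (N (N e e (L 10187).b.a.b.a.a.d (L 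
  10187).b.a.b.a.a.c) e e (L 10173).a.b.a.a.d.b.a.c.b.b.a) (N (N (L 10173).a.b.a.a.c.b.a.d.b.b (L 
  10173).b.a.b.a.a.d e (L 10173).a.b.a.a.c.b.a.d.b.c) e e (L 10173).a.a.d.b.a.c.b) (N (L 
  10173).a.b.a.a.d.b.a.c.b.b (L 10173).b.a.b.a.a.c e e).a) e) (N (N (N (N e (H 9807 (N (L 0).c (N 
  e e (L 9718).b.a.a.a.b.a (L 9718).b.a.a.a.b.a) e e)) (L 10217).c.a.b.a.a.d (L 
  10217).c.a.b.a.a.c) (L 0).a (L 10217).a.b.a.a.d (N (L 0).a.a.c.a.b.a e (L 10217).a.b.a.a e)) (N 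
  (N (H 9807 (L 0).b.a).c.a.b.a e (L 10187).c.a.b.a.a.d (L 10187).c.a.b.a.a.c) (N (H 9729 (L 
  0).b.a).c.a.b.a e e (L 10173).b.a.a.c.b.a) (N (H 10123 (L 0).b.a).c.a.b.a e (L 
  10173).a.b.a.a.d.b.a.c.b.d e) (N (H 10123 (L 0).b.a.c.a).b.a e e (L 
  10173).a.b.a.a.c.b.a.d.b.c)) (L 10173).c.a.b.a.a.d.b.a (N (N (N (H 9807 (L 0).d.a).c.a.b (L 
  0).a.c.a e e) (L 10173).c.a.b.a.a.c e e) (H 9768 (L 0).d.a).c.a.b.a.a (H 7761 (L 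
  0).d.a).c.a.b.a.a (H 7164 (L 0).d.a).c.a.b.a.a)) (N (N (N (H 9807 (L 0).b.c).a.b (H 9768 (N (L 
  0).c (N e e (L 9676).b.a.a.b.b.a (L 9676).b.a.a.b.b.a) e e)) (L 10217).c.a.b.a.a.d (L 
  10217).c.a.b.a.a.c) e (L 10187).a.b.a.a.d (N (L 0).a.b.c.a.b.a e (L 10187).a.b.a.a e)) (N (N (N 
  (H 9807 (L 0).b.b).c.a.b (H 9729 (L 0).b.c).a e e) e (L 10187).c.a.b.a.a.d (L 
  10187).c.a.b.a.a.c) (H 9729 (L 0).b.b).c.a.b.a.a (N (N (H 10123 (L 0).b.b).c.a.b (L 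
  10173).a.b.a.a.c.b.a.d.b e e) e (L 10173).a.b.a.a.d.b.a.c.b.d e) (N (N (H 10123 (L 
  0).b.b).c.a.b (N e (L 10173).a.b.a.a.d.b.a.c (H 10173 (L 10169).a.a.c.d).a.a e) e e) e e (L 
  10173).a.b.a.a.c.b.a.d.b.c)) (N (N (N (H 9807 (L 0).c.b).c.a.b (H 10123 (L 0).b.c).a e e) (L 
  10173).c.a.b.a.a.d e (L 10173).a.b.a.a.c.b.a.d.b.c) e (H 7164 (L 0).c.b).c.a.b.a.a (H 7761 (L 
  0).c.b).c.a.b.a.a) (N (N (N (H 9807 (L 0).d.b).c.a.b (H 10123 (L 0).b.c).a e e) (N e (L 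
  10173).b.a.a.d.b.a.c (L 10123).b.a.a e) (L 10173).a.b.a.a.d.b.a.c.b.d e) (H 9768 (L 
  0).d.b).c.a.b.a.a (H 7761 (L 0).d.b).c.a.b.a.a (H 7164 (L 0).d.b).c.a.b.a.a)) (N (N (N (H 9807 
  (L 0).c.c).a.b (H 7164 (N (L 0).c (H 7163 (L 4784).b.a).a.c.b.a.d (L 6750).b.a.a.c.d.a.a e)) (N 
  e e (L 9674).c.a.b.a.a (L 10217).c.a.b.a.a) (L 9719).b.a.a.c) (L 10173).a.b.a.a.d e (N (L 
  0).a.c.c.a.b.a e (L 9720).b.a.a.c.b.a.d.b e)) (N (N (N (H 9807 (L 0).b.c).c.a.b (H 9768 (L 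
  0).c.c).a e e) e (L 10187).c.a.b.a.a.d (L 10187).c.a.b.a.a.c) (N (H 9729 (L 0).b.c).c.a.b.a e e 
  (L 10173).b.a.a.c.b.a) (H 10123 (L 0).b.c).c.a.b.a.a (N (H 10123 (L 0).b.c).c.a.b (L 
  10173).a.b.a.a.d.b.a.c.b e e).a) (N (N (N (H 9807 (L 0).c.c).c.a.b (N (H 7164 (L 0).c.c) (L 
  9752).a.b.a.a.c.b.a.d e e) e e) (L 10173).c.a.b.a.a.d e (L 10173).a.b.a.a.c.b.a.d.b.c) (H 9768 
  (L 0).c.c).c.a.b.a.a e (H 7761 (L 0).c.c).c.a.b.a.a) (N (N (N (H 9807 (L 0).d.c).c.a.b (N (H 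
  7761 (L 0).c.c) (L 10173).a.b.a.a.d.b.a.c e e) e e) (L 10173).c.a.b.a.a.c e e) (N (H 9768 (L 
  0).d.c).c.a.b.a e (L 10173).b.a.a.d.b.a e) (H 7761 (L 0).d.c).c.a.b.a.a (H 7164 (L 
  0).d.c).c.a.b.a.a)) (N (H 10128 (N (N (H 9807 (L 0).d.c).a.b (H 7761 (N (L 0).c (H 7638 (L 
  5384).b.a).a.d.b.a.c e (L 7528).a.d.d.c.a)) (L 7799).c.a.b.a.a.d (L 9742).c.a.b.a.a.d) (N e (L 
  10099).a.b.a.a.d.c.a.a.d.d e (L 9870).a.d) (N (L 0).a.d.c.a.b.a e e (L 9942).c.a.b.a.a.d) (L 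
  9782).c.a.b.a.a.d.d)) (N (N (N (H 9807 (L 0).b.d).c.a.b (H 9768 (L 0).d.c).a e e) e (L 
  10187).c.a.b.a.a.d (L 10187).c.a.b.a.a.c) (H 9729 (L 0).b.d).c.a.b.a.a (N (H 10123 (L 
  0).b.d).c.a.b (N e (L 10173).a.b.a.a.c.b.a.d e (H 10173 (L 10074).a.a.d.c).a.a) e e).a (H 10123 
  (L 0).b.d).c.a.b.a.a) (N (N (N (H 9807 (L 0).c.d).c.a.b (N (H 7761 (L 0).d.c) (L 
  10173).a.b.a.a.c.b.a.d e e) e e) (L 10173).c.a.b.a.a.d e e) (H 9768 (L 0).c.d).c.a.b.a.a (H 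
  7164 (L 0).c.d).c.a.b.a.a e) (N (N (N (H 9807 (L 0).d.d).c.a.b (N (H 7164 (L 0).d.c) (L 
  9912).a.b.a.a.d.b.a.c e e) e e) (L 10173).c.a.b.a.a.c (L 10173).a.b.a.a.d.b.a.c.b.d e) (H 9768 
  (L 0).d.d).c.a.b.a.a (H 7761 (L 0).d.d).c.a.b.a.a (H 7164 (L 0).d.d).c.a.b.a.a))) e) (N (H 9729 
  (N (N (N (L 7311).a.b.b.a.a.b.c (L 0).b (N (L 0).a.a.a.b.b.a (L 7311).b.b.a.a (N e (L 
  9592).b.b.a.a.b.d.a.a e (L 9663).b.b.a.a.b.d.a.c).b e) e) (L 0) (H 9681 (N (N (N (L 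
  0).c.a.a.b.b (L 0).a.a.b e e) e e (L 7326).a.b.b.a.a.b) (H 8432 (N e (H 7263 (H 4862 (L 
  0).c.a).a.b) e (L 7905).a.b).a).a (N (H 7164 (L 0).c.a).a.b.b.a (N e (L 9543).b.a.a.b.d.a.a e 
  (L 9615).b.a.a.b.d.a.c) e (H 9673 (H 9372 (L 9106).b.a).a.b).c.a) (N (H 7761 (L 0).c.a).a.b.b.a 
  e e (N e (L 9632).b.b.a.a.b.c.a.a (L 9468).b.b.a.a.b.c.a.d e).b))) e) (N (L 
  7311).a.b.b.a.a.b.c.a (N (N (N e (L 9244).b.b.a.a.b.d.a.a (L 9467).b.b.a.a.b.c.a.d e).c e (L 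
  9260).b.b.a.a.b.d.a.c.d.b e) e (L 9513).b.b.a.a.b.c.a.a.b.b.d e) (N (N (N (L 0).c.b.a.b.b (L 
  0).b.a.b e (L 9669).b.b.a.a.b.d.a.c.d) e e (L 7374).a.b.b.a.a.b) (H 4864 (L 0).c.b).a.b.b.a.a 
  (N (H 7164 (L 0).c.b).a.b.b.a e e (L 9567).b.a.a.b.c.a) (N (N (H 7761 (L 0).c.b).a.b.b e (L 
  9518).b.b.a.a.b.d.a.a.b e) (L 9507).b.a.a.b.c.a.a.b e e)) e) (N (N (N (N (L 0).c e (L 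
  9718).b.b.a.a.a.b.a (L 9718).b.b.a.a.a.b.a).b.b (L 0).a.b (L 7311).a.b.b.a.a.b (L 
  7311).a.b.b.a.a.b) (L 0).a.c.a.b.b.a.a e (N (L 0).a.c.a.b.b.a (L 7374).b.b.a.a e (N e (L 
  9613).b.b.a.a.b.c.a.a (L 9703).b.b.a.a.b.c.a.d e).b)) (N (N (N (L 0).b.c.a.b.b (H 4864 (L 
  0).c.a).b e (N e (L 9581).b.b.a.a.b.c.a.a e (L 9510).b.b.a.a.b.d.a.c)) e e (L 
  9579).b.b.a.a.b.c.a.d.c.b) (L 0).b.c.a.b.b.a.a (L 0).b.c.a.b.b.a.a (N (L 0).b.c.a.b.b.a e (L 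
  9216).a.b.d.a e)) (N (N (N (L 0).c.c.a.b.b (H 7164 (N (L 0).c e e (H 7163 (L 
  4784).b.b).a.a.c.b.a)).b e (N e (L 9717).b.b.a.a.b.c.a.a e (L 9629).b.b.a.a.b.d.a.c)) e e (L 
  7374).a.b.b.a.a.b) (N (H 4864 (L 0).c.c).a.b.b e (L 9530).b.b.a.a.b.c.a.d.c e).a (H 7164 (L 
  0).c.c).a.b.b.a.a (N (N (H 7761 (L 0).c.c).a.b.b e (H 9217 (L 9107).a.a.b.d).a.a.b e) e e (N e 
  (L 9592).b.b.a.a.b.c.a.a (H 9618 (L 9493).b.b).a.a.b.c.a.d e).b)) (N (N (N (L 0).d.c.a.b.b (H 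
  7761 (N (L 0).c e (H 7638 (L 5384).b.b).a.a.d.b.a e)).b e e) e (L 7374).a.b.b.a.a.b e) (N (H 
  4864 (L 0).d.c).a.b.b e e (L 9217).b.b.a.a.b.d.a.c.d).a (H 7761 (L 0).d.c).a.b.b.a.a (N (H 7164 
  (L 0).d.c).a.b.b.a (N e (L 9632).b.a.a.b.c.a.a (L 9516).b.a.a.b.c.a.d e) e e))) e)) (N (N (H 
  9729 (N (N e (L 0).b.b (L 7311).b.b.b.a.a.b e) (L 0).b (N (L 0).a.a.b.b.b.a (H 9709 (H 8458 (N 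
  e (L 7311).b e (L 7967).a.a.b)).a.a) (N e (N e (L 9592).b.b.a.a.b.d.a.a e (L 
  9663).b.b.a.a.b.d.a.c) e (L 9467).a.a.b.c.a) e) e)) (N (L 10187).b.b.b.a.a.d.c e (N (H 10123 (L 
  0).b.a).b.b.b.a e (L 10173).b.b.a.a.d.b.a.c.b.d e) e) (N (N (N (H 9807 (L 0).c.a).b.b.b (L 
  0).a.b.b e e) (L 10173).b.b.b.a.a.d e e) (H 9768 (L 0).c.a).b.b.b.a.a (H 7164 (L 
  0).c.a).b.b.b.a.a (H 10128 (H 7761 (L 0).c.a).b.b).b.a.a) e) (N (N (L 10217).b.b.b.a.a.d.c e (L 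
  10187).b.b.a.a.d e) (N (L 10187).b.b.b.a.a.d.c e (N (L 10173).b.b.a.a.c.b.a.d.b.b e (L 
  10173).b.b.a.a.d.b.a.c.b.d e) e) (N (N e (N e (L 10173).b.a.a.c.b.a.d e (L 10123).b.a.a) e (L 
  10173).b.b.a.a.c.b.a.d.b.c) e (L 10173).b.a.a.d.b.a.c.b.d e) e) (N (N (N (H 9807 (N e (L 0).c 
  (L 9718).b.b.a.a.a.b.a (L 9718).b.b.a.a.a.b.a)).b.b (H 10123 (L 0).b.b) (L 10217).b.b.b.a.a.d 
  (L 10217).b.b.b.a.a.c) (N (L 0).a.c.b.b.b.a (L 10173).a.a.c.b.a.d e (H 10123 (L 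
  9907).a.a.d.c).a.a) e (N (L 0).a.c.b.b.b.a e (L 10173).b.a.a.c.b.a.d.b e)) (N (N (N (H 9807 (L 
  0).b.c).b.b.b (H 9768 (N e (L 0).c (L 9676).b.b.a.a.b.b.a (L 9676).b.b.a.a.b.b.a)).b e e) e (L 
  10187).b.b.b.a.a.d (L 10187).b.b.b.a.a.c) (H 9729 (L 0).b.c).b.b.b.a.a e (N (H 10123 (L 
  0).b.c).b.b.b (L 10173).b.b.a.a.d.b.a.c.b e e).a) (N (N (N (H 9807 (L 0).c.c).b.b.b (N e (H 
  7164 (N e (L 0).c e (H 7082 (L 4784).b.b).a.a.c.b.a)) (L 10379).b.b.a.a.c.d.a.a e) e (N e e (N 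
  (L 10169) (L 9564).a.a.c.c e e).a (L 10517).b.b.a.a.c.d.a.b)) (L 10173).b.b.b.a.a.d e (L 
  10173).b.b.a.a.c.b.a.d.b.c) (H 9768 (L 0).c.c).b.b.b.a.a (H 7164 (L 0).c.c).b.b.b.a.a (N (H 
  7761 (L 0).c.c).b.b.b.a (L 10173).a.a.d.b.a.c e e)) (N (N (N (H 9807 (L 0).d.c).b.b.b (H 7761 
  (N e (L 0).c (L 5384).b.b.a.a.d.b.a e)).b e e) (L 10173).b.b.b.a.a.c e e) (H 9768 (L 
  0).d.c).b.b.b.a.a (H 7761 (L 0).d.c).b.b.b.a.a (H 7164 (L 0).d.c).b.b.b.a.a)) e) (N (N (H 10123 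
  (N (N e (H 9788 (N e e (L 0) (L 9699).b.a.a.a.b.a).b) (L 9737).c.b.b.a.a.c (L 
  7805).c.b.b.a.a.c) (N e (L 0) (L 9023).c.b.b.a.a.c (L 9666).b.b.a.a.c.c.b.d.c.a) (N (L 
  9737).b.b.a e (L 9777).c.b.b.a.a e).c (N (L 0).a.a.c.b.b.a e (N (N (H 9074 (L 7805).b.b) (L 
  9023).a.a.c.c e e) e (L 9937).c.b.b.a.a e) (L 9911).a.a.c.d.a.b))) (H 10105 (N (N (N (H 9807 (L 
  0).b.a).c.b.b (L 0).a.c.b e e) e (H 9972 (L 7758).c.b).b.a.a.d (L 9725).c.b.b.a.a.d) (N (H 9729 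
  (L 0).b.a).c.b.b.a e e (N (H 10067 (L 9987).b.a.a.c).c.b.b e (L 10079).b.a.a.d.c.a.b (N e (H 
  9900 (L 8402).c.b) (H 10023 (L 9934).b.a.a.d) e).a.a)) (N (L 9700).b.b.a e e (L 
  8717).c.b.b.a.a).d (N (H 10070 (N (N e (L 0).b.a.c.b (H 9991 (H 9860 (L 9119).b.a).a.d) e) e (L 
  9812).d e)) e e (N (L 9772).b.b.a e e (L 9748).c.b.b.a.a)))) (N (L 10173).c.b.b.a.a.d.b (H 9744 
  (L 0).c.a).c.b.b.a.a (H 7164 (L 0).c.a).c.b.b.a.a (H 7761 (L 0).c.a).c.b.b.a.a) (N (N (N (H 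
  9788 (L 0).d.a).c.b.b (L 0).a.c.b e e) (L 10173).c.b.b.a.a.c e e) (N (H 9744 (L 0).d.a).c.b.b.a 
  e (L 10249).c.b.b.a.a.c e) (N (H 7761 (L 0).d.a).c.b.b.a (L 10173).a.a.c.b.a.d e e) (H 7164 (L 
  0).d.a).c.b.b.a.a)) (N (N (N (H 9807 (L 0).b.c).b.b (H 9744 (N e e (L 0) (L 
  9651).b.a.a.b.b.a).b) (L 10217).c.b.b.a.a.d (L 10217).c.b.b.a.a.c) e (N (L 0).a.b.c.b.b.a e e 
  (L 10187).b.b.a.a) (N (L 0).a.b.c.b.b.a e (L 10187).b.b.a.a e)) (N (N (N (H 9807 (L 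
  0).b.b).c.b.b (H 9729 (L 0).b.c).b e e) e (L 10187).c.b.b.a.a.d (L 10187).c.b.b.a.a.c) (H 9729 
  (L 0).b.b).c.b.b.a.a (N (L 10173).b.b.a.a.c.b.a.d.b.b e (L 10173).b.b.a.a.d.b.a.c.b.d e) (N (N 
  (H 10123 (L 0).b.b).c.b.b (L 10173).b.b.a.a.d.b.a.c.b e e) e e (L 10173).b.b.a.a.c.b.a.d.b.c)) 
  (N e (L 10173).c.b.b.a.a.d e (L 10173).b.b.a.a.c.b.a.d.b.c).a (N (N (N (H 9788 (L 0).d.b).c.b.b 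
  (H 10123 (L 0).b.c).b e e) (N e (L 10173).b.a.a.d.b.a.c (L 10123).b.a.a e) (L 
  10173).b.b.a.a.d.b.a.c.b.d e) (N (H 9744 (L 0).d.b).c.b.b.a e (L 10249).c.b.b.a.a.c e) (H 7761 
  (L 0).d.b).c.b.b.a.a (H 7164 (L 0).d.b).c.b.b.a.a)) (N (N (N (H 9788 (N e e (N (L 
  9556).b.b.a.a.a.b e (L 0) e) (L 9699).b.b.a.a.a.b.a)).b.b (H 7127 (N e (N e e (L 0) (H 7044 (L 
  4747).b.a).a.c.b.a) (H 7091 (H 7004 (L 6724).b.a).a.c.d.a).a e)) (L 10217).c.b.b.a.a.d (H 10535 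
  (N e e (H 10078 (N (L 8400).b (H 10036 (L 8879).a.c).c e e)).a (H 10459 (L 
  10274).b.a).a.c.d.a.b))) (N (L 0).a.c.c.b.b.a e (N e e (N (L 9557).c.b.b.a e e (L 
  10524).a.c.c.b) (H 10589 (L 10246).b.a).a.c.d.a.b) (N (L 10173).b.b e (L 10536).b.b.a.a.c.c.b.d 
  e).a) e (N (L 0).a.c.c.b.b.a e (L 8366).b.a.a.c.b.a.d.b e)) (N (N (N (H 9807 (L 0).b.c).c.b.b 
  (H 9744 (N e e (N (L 9514).b.b.a.a.b.b e (L 0) e) (L 9651).b.b.a.a.b.b.a)).b e e) e (L 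
  10187).c.b.b.a.a.d (L 10187).c.b.b.a.a.c) (N (H 9729 (L 0).b.c).c.b.b.a e e (L 
  10173).b.a.a.c.b.a) (H 10123 (L 0).b.c).c.b.b.a.a (N (H 10123 (L 0).b.c).c.b.b (L 
  10173).b.b.a.a.d.b.a.c.b e e).a) (N (N (N (H 9788 (L 0).c.c).c.b.b (H 7164 (N e e (L 0).c (L 
  4784).b.b.a.a.c.b.a)).b e e) (L 10173).c.b.b.a.a.d e (L 10173).b.b.a.a.c.b.a.d.b.c) (H 9744 (L 
  0).c.c).c.b.b.a.a e (H 7761 (L 0).c.c).c.b.b.a.a) (N (N (N (H 9788 (L 0).d.c).c.b.b (H 7761 (N 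
  (L 5384).b.b.a.a.d.b e (L 0) e).c).b e e) (L 10111).c.b.b.a.a.c e e) (N (H 9744 (L 
  0).d.c).c.b.b.a e (N (L 10123).a.d.b e (L 10227).c.b.b.a.a e) e) (H 7711 (L 0).d.c).c.b.b.a.a 
  (H 7164 (L 0).d.c).c.b.b.a.a)) (N (N (N (H 9788 (N e e (N (L 9556).b.b.a.a.a.b e e (L 0)) (L 
  9699).b.b.a.a.a.b.a)).b.b (H 7761 (N e (L 0).c e (L 7563).b.a.a.d.d.c.a)) (L 10217).c.b.b.a.a.d 
  (L 10217).c.b.b.a.a.c) (N (L 0).a.d.c.b.b.a e (N (L 10173).b.b.a e e (L 10275).c.b.b.a.a) e) (L 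
  0).a.d.c.b.b.a.a e) (N (N (N (H 9807 (L 0).b.d).c.b.b (H 9744 (N e e (N (L 9514).b.b.a.a.b.b e 
  e (L 0)) (L 9651).b.b.a.a.b.b.a)).b e e) e (L 10187).c.b.b.a.a.d (N (L 10187).c.b.b (L 
  10224).a.c.c e e).a.c) (H 9729 (L 0).b.d).c.b.b.a.a (N (N (H 10123 (L 0).b.d).c.b.b (L 
  10173).b.b.a.a.c.b.a.d.b e e) e (L 10249).b.b.a.a e) (H 10123 (L 0).b.d).c.b.b.a.a) (N (N (N (H 
  9788 (L 0).c.d).c.b.b (H 7761 (N e e (L 0).d (L 5384).b.b.a.a.c.b.a)).b e e) (L 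
  10173).c.b.b.a.a.d e e) (H 9744 (L 0).c.d).c.b.b.a.a (H 7164 (L 0).c.d).c.b.b.a.a e) (N (N (N 
  (H 9788 (L 0).d.d).c.b.b (N e (H 7164 (N (H 7097 (L 4784).b.b).a.a.d.b e e (L 0)).c) e (L 
  9878).a.a.d.d.c.a) e e) (L 10173).c.b.b.a.a.c (L 10173).b.b.a.a.d.b.a.c.b.d e) (N (H 9744 (L 
  0).d.d).c.b.b.a e (L 10249).c.b.b.a.a.c e) (H 7761 (L 0).d.d).c.b.b.a.a (H 7164 (L 
  0).d.d).c.b.b.a.a))) e) (N (H 9697 (N (N (N (N e e (L 9577).a.c.b.a.a.c (L 7528).a.c.b.a.a.c) 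
  (N e (N e e (L 9556).c.b.a.a.c.d.a.a (L 9628).c.b.a.a.c.d.a.b).c (L 0) e) (N (L 0).a.a.a.c.b.a 
  e (N (L 9577).c.b.a e (L 9617).a.c.b.a.a e) e) (N (L 0).a.a.a.c.b.a (L 
  9189).c.b.a.a.c.c.d.b.c.a (L 7528).c.b.a.a (N e (L 9590).c.b.a.a.c.c.d.d.a (N (L 
  9557).c.b.a.a.c.d.a (L 9435).c.b.a.a.c.c.d e e).c e))) (L 0) (N e (N (L 0).c.a.a.c.b.a e e (N 
  (L 9575).c.b.a.a.c.c.d.d e (L 9474).c.b.a.a.c.d.a.a e).c) (N (N e (H 9507 (H 4603 (L 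
  0).c.a).a.c) e (L 9687).a.c).a (L 9514).b.a.a.c.c.d (L 9617).c.b.a.a e) (N (H 7761 (L 
  0).c.a).a.c.b.a (L 9472).c.b.a.a.c.d.a.a.c.c e e)) (H 9317 (N (N (N (L 0).d.a.a.c.b (L 0).a.a.c 
  e e) e (L 8882).a.c.b.a.a.c e) (N (N (L 0).d.a.a.c.b e (H 9303 (L 8806).b.a).a.c.c.d.b e) (N e 
  e (L 9215).c.b.a.a.c.d.a.a (L 9097).c.b.a.a.c.d.a.b).c (L 8193).a.c.b.a.a.c e) (N (H 8722 (H 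
  7414 (N e (H 7373 (L 7242).b.a).a.c.c (H 5074 (L 0).d.a).a e)).b.a) e (L 8902).a.c.b.a.a.c e) 
  (N (H 7164 (L 0).d.a).a.c.b.a (H 9247 (N e e (H 9109 (L 8799).b.a).a (L 8921).b.a.a.c.c)).d.a 
  (N (H 9203 (N e (H 8448 (L 6648).a.c) e (H 9169 (L 9029).a.c)).a) (H 9275 (H 9230 (L 
  9052).b.a).a.c.c.d) e e).c e)))) (N (N (N (L 0).b.a.c.b (L 0).a.c (L 9577).a.c.b.a.a.c (L 
  7528).a.c.b.a.a.c) e (N (L 0).a.b.a.c.b.a e (N (L 9265).c.b.a e (L 9617).a.c.b.a.a e) e) (N (L 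
  0).a.b.a.c.b.a e (H 9566 (L 5118).c.b).a.a (N (L 9478).c.b.a.a.c.d.a (L 9476).c.b.a.a.c.c.d e 
  e).c.c)) (N (N (N (L 0).b.b.a.c.b (L 0).b.a.c e (L 9608).c.b.a.a.c.d.a.b.d) e (L 
  9265).a.c.b.a.a.c (L 5118).a.c.b.a.a.c) (N (L 0).b.b.a.c.b.a e (L 8271).a.c.b.a.a.c e) (N (L 
  0).b.b.a.c.b.a e (N (N e (L 8271).c e (L 9677).a.a.c).a e (L 9285).a.c.b.a.a e) e) (N (N (L 
  0).b.b.a.c.b (H 9585 (L 9478).c.b).a.a.c.d.a.a.c e e) e (L 7354).a.c.b.a.a.c (N (L 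
  9662).c.b.a.a.c.c.d.d.b e (N (L 9559).c.b.a.a.c.d.a (L 9595).c.b.a.a.c.c.d e e).c e))) (N (N (L 
  9489).c.b.a.a.c.d.a.b.d.d e e (N e (L 9649).c.b.a.a.c.c.d.d (L 9243).c.b.a.a.c.c.d.b e).c) e (L 
  9285).c.b.a.a.c (L 9227).b.a.a.c.d.a.b) (N (N (N (L 0).d.b.a.c.b (L 0).b.a.c (L 9119).a.a.d e) 
  e (L 9265).a.c.b.a.a.c e) (N (L 0).d.b.a.c.b.a e (L 8575).a.c.b.a.a.c e) (N (N (H 5093 (L 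
  0).d.b).a.c.b e e (L 9182).c.b.a.a.c.d.a.b.d) e (N (H 9492 (L 7354).c.b).a e (L 9285).a.c.b.a.a 
  e) e) (N (H 7164 (L 0).d.b).a.c.b.a e (N (N e (H 8997 (L 7040).a.c) e (L 9599).b.a.a.c).a (L 
  9634).b.a.a.c.c.d e e).c e))) (N (N (N e e (L 9577).a.c.b.a.a.c (L 7528).a.c.b.a.a.c) (L 
  9677).c.b.a.a.c.d.a.a.c.c.b (L 9617).a.c.b.a.a.c.c (N e (L 9507).c.b.a.a.c.c.d.b.c.a e (L 
  9632).c.b.a.a.c.d.a.a.c.c)) (N (N (N (L 0).b.c.a.c.b (L 0).c.a.c e (L 9648).c.b.a.a.c.d.a.b.d) 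
  e (L 9265).a.c.b.a.a.c (L 5118).a.c.b.a.a.c) (N (L 0).b.c.a.c.b.a e (L 8271).a.c.b.a.a.c e) (N 
  (L 0).b.c.a.c.b.a e (L 9285).a.c.b.a.a.c e) (N (N (L 0).b.c.a.c.b (L 9481).c.b.a.a.c.d.a.a.c e 
  e) e (N (L 9575).b.a.a.c.c.d.d e (H 9630 (N e (H 8514 (L 7354).a.c) e (L 9407).b.a.a.c).a).a e) 
  e)) (N (N (N (L 0).c.c.a.c.b (H 4603 (N (L 0).c.b.a.a.c.d e (L 0) e).a).c e (L 
  9432).c.b.a.a.c.d.a.b.d) (L 9227).c.b.a.a.c.d.a.b.d.c e (N e (L 9649).c.b.a.a.c.c.d.d (L 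
  9542).c.b.a.a.c.c.d.b e).c) (N (L 0).c.c.a.c.b.a (L 9456).c.b.a.a.c.c.d.b.c.a e (N (L 
  9575).c.b.a.a.c.c.d.d e (L 9478).c.b.a.a.c.d.a.a e).c) (H 9546 (H 4603 (L 0).c.c).a.c).b.a.a (N 
  (H 7761 (L 0).c.c).a.c.b.a (L 9478).c.b.a.a.c.d.a.a.c.c e e)) (N (N (N (L 0).d.c.a.c.b (H 7761 
  (L 0).c.a).c e e) e (L 9265).a.c.b.a.a.c e) (N (L 0).d.c.a.c.b.a (L 9665).c.b.a.a.c.c.d.b.c.a 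
  (N e (L 8575).a.c e (L 9472).b.a.a.c).a.a.c e) (N (H 5093 (L 0).d.c).a.c.b.a e (L 
  9285).a.c.b.a.a.c e) (N (H 7164 (L 0).d.c).a.c.b.a (L 9547).b.a.a.c.d.a (H 9505 (L 
  7040).a.c).b.a.a.c e))) (N (N (N (L 0).d.a.c.b (L 0).a.c (L 9577).a.c.b.a.a.c (L 
  7528).a.c.b.a.a.c) (N (L 0).a.d.a.c.b.a (N e e (L 9522).c.b.a.a.c.d.a.a (L 
  9668).c.b.a.a.c.d.a.b).c (L 9667).c.b.a.a.c.c.d.d.a.a e) (N (L 0).a.d.a.c.b.a e (N (L 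
  9265).c.b.a e (L 9617).a.c.b.a.a e) e) e) (N (N (N (L 0).b.d.a.c.b (L 0).d.a.c e e) e (N e (L 
  9507).a.a.c.c.d (L 9265).a.c.b.a.a e) (L 5118).a.c.b.a.a.c) (N (L 0).b.d.a.c.b.a e (N e e (N e 
  (L 8271).a.c e (L 9596).b.a.a.c).a.a (L 9482).b.a.a.c.d.a.b) e) (N (L 0).b.d.a.c.b.a e (N (L 
  8575).c.b.a e (L 9285).a.c.b.a.a e) e) (N (L 0).b.d.a.c.b.a e (L 7354).a.c.b.a.a.c e)) (H 9679 
  (N (N (N (L 0).c.d.a.c.b (H 5075 (L 0).d.a).c e e) (L 9527).c.b.a.a.c.d.a.b.d.c e e) (N (L 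
  0).c.d.a.c.b.a (L 9467).c.b.a.a.c.c.d.b.c.a e (L 9549)) (N (H 4603 (L 0).c.d).a.c.b.a (H 9639 
  (H 9573 (L 9200).a.c).c.d) (L 9285).c.b.a.a e) (H 7761 (L 0).c.d).a.c.b.a.a)) (N (N (N (L 
  0).d.d.a.c.b (H 7164 (L 0).d.a).c e e) e (L 9265).a.c.b.a.a.c e) (N (N (L 0).d.d.a.c.b e e (L 
  9182).a.a.c) (N (L 9626).c.b.a.a.c.c.d.b.c e (N e e (L 9557).c.b.a.a.c.d.a.a (H 9584 (L 
  9460).c.b).a.a.c.d.a.b) e) (L 8575).a.c.b.a.a.c e) (N (N (H 5093 (L 0).d.d).a.c.b e e (L 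
  9496).c.b.a.a.c.d.a.b.d) e (N (H 9529 (N e (L 7040).c e (L 9462).a.a.c)).a e (L 9285).a.c.b.a.a 
  e) e) (N (H 7164 (L 0).d.d).a.c.b.a e (H 9517 (L 7040).a.c).b.a.a.c e))))) (N (N (H 9768 (N (N 
  e (L 0).b.c e (L 7350).b.c.b.a.a.b) (N e (N e e (L 9676).a.a.b.b.a (L 9676).a.a.b.b.a) (L 0) e) 
  (N (L 0).a.a.b.c.b.a e (N e (N e (L 9631).c.b.a.a.b.d.a.a e (L 9702).c.b.a.a.b.d.a.c) e (L 
  9694).c.b.a.a.b.b.a.c.b) e) (N (L 0).a.a.b.c.b.a (H 8622 (L 7350).c.b).a.a e (N (L 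
  9549).a.a.b.d (L 9694).c.b.a.a.b.b.a.d e e).c))) (N (N e e (L 10187).b.c.b.a.a.d (L 
  10187).b.c.b.a.a.c) (H 9729 (L 0).b.a).b.c.b.a.a (N (H 10123 (L 0).b.a).b.c.b.a e (L 
  10173).c.b.a.a.d.b.a.c.b.d e) (N (H 10123 (L 0).b.a).b.c.b.a e e (L 
  10173).c.b.a.a.c.b.a.d.b.c)) (N (N (N (H 9807 (L 0).c.a).b.c.b (L 0).a.b.c e e) (L 
  10173).b.c.b.a.a.d e e) e (H 7164 (L 0).c.a).b.c.b.a.a (H 10128 (H 7761 (L 0).c.a).b.c).b.a.a) 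
  (N (N (N (H 9807 (L 0).d.a).b.c.b (L 0).a.b.c e e) (L 10173).b.c.b.a.a.c e e) (H 9768 (L 
  0).d.a).b.c.b.a.a (H 10128 (H 7761 (L 0).d.a).b.c).b.a.a (H 7164 (L 0).d.a).b.c.b.a.a)) (N (N 
  (N (H 9807 (L 0).b.b).c.b (H 9729 (L 0).b.c) (L 10217).b.c.b.a.a.d (L 10217).b.c.b.a.a.c) e (N 
  (L 0).a.b.b.c.b.a e e (L 10187).c.b.a.a) (N (L 0).a.b.b.c.b.a e (L 10187).c.b.a.a e)) (N (N (N 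
  (H 9807 (L 0).b.b).b.c.b (H 9729 (L 0).b.b).c e e) e (L 10187).b.c.b.a.a.d (L 
  10187).b.c.b.a.a.c) e (N (N (H 10123 (L 0).b.b).b.c.b (L 10173).c.b.a.a.c.b.a.d.b e e) e (L 
  10173).c.b.a.a.d.b.a.c.b.d e) (N (N (H 10123 (L 0).b.b).b.c.b (L 10173).c.b.a.a.d.b.a.c.b e e) 
  e e (L 10173).c.b.a.a.c.b.a.d.b.c)) (N (N (N (H 9807 (L 0).c.b).b.c.b (H 10123 (L 0).b.b).c e 
  e) (N e (L 10173).b.a.a.c.b.a.d e (L 10123).b.a.a) e (L 10173).c.b.a.a.c.b.a.d.b.c) e (N (H 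
  7164 (L 0).c.b).b.c.b.a e e (L 10173).b.a.a.d.b.a.c.b) (H 7761 (L 0).c.b).b.c.b.a.a) (N (N (N 
  (H 9807 (L 0).d.b).b.c.b (H 10123 (L 0).b.b).c e e) (N e (L 10173).b.a.a.d.b.a.c (L 
  10123).b.a.a e) (L 10173).c.b.a.a.d.b.a.c.b.d e) (H 9768 (L 0).d.b).b.c.b.a.a (H 7761 (L 
  0).d.b).b.c.b.a.a (N (H 7164 (L 0).d.b).b.c.b.a e (L 10173).b.a.a.c.b.a.d.b e))) (N (N (N e e 
  (L 10217).b.c.b.a.a.d (L 10217).b.c.b.a.a.c) (L 10173).c.b.a.a.d e (L 10173).b.a.a.c.b.a.d.b.c) 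
  (N (N e e (L 10187).b.c.b.a.a.d (L 10187).b.c.b.a.a.c) e e (L 10173).c.b.a.a.d.b.a.c.b.b.a) (N 
  (L 10173).c.b.a.a.c.b.a.d.b.b (L 10173).b.c.b.a.a.d e (L 10173).c.b.a.a.c.b.a.d.b.c).a (N (L 
  10173).c.b.a.a.d.b.a.c.b.b (L 10173).b.c.b.a.a.c e e).a) (N (N (N (H 9807 (L 0).d.b).c.b (H 
  10123 (L 0).b.c) (L 10217).b.c.b.a.a.d (L 10217).b.c.b.a.a.c) (N (L 0).a.d.b.c.b.a (L 
  10173).a.a.d.b.a.c (H 10123 (L 9911).a.a.c.d).a.a e) (N (L 0).a.d.b.c.b.a e e (L 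
  10173).b.a.a.d.b.a.c.b) e) (N (N (N (H 9807 (L 0).b.d).b.c.b (H 9768 (L 0).d.b).c e e) e (L 
  10187).b.c.b.a.a.d (L 10187).b.c.b.a.a.c) (H 9729 (L 0).b.d).b.c.b.a.a (N (H 10123 (L 
  0).b.d).b.c.b (L 10173).c.b.a.a.c.b.a.d.b e e).a e) (N (N (N (H 9807 (L 0).c.d).b.c.b (N e (L 
  10173).c.b.a.a.c.b.a.d (H 7761 (N (L 7563).c.b.a.a.c.c.d (L 0).d e e)) e) e e) (L 
  10173).b.c.b.a.a.d e e) (H 9768 (L 0).c.d).b.c.b.a.a (H 7164 (L 0).c.d).b.c.b.a.a (H 7761 (L 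
  0).c.d).b.c.b.a.a) (N (N (N (H 9807 (L 0).d.d).b.c.b (N e (L 8715).c.b.a.a.d.b.a.c (H 7164 (L 
  0).d.b) e) (N (L 10551) (L 9878).a.a.d.d e e).a.d e) (L 10173).b.c.b.a.a.c (L 
  10173).c.b.a.a.d.b.a.c.b.d e) (H 9768 (L 0).d.d).b.c.b.a.a (H 7761 (L 0).d.d).b.c.b.a.a (H 7164 
  (L 0).d.d).b.c.b.a.a))) (N (N (H 7164 (N (N e (L 0).c.c e (L 4830).c.c.b.a.a.c) (N e (N e e (N 
  e e (H 7139 (L 7012).c.b).a.a.c.d.a.a (L 7084).c.b.a.a.c.d.a.b) (H 7151 (L 4784).a.a).c.b.a) (L 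
  0) e) e (N (L 0).a.a.c.c.b.a e (L 4807).a.a (N e (L 6888).a.a.c.d.a (L 7073).c.b.a.a.c.b.a.d.b 
  e)))) (N (N (N (H 9807 (L 0).b.a).c.c.b (L 0).a.c.c e e) e (L 10187).c.c.b.a.a.d (L 
  9929).c.c.b.a.a.c) (N (H 9729 (L 0).b.a).c.c.b.a e (L 9622).c.c.b.a.a.c (L 9912).b.a.a.c.b.a) 
  (N (H 9865 (L 0).b.a).c.c.b.a e (L 10173).c.b.a.a.d.b.a.c.b.d e) (N (H 10123 (L 0).b.a.c.c).b.a 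
  e e (L 9912).c.b.a.a.c.b.a.d.b.c)) (N (L 10173).c.c.b.a.a.d.b (H 9768 (L 0).c.a).c.c.b.a.a e (H 
  7761 (L 0).c.a).c.c.b.a.a) (N (N (N (H 9807 (L 0).d.a).c.c.b (L 0).a.c.c e e) (L 
  9912).c.c.b.a.a.c e e) (N (H 9768 (L 0).d.a).c.c.b.a e (L 9926).c.c.b.a.a.c e) (N (H 7503 (L 
  0).d.a).c.c.b.a (L 9912).a.a.c.b.a.d e e) (H 7164 (L 0).d.a).c.c.b.a.a)) (N (N (N (H 9807 (L 
  0).b.c).c.b (H 9768 (N e (N e e (L 9676).b.a.a.b.b.a (L 9676).b.a.a.b.b.a) (L 0).c e)) (L 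
  10217).c.c.b.a.a.d (L 9958).c.c.b.a.a.c) e (N (L 0).a.b.c.c.b.a e e (L 10187).c.b.a.a) (N (L 
  0).a.b.c.c.b.a e (L 9929).c.b.a.a e)) (N (N (N (H 9807 (L 0).b.b).c.c.b (H 9729 (L 0).b.c).c e 
  e) e (L 10187).c.c.b.a.a.d (L 9929).c.c.b.a.a.c) (N (H 9729 (L 0).b.b).c.c.b.a e (L 
  9622).c.c.b.a.a.c e) (N (N (H 9865 (L 0).b.b).c.c.b (L 9912).c.b.a.a.c.b.a.d.b e e) e (N (L 
  9622).c.b.a e e (L 10173).c.b.a.a.d.b.a.c.b) e) (N (N (H 10123 (L 0).b.b).c.c.b (N e (L 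
  10173).c.b.a.a.d.b.a.c (H 9912 (L 9890).a.a.c.d).a.a e) e e) e e (L 9912).c.b.a.a.c.b.a.d.b.c)) 
  (N (N (N (H 9807 (L 0).c.b).c.c.b (H 9865 (L 0).b.c).c e e) (L 10173).c.c.b.a.a.d e (L 
  9912).c.b.a.a.c.b.a.d.b.c) e e (H 7761 (L 0).c.b).c.c.b.a.a) (N (N (N (H 9807 (L 0).d.b).c.c.b 
  (H 10123 (L 0).b.c).c e e) (N e (L 10173).b.a.a.d.b.a.c (L 9865).b.a.a e) (L 
  10173).c.b.a.a.d.b.a.c.b.d e) (N (H 9768 (L 0).d.b).c.c.b.a e (L 9926).c.c.b.a.a.c e) (H 7503 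
  (L 0).d.b).c.c.b.a.a (H 7164 (L 0).d.b).c.c.b.a.a)) (N (N (N (H 9807 (L 0).c.c).c.b (H 7164 (N 
  e (L 4784).b.a.a.c.b.a.d (N (L 6750).b.a.a.c.d.a e (L 0) e) e)) (L 10217).c.c.b.a.a.d (L 
  9741).b.a.a.c) (N (L 0).a.c.c.c.b.a e e (L 10173).c.b.a.a) (L 9694).c.c.b.a.a.c.c (N (L 
  0).a.c.c.c.b.a e (L 9743).b.a.a.c.b.a.d.b e)) (N (N (N (H 9807 (L 0).b.c).c.c.b (H 9768 (L 
  0).c.c).c e e) e (L 10187).c.c.b.a.a.d (L 9929).c.c.b.a.a.c) (N (H 9729 (L 0).b.c).c.c.b.a e (L 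
  9622).c.c.b.a.a.c (L 9912).b.a.a.c.b.a) (H 9865 (L 0).b.c).c.c.b.a.a (N (H 10123 (L 
  0).b.c).c.c.b (L 10173).c.b.a.a.d.b.a.c.b e e).a) (N (L 9912).c.b.a.a.c.b.a.d.b.b (L 
  10173).c.c.b.a.a.d e (L 9912).c.b.a.a.c.b.a.d.b.c).a (N (N (N (H 9807 (L 0).d.c).c.c.b (N e (L 
  10173).c.b.a.a.d.b.a.c (H 7761 (L 0).c.c) e) e e) (L 9912).c.c.b.a.a.c e e) (N (H 9768 (L 
  0).d.c).c.c.b.a e (N (L 10173).b.a.a.d.b e (L 9926).c.c.b.a.a e) e) (H 7503 (L 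
  0).d.c).c.c.b.a.a (H 7164 (L 0).d.c).c.c.b.a.a)) (N (N (N (H 9807 (L 0).d.c).c.b (H 7761 (N e 
  (L 5384).b.a.a.d.b.a.c (L 0).c (L 7563).b.a.a.d.d.c.a)) (L 10217).c.c.b.a.a.d (L 
  9958).c.c.b.a.a.c) (N (L 0).a.d.c.c.b.a e (L 9912).c.b.a.a e) (N (L 0).a.d.c.c.b.a e (L 
  10295).c.c.b.a.a.d e) e) (N (N (N (H 9807 (L 0).b.d).c.c.b (H 9768 (L 0).d.c).c e e) e (L 
  10187).c.c.b.a.a.d (L 9929).c.c.b.a.a.c) (N (H 9729 (L 0).b.d).c.c.b.a e (L 9622).c.c.b.a.a.c 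
  e) (N (N (H 9865 (L 0).b.d).c.c.b (N e (L 9912).c.b.a.a.c.b.a.d e (H 10123 (N (H 10067 (L 
  9864).a.a).d.c e (L 9890).a.a.d.d e).a)) e e) e (L 9926).c.b.a.a e) (H 10123 (L 
  0).b.d).c.c.b.a.a) (N (N (N (H 9807 (L 0).c.d).c.c.b (N e (L 9912).c.b.a.a.c.b.a.d (H 7503 (L 
  0).d.c) e) e e) (L 10173).c.c.b.a.a.d e e) (H 9768 (L 0).c.d).c.c.b.a.a (H 7164 (L 
  0).c.d).c.c.b.a.a e) (N (N (N (H 9807 (L 0).d.d).c.c.b (N e (L 8414).c.b.a.a.d.b.a.c (H 7164 (L 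
  0).d.c) (N (L 10379).c.b.a.a.d.c e (L 9575).a.a.d.d e).a) (N e e (L 10517).c.b.a.a.d.c.a.b (L 
  10485).a.a) e) (L 9912).c.c.b.a.a.c (L 10173).c.b.a.a.d.b.a.c.b.d e) (N (H 9768 (L 
  0).d.d).c.c.b.a e (L 9926).c.c.b.a.a.c e) (H 7503 (L 0).d.d).c.c.b.a.a (H 7164 (L 
  0).d.d).c.c.b.a.a))) (N (N (H 7761 (N (N e (L 0).d.c e (L 7363).d.c.b.a.a.d) (N e (L 
  5384).a.a.d.b.a.c (L 0) (N (L 7563).a.a.d.d.c e e (L 7563).d.c.b.a.a)) (N (L 0).a.a.d.c.b.a e 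
  (L 7674).c.b.a.a.d.b.a.c.b.d (L 7563).d.c.b.a.a.d) (N (L 7363).c.b.a e e (L 
  7403).d.c.b.a.a).d)) (N (N (N (H 9807 (L 0).b.a).d.c.b (L 0).a.d.c e e) e (L 10187).d.c.b.a.a.d 
  (L 10187).d.c.b.a.a.c) (N (H 9729 (L 0).b.a).d.c.b.a e (N (L 10173).b.a.a.d.b e e (L 
  10275).d.c.b.a.a) e) (N (H 10123 (L 0).b.a.d.c).b.a e (L 10173).c.b.a.a.d.b.a.c.b.d e) (N (H 
  10123 (L 0).b.a).d.c.b.a e e (L 10123).a.a.c.b.a.d.b.c)) (N (N (N (H 9807 (L 0).c.a).d.c.b (L 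
  0).a.d.c e e) (L 10173).d.c.b.a.a.d e e) (H 9768 (L 0).c.a).d.c.b.a.a (H 7164 (L 
  0).c.a).d.c.b.a.a e) (N (L 10173).d.c.b.a.a.c.b (N (H 9768 (L 0).d.a).d.c.b.a e (L 
  10527).d.c.b.a.a.d e) (H 7761 (L 0).d.a).d.c.b.a.a (H 7164 (L 0).d.a).d.c.b.a.a)) (N (N (N (H 
  9807 (L 0).b.d).c.b (H 9768 (N e (N e e (L 9676).b.a.a.b.b.a (L 9676).b.a.a.b.b.a) (L 0).d e)) 
  (L 10217).d.c.b.a.a.d (L 10217).d.c.b.a.a.c) e (N (L 0).a.b.d.c.b.a e e (L 10187).c.b.a.a) (N 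
  (L 0).a.b.d.c.b.a e (L 10187).c.b.a.a e)) (N (N (N (H 9807 (L 0).b.b).d.c.b (H 9729 (L 
  0).b.d).c e e) e (L 10187).d.c.b.a.a.d (L 10187).d.c.b.a.a.c) (N (H 9729 (L 0).b.b).d.c.b.a e 
  (L 10275).d.c.b.a.a.d e) (N (N (H 10123 (L 0).b.b).d.c.b (L 10173).c.b.a.a.c.b.a.d.b e e) e (L 
  10173).c.b.a.a.d.b.a.c.b.d (L 10275).c.b.a.a) (N (N (H 10123 (L 0).b.b).d.c.b (L 
  10173).c.b.a.a.d.b.a.c.b e e) e e (L 10173).c.b.a.a.c.b.a.d.b.c)) (N (N (N (H 9807 (L 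
  0).c.b).d.c.b (H 10123 (L 0).b.d).c e e) (N e (L 10173).b.a.a.c.b.a.d e (L 10123).b.a.a) e (L 
  10173).c.b.a.a.c.b.a.d.b.c) (H 9768 (L 0).c.b).d.c.b.a.a (H 7164 (L 0).c.b).d.c.b.a.a e) (N (N 
  (N (H 9807 (L 0).d.b).d.c.b (H 10123 (L 0).b.d).c e e) (L 10173).d.c.b.a.a.c (L 
  10173).c.b.a.a.d.b.a.c.b.d e) (L 10527).d.c.b.a.a.d.c (H 7761 (L 0).d.b).d.c.b.a.a (H 7164 (L 
  0).d.b).d.c.b.a.a)) (N (N (N (H 9807 (L 0).c.d).c.b (H 7761 (N e (L 5384).b.a.a.c.b.a.d (N (L 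
  7563).b.a.a.c.c.d e e (L 0)) e)) (L 10217).d.c.b.a.a.d (L 10217).d.c.b.a.a.c) (N (L 
  0).a.c.d.c.b.a e e (L 10173).c.b.a.a) (L 10527).d.c.b.a.a.c.d (L 0).a.c.d.c.b.a.a) (N (N (N (H 
  9807 (L 0).b.c).d.c.b (H 9768 (L 0).c.d).c e e) e (L 10187).d.c.b.a.a.d (L 10187).d.c.b.a.a.c) 
  (N (H 9729 (L 0).b.c).d.c.b.a e (L 10275).d.c.b.a.a.d e) (H 10123 (L 0).b.c).d.c.b.a.a (N (H 
  10123 (L 0).b.c).d.c.b (L 10173).c.b.a.a.d.b.a.c.b e e).a) (N (N (N (H 9807 (L 0).c.c).d.c.b (N 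
  e (L 10173).c.b.a.a.c.b.a.d (H 7164 (N (L 6750).c.b.a.a.c.d.a e e (L 0).c)) e) e e) (L 
  10173).d.c.b.a.a.d e (L 10173).c.b.a.a.c.b.a.d.b.c) (H 9768 (L 0).c.c).d.c.b.a.a (H 7164 (L 
  0).c.c).d.c.b.a.a (H 7761 (L 0).c.c).d.c.b.a.a) (N (N (L 10173).c.b.a.a.d.b.a.c.b.b (L 
  10173).d.c.b.a.a.c e e) (L 10527).d.c.b.a.a.d.c e e)) (N (N (N (H 9807 (L 0).d.d).c.b (H 7164 
  (N e (N (H 7097 (L 4784).b.a).a.d.b e e (L 6734).b.a.a).c (L 0).d (H 7050 (L 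
  6750).b.a).a.d.c.a.a)) (L 8719).b.a.a.d (L 10217).d.c.b.a.a.c) (N (L 0).a.d.d.c.b.a e (L 
  10173).c.b.a.a (L 10614).b.a.a.d.c.a.b.c) (N (L 0).a.d.d.c.b.a e e (N e (L 8715).b.a.a.d.b.a.c 
  e (L 9926).d.c.b.a.a)) e) (N (N (N (H 9807 (L 0).b.d).d.c.b (H 9768 (L 0).d.d).c e e) e (L 
  10187).d.c.b.a.a.d (L 10187).d.c.b.a.a.c) (N (H 9729 (L 0).b.d).d.c.b.a e (N (L 
  10173).b.a.a.d.b e e (L 10275).d.c.b.a.a) e) (N (N (H 10123 (L 0).b.d).d.c.b (L 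
  10173).c.b.a.a.c.b.a.d.b e e) e e (L 10527).c.b.a.a) (H 10123 (L 0).b.d).d.c.b.a.a) (N (N (N (H 
  9807 (L 0).c.d).d.c.b (N e (L 10173).c.b.a.a.c.b.a.d (H 7761 (N (L 7563).c.b.a.a.c.c.d e e (L 
  0).d)) e) e e) (L 10173).d.c.b.a.a.d e e) (N (H 9768 (L 0).c.d).d.c.b.a e e (L 
  10173).b.a.a.c.b.a) (H 7164 (L 0).c.d).d.c.b.a.a (H 7761 (L 0).c.d).d.c.b.a.a) (N (N (N (H 9807 
  (L 0).d.d).d.c.b (N e (L 9743).c.b.a.a.d.b.a.c (H 7164 (L 0).d.d) e) e e) (L 10173).d.c.b.a.a.c 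
  (L 10173).c.b.a.a.d.b.a.c.b.d e) (N (H 9768 (L 0).d.d).d.c.b.a e (L 10527).d.c.b.a.a.d e) (H 
  7761 (L 0).d.d).d.c.b.a.a e)))) e) e e) (H 9729 (N (L 0) (N (N (N (N (N (L 7311).a.a.b.b.a.b.c 
  (L 9240).a.a.b.b.a.a.c (N e (L 7311).a.b.b.a (N e (L 9592).a.b.b.a.b.d.a.a e (L 
  9663).a.b.b.a.b.d.a.c).b e) e) (N (L 7401).a.a.b.b.a.a.c (L 0).a (N (N (L 9240).a.b.b (L 
  0).b.a.a.a.b e e) e e (L 9507).a.b.b.a.b.c.a.a.b.b) e) (N (N (H 4903 (L 0).c.a).a.a.b.b (L 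
  0).a.a.a.b e (N (L 7401).a.a.b.b.a (L 7374).a.a.b.b.a e e)) (N (N (L 9244).b.b.a.b.d (H 7266 (H 
  4864 (L 0).c.a).a.a).b e e) (L 9595).a.b.b.a.a.c.a.b.c.d e (L 9240).a.a.b.b.a.a) (N (L 
  0).c.a.a.a.b.b (N (L 9232).b.b.a.a.c (L 9592).b.b.a.b.d.a.a e (L 9663).b.b.a.b.d.a.c) e (N (L 
  9232).b.b.a (H 9714 (L 9155).b.b).a e e).c.a) (N (L 0).c.a.a.a.b.b e e (N e (L 
  9632).a.b.b.a.b.c.a.a (N (L 9595).a.b.b.a (L 9516).a.b.b.a e e).c.a.d e).b)) e) (N (N (L 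
  7311).a.a.b.b.a.b.c (L 9240).a.a.b.b.a.a.c (N (L 7401).a.b.b (L 0).a.b.a.a.b e e).a e) (L 0) (N 
  (N (N e (H 9175 (H 4903 (L 0).c.b).a.a).b e (N e (H 9698 (L 9586).a.b).b.a.a.d.a (L 
  9669).a.b.b.a.b.d.a e).d) (L 0).b.a.a.b e (N (L 7401).a.a.b.b.a (L 7374).a.a.b.b.a e e)) (N (H 
  4864 (L 0).c.b).a.a.b.b e e (L 9240).a.a.b.b.a.a) (N (L 0).c.b.a.a.b.b e e (N (L 9644).b.b.a (L 
  9567).b.b.a e e).c.a) (N (N e (L 0).c.b.a.a.b (N e (L 9518).a.b.b.a.b.d.a.a (L 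
  9295).a.b.b.a.a.c.a.b e) e) (N (L 9299).b.b.a.a.d (L 9507).b.b.a.b.c.a.a e e) e e)) e) (N (N (N 
  (L 0).a.c.a.a.b.b (H 4903 (L 0).c.a).a.b (L 7311).a.a.b.b.a.b (L 7311).a.a.b.b.a.b) (N e (L 
  0).a.a (L 9240).a.a.b.b.a.a (L 9240).a.a.b.b.a.a) e (N (N (L 7401).a.b.b (L 0).a.c.a.a.b e e) 
  (L 7374).a.b.b.a e (N e (L 9613).a.b.b.a.b.c.a.a (L 9703).a.b.b.a.b.c.a.d e).b)) (H 8435 (N (N 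
  (N e (L 0).b.c.a.a.b e (N e (H 7905 (L 6735).b.c.a.a) e (H 8305 (L 8209).a.b.b.a).b.d.a.c)) (H 
  7266 (H 4864 (L 0).c.a).a.b) (L 7401).a.a.b.b.a.a (N (L 7401).a.a.b.b.a (H 8374 (L 
  8232).b.a).b.c.a.d.c e e)) e (L 0).b.c.a.a.b.b.a (N (L 0).b.c.a.a.b.b e (L 7960).b.b.a.b.d.a 
  e))) (N (N (N e (H 4903 (L 0).c.c).a.a.b e (N e (L 9717).a.b.b.a.b.c.a.a e (N e (L 
  9546).a.b.b.a.a.d.a (N (L 9705).a.b.b.a (L 9629).a.b.b.a e e).d.a e))) (N e (L 0).c.a.a (L 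
  9299).a.b.b.a.a.d.a.b.d e) e (N (L 7401).a.a.b.b.a (L 7374).a.a.b.b.a e e)) (N (N e (H 4864 (L 
  0).c.c).a.a.b (N (H 9658 (L 9232).b.a) e (N (L 9563).b.a (H 9662 (L 9484).b.a) e e).c.a.d e) e) 
  (N (L 9592).b.a.b.d.a e e (H 9675 (L 9564).a.b).b.a.a.c.a.b.c) e (N (L 9240).a.a.b.b.a e (L 
  9663).b.a.b.d.a e)) (L 0).c.c.a.a.b.b.a (N (N e (L 0).c.c.a.a.b (N (H 9500 (L 9232).b.a) (H 
  9421 (N (H 9353 (H 9300 (L 9191).a.b).b.a).b.d (L 9155) e e).a) (L 9554).b.a.a.c.a.b e) e) e e 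
  (N e (L 9592).a.b.b.a.b.c.a.a (N (H 9675 (L 9564).a.b).b.a (H 9662 (H 9605 (L 9493).a.b).b.a) e 
  e).c.a.d e).b)) (N (N (H 4903 (L 0).d.c).a.a.b.b (N e (L 0).c.a.a e (L 9571).b.a.a.c.a.b.c) (N 
  (L 7401).a.a.b.b.a (L 7374).a.a.b.b.a e e) e) (N (N e (H 4864 (L 0).d.c).a.a.b e (N (L 
  9295).a.b.b.a (L 9217).a.b.b.a e e).d.a.c.d) e (L 9240).a.a.b.b.a.a e) (L 0).d.c.a.a.b.b.a (N 
  (H 9086 (L 0).d.c).a.a.b.b (N (L 9644).b.b.a.a.d (L 9632).b.b.a.b.c.a.a (N (L 9595).b.b.a (L 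
  9516).b.b.a e e).c.a.d e) e e))) e) (L 0) (N (N (N (N e (L 0).a.c.a.b (L 7311).c.a.b.b.a.b (L 
  7311).c.a.b.b.a.b) (L 0).c.a.b (N e (L 7311).a.b.b.a (N e (L 9592).a.b.b.a.b.d.a.a e (L 
  9663).a.b.b.a.b.d.a.c).b e) (N (L 0).a.a.c.a.b.b (L 7311).a.b.b.a e (N e (L 
  9592).a.b.b.a.b.c.a.a (L 9663).a.b.b.a.b.c.a.d e).b)) (N (L 0).b.a.c.a.b.b.a (L 0).a (L 
  9507).a.b.b.a.b.c.a.a.b.b.d (N (L 0).b.a.c.a.b.b e (L 9507).a.b.b.a.b.d.a.a.b.b e)) (N (L 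
  7374).c.a.b.b.a.b.d e e (N e (L 9632).a.b.b.a.b.c.a.a (L 9516).a.b.b.a.b.c.a.d e).b.d) (N (N (L 
  0).d.a.c.a.b.b (L 0).a.c.a.b (L 7374).c.a.b.b.a.b e) (N (L 8625).b.b.a.b.c (H 7328 (H 4864 (L 
  0).d.a).c.a).b e e).a (N (L 0).d.a.c.a.b.b e (N e (L 9632).a.b.b.a.b.d.a.a e (L 
  9516).a.b.b.a.b.d.a.c).b e) (N (L 0).d.a.c.a.b.b (N e (L 9613).b.b.a.b.c.a.a (L 
  9703).b.b.a.b.c.a.d e) e e))) (N (N (N (L 0).a.b.c.a.b.b (L 0).b.c.a.b (L 7311).c.a.b.b.a.b (N 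
  e (N (L 9581).b.b.a.b.c (H 8583 (L 7311).c.a).b e e).a e (L 9510).b.b.a.b.d.a.c)) (H 4864 (L 
  0).c.a).b e (N (L 0).a.b.c.a.b.b (L 9579).b.b.a.b.c.a.d.c e e)) (N (N (N e (L 0).b.b.c.a.b (N e 
  (L 9244).a.b.b.a.b.d.a.a (L 9467).a.b.b.a.b.c.a.d e) (N e (L 9244).a.b.b.a.b.c.a.a e (L 
  9467).a.b.b.a.b.d.a.c)) e (L 9260).a.b.b.a.b.d.a.c.d.b (L 9260).a.b.b.a.b.c.a.d.c.b) (N e e (L 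
  9618).b.b.a.b (L 9618).b.b.a.b).a.a (N (L 0).b.b.c.a.b.b e e (L 9513).a.b.b.a.b.c.a.a.b.b) (N 
  (L 0).b.b.c.a.b.b e (H 9690 (H 9637 (L 9513).a.b).b.a).b.d.a.a.b.b e)) (N (N (N e (L 
  0).c.b.c.a.b e (L 9669).a.b.b.a.b.d.a.c.d) (L 0).b.c.a.b e (L 7374).c.a.b.b.a.b) e (L 
  0).c.b.c.a.b.b.a (N e (L 0).c.b.c.a.b (L 9518).a.b.b.a.b.d.a.a.b e).a) (N (N (N e (L 
  0).d.b.c.a.b (L 9669).a.b.b.a.b.c.a.d.c e) (L 0).b.c.a.b (L 7374).c.a.b.b.a.b e) (H 4864 (L 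
  0).d.b).c.a.b.b.a (N (N e (L 0).d.b.c.a.b e (H 9216 (H 9096 (L 9003).a.b.b.a).b.c.a.a).b) e (L 
  9717).b.d.a.a.b.b e) (L 0).d.b.c.a.b.b.a)) (N (N (N (L 0).a.c.c.a.b.b (L 0).c.c.a.b (L 
  7311).c.a.b.b.a.b (N e (N (L 9717).b.b.a.b.c (H 9115 (L 7311).c.a).b e e).a e (L 
  9629).b.b.a.b.d.a.c)) (L 0).c.a.b e (N (L 0).a.c.c.a.b.b (L 7374).a.b.b.a e (N e (L 
  9613).a.b.b.a.b.c.a.a (L 9703).a.b.b.a.b.c.a.d e).b)) (N (N (N e (L 0).b.c.c.a.b e (N e (L 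
  9581).a.b.b.a.b.c.a.a e (L 9510).a.b.b.a.b.d.a.c)) (H 4864 (L 0).c.c).a.b (L 
  9530).b.b.a.b.c.a.d.c (L 9579).a.b.b.a.b.c.a.d.c.b) (N e e (L 9434).b.b.a.b (H 9722 (L 
  9119).b.b).a.b).a.a (N (L 0).b.c.c.a.b.b e (L 8630).c.a.b.b.a.b e) (N (L 0).b.c.c.a.b.b e (L 
  8632).b.b.a.b.d.a e)) (N (N (N e (L 0).c.c.c.a.b e (N e (L 9717).a.b.b.a.b.c.a.a e (L 
  9629).a.b.b.a.b.d.a.c)) (L 0).c.c.a.b e (L 7374).c.a.b.b.a.b) (N e (H 4864 (L 0).c.c).c.a.b (L 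
  9530).a.b.b.a.b.c.a.d.c e).a e (N (N e (L 0).c.c.c.a.b (L 9502).a.b.b.a.b.d.a.a.b e) e e (N e 
  (L 9592).a.b.b.a.b.c.a.a (L 9493).a.b.b.a.b.c.a.d e).b)) (N (N (L 0).d.c.c.a.b.b (L 0).c.c.a.b 
  (H 9152 (N (H 9044 (L 8922).b.b).a.b.d (H 8513 (L 7374).c.a).b e e)).a.b e) (N e (H 4864 (L 
  0).d.c).c.a.b e (L 9217).a.b.b.a.b.d.a.c.d).a (L 0).d.c.c.a.b.b.a (N (L 0).d.c.c.a.b.b (N e (L 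
  9592).b.b.a.b.c.a.a (H 9618 (L 9493).b.b).a.b.c.a.d e) e e))) (N (N (N (L 0).a.d.c.a.b.b (L 
  0).d.c.a.b (L 7311).c.a.b.b.a.b (L 7311).c.a.b.b.a.b) (L 0).c.a.b (N (L 0).a.d.c.a.b.b (L 
  7374).a.b.b.a (N e (L 9613).a.b.b.a.b.d.a.a e (L 9703).a.b.b.a.b.d.a.c).b e) e) (N (N (N e (L 
  0).b.d.c.a.b (N e (L 9581).a.b.b.a.b.d.a.a (L 9510).a.b.b.a.b.c.a.d e) e) (H 4864 (L 
  0).d.c).a.b (L 9579).a.b.b.a.b.d.a.c.d.b (L 9217).b.b.a.b.d.a.c.d) (N e e (H 9712 (L 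
  9199).b.b).a.b (L 9512).b.b.a.b).a.a (N (L 0).b.d.c.a.b.b e e (L 8862).c.a.b.b.a.b) (L 
  0).b.d.c.a.b.b.a) (N (N (L 0).c.d.c.a.b.b (L 0).d.c.a.b e (L 7374).c.a.b.b.a.b) (N e (H 4864 (L 
  0).c.d).c.a.b (L 9217).a.b.b.a.b.c.a.d.c e).a (L 0).c.d.c.a.b.b.a e) (N (N (N e (L 0).d.d.c.a.b 
  (N e (L 9717).a.b.b.a.b.d.a.a (L 9629).a.b.b.a.b.c.a.d e) e) (L 0).d.c.a.b (L 7374).c.a.b.b.a.b 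
  e) (N (N e (H 4864 (L 0).d.d).c.a.b e (L 9530).a.b.b.a.b.d.a.c.d) (L 9632).b.a.b.c.a.a (L 
  9516).b.a.b.c.a.d e) (N (N e (L 0).d.d.c.a.b e (L 9502).a.b.b.a.b.c.a.a.b) e (N e (L 
  9592).a.b.b.a.b.d.a.a e (L 9493).a.b.b.a.b.d.a.c).b e) (L 0).d.d.c.a.b.b.a))) e) (N (N (N (N (L 
  7311).a.b.b.b.a.b.c (L 0).a.b.b (N (L 0).a.a.a.b.b.b (L 7311).b.b.b.a (N e (L 
  9592).b.b.b.a.b.d.a.a e (L 9663).b.b.b.a.b.d.a.c).b e) e) (N (L 7401).a.b.b.b.a.a.c (L 0).b (N 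
  (N (L 9240).b.b.b (L 0).b.a.a.b.b e e) e e (L 9507).b.b.b.a.b.c.a.a.b.b) e) (H 9691 (N (N (L 
  0).c.a.a.b.b.b (L 0).a.a.b.b e (L 7336).a.b.b.b.a.b) (H 8435 (N (L 7905).a.b.d (H 7266 (H 4864 
  (L 0).c.a).a.b).b e e)).a (N (L 0).c.a.a.b.b.b (N e (L 9553).b.b.a.b.d.a.a e (L 
  9625).b.b.a.b.d.a.c) e (H 9686 (H 9383 (L 9117).b.b).a.b).c.a) (N (L 0).c.a.a.b.b.b e e (N e (L 
  9632).b.b.b.a.b.c.a.a (L 9477).b.b.b.a.b.c.a.d e).b))) e) (N (L 7311).a.b.b.b.a.b.c.a (L 0) (N 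
  (N (N e (L 0).c.b.a.b.b e (L 9669).b.b.b.a.b.d.a.c.d) (L 0).b.a.b.b e (L 7374).a.b.b.b.a.b) (H 
  4864 (L 0).c.b).a.b.b.b.a (N (L 0).c.b.a.b.b.b e e (L 9567).b.b.a.b.c.a) (N (N e (L 
  0).c.b.a.b.b (L 9518).b.b.b.a.b.d.a.a.b e) (L 9507).b.b.a.b.c.a.a.b e e)) e) (N (N (N (L 
  0).a.c.a.b.b.b (L 0).c.a.b.b (L 7311).a.b.b.b.a.b (L 7311).a.b.b.b.a.b) (L 0).a.b.b e (N (L 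
  0).a.c.a.b.b.b (L 7374).b.b.b.a e (N e (L 9613).b.b.b.a.b.c.a.a (L 9703).b.b.b.a.b.c.a.d e).b)) 
  (N (N (N e (L 0).b.c.a.b.b e (N e (L 9581).b.b.b.a.b.c.a.a e (L 9510).b.b.b.a.b.d.a.c)) (H 4864 
  (L 0).c.a).b.b e (L 9579).b.b.b.a.b.c.a.d.c.b) (L 0).b.c.a.b.b.b.a (L 0).b.c.a.b.b.b.a (N (L 
  0).b.c.a.b.b.b e (L 9216).a.b.d.a e)) (N (N (N e (L 0).c.c.a.b.b e (N e (L 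
  9717).b.b.b.a.b.c.a.a e (L 9629).b.b.b.a.b.d.a.c)) (L 0).c.a.b.b e (L 7374).a.b.b.b.a.b) (N e 
  (H 4864 (L 0).c.c).a.b.b (L 9530).b.b.b.a.b.c.a.d.c e).a (L 0).c.c.a.b.b.b.a (N (N e (L 
  0).c.c.a.b.b (N (H 9621 (L 9502).b.b).b.a.b.d (L 9217) e e).a.b e) e e (N e (L 
  9592).b.b.b.a.b.c.a.a (H 9618 (L 9493).b.b).b.a.b.c.a.d e).b)) (N (N (L 0).d.c.a.b.b.b (L 
  0).c.a.b.b (L 7374).a.b.b.b.a.b e) (N e (H 4864 (L 0).d.c).a.b.b e (L 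
  9217).b.b.b.a.b.d.a.c.d).a (L 0).d.c.a.b.b.b.a (N (L 0).d.c.a.b.b.b (N e (L 9632).b.b.a.b.c.a.a 
  (L 9516).b.b.a.b.c.a.d e) e e))) e) (N (N (N (L 7311).b.b.b.b.a.b.c e (N e (N (L 9244).b.a.b.d 
  (H 8458 (L 7311).b.b) e e).a (N e (N e (L 9592).b.b.b.a.b.d.a.a e (L 9663).b.b.b.a.b.d.a.c) e 
  (L 9467).b.a.b.c.a) e) e) (L 9507).b.b.b.a.b.c.a.a.b.b.d.c (N (L 7374).b.b.b.b.a.b.d (L 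
  9260).b.a.b.d.a.c.d (L 9217).b.b.a.b.c.a.d (N e (L 9632).b.b.b.a.b.c.a.a (L 
  9516).b.b.b.a.b.c.a.d e).b.d) e) (N (N (N e (N (L 9244).b.b.a.b.d (H 8458 (L 7311).b.b).b e 
  e).a (L 9467).b.b.a.b.c.a.d e).c e (L 9260).b.b.a.b.d.a.c.d.b e) (N (N (N e (L 
  9244).b.b.b.a.b.d.a.a (L 9467).b.b.b.a.b.c.a.d e).c e (L 9260).b.b.b.a.b.d.a.c.d.b e) e (L 
  9513).b.b.b.a.b.c.a.a.b.b.d e) (N (N (L 9669).b.b.b.a.b.d.a.c.d.d e e (L 7374).b.b.b.b.a.b) e 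
  (L 9489).b.b.a.b.c.a.d (N (L 9518).b.b.b.a.b.d.a.a.b.c (L 9513).b.b.a.b.c.a.a.b e e)) e) (N (N 
  (N e e (L 7311).b.b.b.b.a.b (N e (H 9268 (L 7311).b.b).b.b.a e (L 9669).b.b.a.b.d.a.c)) e e (N 
  e (L 7374).b.b.b.a e (N e (L 9613).b.b.b.a.b.c.a.a (L 9703).b.b.b.a.b.c.a.d e).b)) (N (N e (L 
  9581).b.b.b.a.b.c.a.a e (L 9510).b.b.b.a.b.d.a.c).d e e (L 9579).b.b.b.a.b.c.a.d.c.b).a (N (N 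
  (N e (L 9717).b.b.b.a.b.c.a.a e (L 9629).b.b.b.a.b.d.a.c).d e e (L 7374).b.b.b.b.a.b) (L 
  9530).b.b.b.a.b.c.a.d.c.c.a e (N (N (H 9695 (L 9502).b.b).b.a.b.d (L 9489) e e).a.b.c e e (N e 
  (L 9592).b.b.b.a.b.c.a.a (H 9686 (L 9493).b.b).b.a.b.c.a.d e).b)) (N (N (L 9518).b.b.a.b.d (H 
  8590 (L 7374).b.b).b e e).a.b.c (N (H 9614 (L 9217).b.b).b.a.b.d.a.c.d.d (L 9513).b.a.b.c.a.a e 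
  e) e e)) e) (N (N (N (N e (L 0).a.c.b.b (L 7311).c.b.b.b.a.b (L 7311).c.b.b.b.a.b) (L 0).c.b.b 
  (N (L 0).a.a.c.b.b.b (L 7311).b.b.b.a (N e (L 9592).b.b.b.a.b.d.a.a e (L 
  9663).b.b.b.a.b.d.a.c).b e) (N (L 0).a.a.c.b.b.b (H 9268 (L 7311).b.b).b.a e (N e (N e (L 
  9592).b.b.b.a.b.c.a.a (L 9663).b.b.b.a.b.c.a.d e) (L 9669).b.a.b.d.a e))) (N (N (L 
  0).b.a.c.b.b.b e e (L 7873).c.b.b.b.a.c) (N (N e e (L 9689).b.b.a.b (L 9689).b.b.a.b).a (L 0) 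
  (L 8534).c.b.b.b.a.c e) (L 9507).b.b.b.a.b.c.a.a.b.b.d (N (L 0).b.a.c.b.b.b e (N e (L 
  9507).b.b.b.a.b.d.a.a.b (L 8837).c.b.b.b.a e) e)) (N (L 7374).c.b.b.b.a.b.d (H 4864 (L 
  0).c.a).c.b.b.b.a (L 0).c.a.c.b.b.b.a (N (L 0).c.a.c.b.b.b e e (N e (L 9632).b.b.b.a.b.c.a.a (L 
  9516).b.b.b.a.b.c.a.d e).b)) (N (N (L 0).d.a.c.b.b.b (L 0).a.c.b.b (L 7374).c.b.b.b.a.b e) (N 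
  (L 8625).b.b.a.b.c (H 7328 (H 4864 (L 0).d.a).c.b).b e e).a (N (L 0).d.a.c.b.b.b e (N e (L 
  9632).b.b.b.a.b.d.a.a e (L 9470).b.a.b.d.a.c).b e) (N (L 0).d.a.c.b.b.b (N e (L 
  9613).b.b.a.b.c.a.a (L 9703).b.b.a.b.c.a.d e) e e))) (N (N (N (L 0).a.b.c.b.b.b (L 0).b.c.b.b 
  (L 7311).c.b.b.b.a.b (N e (N (L 9581).b.b.a.b.c (N e (H 8583 (L 7311).c.b) (L 9704).b.b.a.b e) 
  e e).a e (L 9510).b.b.a.b.d.a.c)) (N e (H 4864 (L 0).c.b) (L 7362).c.b.b.b.a.b e) (L 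
  0).a.b.c.b.b.b.a (N (L 0).a.b.c.b.b.b (L 9579).b.b.a.b.c.a.d.c e e)) (N (N (N e (L 0).b.b.c.b.b 
  (N e (L 9244).b.b.b.a.b.d.a.a (L 9467).b.b.b.a.b.c.a.d e) (N e (L 9244).b.b.b.a.b.c.a.a e (L 
  9467).b.b.b.a.b.d.a.c)) (L 0).b.c.b.b (L 9260).b.b.b.a.b.d.a.c.d.b (L 
  9260).b.b.b.a.b.c.a.d.c.b) (N (N e e (L 9618).b.b.a.b (L 9618).b.b.a.b) (L 0).b.b.c.b.b e e).a 
  (L 9513).b.b.b.a.b.c.a.a.b.b.d (N (L 0).b.b.c.b.b.b e (L 9513).b.b.b.a.b.d.a.a.b.b e)) (N (N (L 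
  9669).b.b.b.a.b.d.a.c.d.d e e (L 7374).c.b.b.b.a.b) e e (L 9518).b.b.b.a.b.d.a.a.b.c.a) (N (N 
  (N e (L 0).d.b.c.b.b (L 9669).b.b.b.a.b.c.a.d.c e) (L 0).b.c.b.b (L 7374).c.b.b.b.a.b e) (H 
  4864 (L 0).d.b).c.b.b.b.a (N e (L 0).d.b.c.b.b e (L 9518).b.b.b.a.b.c.a.a.b).a (L 
  0).d.b.c.b.b.b.a)) (N (N (N (L 0).a.c.c.b.b.b (L 0).c.c.b.b (L 7311).c.b.b.b.a.b (N e (N (L 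
  9717).b.b.a.b.c (H 9115 (L 7311).c.b).b e e).a e (L 9629).b.b.a.b.d.a.c)) (L 0).c.b.b e (N (L 
  0).a.c.c.b.b.b (L 7374).b.b.b.a e (N e (L 9613).b.b.b.a.b.c.a.a (L 9703).b.b.b.a.b.c.a.d e).b)) 
  (N (N (N e (L 0).b.c.c.b.b e (N e (L 9581).b.b.b.a.b.c.a.a e (L 9510).b.b.b.a.b.d.a.c)) (H 4864 
  (L 0).c.c).b.b (L 9530).b.b.a.b.c.a.d.c (L 9579).b.b.b.a.b.c.a.d.c.b) (N (N e e (L 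
  9434).b.b.a.b (H 9715 (L 9119).b.b).a.b) (L 0).b.c.c.b.b e e).a (L 0).b.c.c.b.b.b.a (N (L 
  0).b.c.c.b.b.b e (L 8632).b.b.a.b.d.a e)) (N (N (N e (L 0).c.c.c.b.b e (N e (L 
  9717).b.b.b.a.b.c.a.a e (L 9629).b.b.b.a.b.d.a.c)) (L 0).c.c.b.b e (L 7374).c.b.b.b.a.b) (N e 
  (H 4864 (L 0).c.c).c.b.b (L 9530).b.b.b.a.b.c.a.d.c e).a e (N (N e (L 0).c.c.c.b.b (L 
  9502).b.b.b.a.b.d.a.a.b e) e e (N e (L 9592).b.b.b.a.b.c.a.a (L 9493).b.b.b.a.b.c.a.d e).b)) (N 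
  (N (L 0).d.c.c.b.b.b (L 0).c.c.b.b (H 9421 (N (H 9387 (L 9194).b.b).a.b.d (H 8513 (L 
  7374).c.b).b e e)).a.b e) (N e (H 4864 (L 0).d.c).c.b.b e (L 9217).b.b.b.a.b.d.a.c.d).a (L 
  0).d.c.c.b.b.b.a (N (L 0).d.c.c.b.b.b (N e (L 9592).b.b.a.b.c.a.a (H 9686 (L 
  9493).b.b).a.b.c.a.d e) e e))) (N (N (N (L 0).a.d.c.b.b.b (L 0).d.c.b.b (L 7311).c.b.b.b.a.b (L 
  7311).c.b.b.b.a.b) (L 0).c.b.b (N (L 0).a.d.c.b.b.b (N (L 9518).b.a.b.d (H 8590 (L 7374).b.b) e 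
  e).a (N e (H 9723 (L 9613).b.b).b.a.b.d.a.a e (L 9703).b.b.b.a.b.d.a.c).b e) e) (N (N (N e (L 
  0).b.d.c.b.b (N e (L 9581).b.b.b.a.b.d.a.a (L 9510).b.b.b.a.b.c.a.d e) e) (H 4864 (L 
  0).d.c).b.b (L 9579).b.b.b.a.b.d.a.c.d.b (H 9614 (L 9217).b.b).a.b.d.a.c.d) (N (N e e (H 9467 
  (L 9199).b.b).a.b (L 9512).b.b.a.b) (L 0).b.d.c.b.b e e).a (L 0).b.d.c.b.b.b.a (L 
  0).b.d.c.b.b.b.a) (N (N (L 0).c.d.c.b.b.b (L 0).d.c.b.b e (L 7374).c.b.b.b.a.b) (N e (H 4864 (L 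
  0).c.d).c.b.b (L 9217).b.b.b.a.b.c.a.d.c e).a (L 0).c.d.c.b.b.b.a e) (N (N (N e (L 0).d.d.c.b.b 
  (N e (L 9717).b.b.b.a.b.d.a.a (L 9629).b.b.b.a.b.c.a.d e) e) (L 0).d.c.b.b (L 7374).c.b.b.b.a.b 
  e) (N e (H 4864 (L 0).d.d).c.b.b e (L 9530).b.b.b.a.b.d.a.c.d).a (N (N e (L 0).d.d.c.b.b e (L 
  9502).b.b.b.a.b.c.a.a.b) e (N e (L 9592).b.b.b.a.b.d.a.a e (L 9493).b.b.b.a.b.d.a.c).b e) (L 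
  0).d.d.c.b.b.b.a))) e) (N (N (N (N (N e e (L 7311).a.c.b.b.a.b (N e (L 7311).a.c.b.b.a (L 
  7810).a.c.b.b.a e)) (L 0).a.c.b (N (L 0).a.a.a.c.b.b (L 7311).c.b.b.a (N e (L 
  9592).c.b.b.a.b.d.a.a e (L 9663).c.b.b.a.b.d.a.c).b e) (N (L 0).a.a.a.c.b.b (L 7311).c.b.b.a (L 
  7810).c.b.b.a (N e (L 9592).c.b.b.a.b.c.a.a (L 9663).c.b.b.a.b.c.a.d e).b)) (H 9155 (N (N (L 
  6746).a.c.b.b.a e (L 7873).a.c.b.b.a e).d (N e e (L 0) (L 8573).b.b.a.a.b.a) (N (L 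
  0).b.a.a.c.b.b e (L 8933).c.b.b.a.a.b.a.c.b.d e) (N (N (L 8585).c.b.b (L 0).b.a.a.c.b e e) e (L 
  8837).a.c.b.b.a.c (L 8936).c.b.b.a.a.b.a.d.b.c))) (N (N e (L 0).a.a.c.b e (L 7374).a.c.b.b.a.b) 
  (N (L 9244).b.b.a.b.d (H 7266 (H 4864 (L 0).c.a).a.c).b e e).a (N (H 4864 (L 0).c.a).a.c.b.b (N 
  e (L 9592).b.b.a.b.d.a.a e (L 9663).b.b.a.b.d.a.c) e (H 9711 (L 9155).b.b).a.b.c.a) (N (H 9635 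
  (L 0).c.a).a.c.b.b e e (N e (L 9632).c.b.b.a.b.c.a.a (L 9516).c.b.b.a.b.c.a.d e).b)) (N (N (H 
  9155 (L 0).d.a).a.c.b.b (L 0).a.a.c.b (L 7374).a.c.b.b.a.b e) (N (H 9237 (N (H 9218 (L 
  8749).b.b).a.b.c (H 7266 (H 4864 (L 0).d.a).a.c).b e e)) e (L 8706).a.c.b.b.a.c e) (N (H 9055 
  (N e (H 7761 (H 5360 (L 0).d.a).a.c) (L 8691).a.c e).b) e (N e (L 9632).c.b.b.a.b.d.a.a e (L 
  9516).c.b.b.a.b.d.a.c).b e) (N (H 9140 (L 0).d.a).a.c.b.b (N (L 9654).b.b.a.c.d (L 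
  9592).b.b.a.b.c.a.a (L 9663).b.b.a.b.c.a.d e) (N (H 9622 (L 9155).b.b).a.b.d e (L 
  8534).a.c.b.b.a e) e))) (N (N (N (L 0).a.b.a.c.b.b (H 9701 (L 0).b.a).c.b (L 7311).a.c.b.b.a.b 
  (N e (L 7311).a.c.b.b.a (L 7810).a.c.b.b.a e)) e (L 0).a.b.a.c.b.b.a (N (L 0).a.b.a.c.b.b e (L 
  7873).c.b.b.a e)) (L 0) (N (N (L 9669).c.b.b.a.b.d.a.c.d.d e e (L 7374).a.c.b.b.a.b) (H 4864 (L 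
  0).c.b).a.c.b.b.a (N (H 4864 (L 0).c.b).a.c.b.b e e (L 9567).b.b.a.b.c.a) (N (N e (H 9635 (L 
  0).c.b).a.c.b (L 9518).c.b.b.a.b.d.a.a.b e) (L 9507).b.b.a.b.c.a.a.b e e)) (N (N (N e (H 9155 
  (L 0).d.b).a.c.b (L 9669).c.b.b.a.b.c.a.d.c e) (L 0).b.a.c.b (L 7374).a.c.b.b.a.b e) (N (H 4864 
  (L 0).d.b).a.c.b.b e (L 8706).a.c.b.b.a.c e) (N (N e (H 5360 (L 0).d.b).a.c.b e (N e (L 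
  9518).c.b.b.a.b.c.a.a e (L 9716).c.b.b.a.c.d.a.b)) (L 9507).b.b.a.b.d.a.a.b (L 8837).c.b.b.a e) 
  (N (H 8490 (L 0).d.b).a.c.b.b e (N (L 9567).b.b.a.b.d e (L 8534).a.c.b.b.a e) e))) (N (N (N e e 
  (L 7311).a.c.b.b.a.b (N e (L 7311).a.c.b.b.a (L 7810).a.c.b.b.a e)) e e (N e (L 7374).c.b.b.a e 
  (N e (L 9613).c.b.b.a.b.c.a.a (L 9703).c.b.b.a.b.c.a.d e).b)) (N (N (N e (L 0).b.c.a.c.b e (N e 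
  (L 9581).c.b.b.a.b.c.a.a e (L 9510).c.b.b.a.b.d.a.c)) (H 4864 (L 0).c.a).c.b e (N e (L 
  9579).c.b.b.a.b.c.a.d.c (L 7873).a.c.b.b.a e)) (N (L 0).b.c.a.c.b.b e (L 8534).a.c.b.b.a.c e) 
  (L 0).b.c.a.c.b.b.a (N (L 0).b.c.a.c.b.b e (N (L 9260).b.b.a.b.d e (L 8837).a.c.b.b.a e) e)) (N 
  (N (N e (H 9155 (L 0).c.c).a.c.b e (N e (L 9717).c.b.b.a.b.c.a.a e (L 9629).c.b.b.a.b.d.a.c)) 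
  (H 4864 (L 0).c.a).c.b e (L 7374).a.c.b.b.a.b) (N e (H 4864 (L 0).c.c).a.c.b (L 
  9530).c.b.b.a.b.c.a.d.c e).a (H 4864 (L 0).c.c).a.c.b.b.a (N (N e (H 9635 (L 0).c.c).a.c.b (L 
  9502).c.b.b.a.b.d.a.a.b e) e e (N e (L 9592).c.b.b.a.b.c.a.a (L 9493).c.b.b.a.b.c.a.d e).b)) (N 
  (N (H 9155 (L 0).d.c).a.c.b.b (H 9635 (L 0).c.a).c.b (L 7374).a.c.b.b.a.b e) (N (N e (H 4864 (L 
  0).d.c).a.c.b e (L 9217).c.b.b.a.b.d.a.c.d) e (L 8706).a.c.b.b.a.c e) (H 5360 (L 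
  0).d.c).a.c.b.b.a (N (H 9140 (L 0).d.c).a.c.b.b (N e (L 9632).b.b.a.b.c.a.a (L 
  9516).b.b.a.b.c.a.d e) (L 8534).a.c.b.b.a.c e))) (N (N (N (L 0).a.d.a.c.b.b (H 9155 (L 
  0).d.a).c.b (L 7311).a.c.b.b.a.b (N e (L 7311).a.c.b.b.a (L 7810).a.c.b.b.a e)) (L 0).a.c.b (N 
  (L 0).a.d.a.c.b.b (L 7374).c.b.b.a (N e (L 9613).c.b.b.a.b.d.a.a e (L 9703).c.b.b.a.b.d.a.c).b 
  e) e) (N (N (N e (L 0).b.d.a.c.b (N e (N (L 9534).b.a.b.d (L 8625) e e).a (H 9617 (L 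
  9510).c.b).b.a.b.c.a.d e) e) (H 7328 (H 4864 (L 0).d.a).c.b) (H 9694 (L 
  9579).c.b).b.a.b.d.a.c.d.b (L 7873).a.c.b.b.a.c) (N (L 0).b.d.a.c.b.b e (L 8534).a.c.b.b.a.c e) 
  (N (L 0).b.d.a.c.b.b e (N e (L 8706).c (L 9588).c.b.b.a.b.d.a e).b.a (L 9260).b.b.a.b.c.a) (N 
  (L 0).b.d.a.c.b.b e (L 8837).a.c.b.b.a.c e)) (N (N (H 9155 (L 0).c.d).a.c.b.b (H 5360 (L 
  0).d.a).c.b e (L 7374).a.c.b.b.a.b) (N e (H 4864 (L 0).c.d).a.c.b (L 9217).c.b.b.a.b.c.a.d.c 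
  e).a (N (H 4864 (L 0).c.d).a.c.b.b (N e (L 9632).b.b.a.b.d.a.a e (L 9470).a.b.d.a.c) e e) (H 
  9635 (L 0).c.d).a.c.b.b.a) (N (N (N e (H 9155 (L 0).d.d).a.c.b (N e (L 9717).c.b.b.a.b.d.a.a (L 
  9629).c.b.b.a.b.c.a.d e) e) (H 9140 (L 0).d.a).c.b (L 7374).a.c.b.b.a.b e) (N (N e (H 4864 (L 
  0).d.d).a.c.b e (N e e (H 9716 (L 9350).b.a.c.c).b.a (H 9654 (L 9530).c.b).b.a.b.d.a.c)) (L 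
  9613).b.a.b.c.a.a (N e e (L 8706).a.c.b.b.a (L 9703).b.a.b.c.a) e) (N (N e (H 5360 (L 
  0).d.d).a.c.b e (L 9502).c.b.b.a.b.c.a.a.b) e (N (L 8534).c.b.b (N e (L 9592).c.b.b.a.b.d.a.a e 
  (L 9493).c.b.b.a.b.d.a.c) e e) e) (N (H 9140 (L 0).d.d).a.c.b.b e (L 8534).a.c.b.b.a.c e)))) (N 
  (N (N (N e (L 0).a.b.c.b (L 7311).b.c.b.b.a.b (L 7311).b.c.b.b.a.b) (N e (N e (L 0) (N (L 
  9666).c.b.b.a.b.c.b e e (L 9507).c.b.b.a.b.c.b) e).c (L 7362).b.c.b.b.a.b (L 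
  9260).c.b.b.a.b.c.b.d.c.a) (N (L 0).a.a.b.c.b.b (L 7311).c.b.b.a (N e (L 9592).c.b.b.a.b.d.a.a 
  e (L 9663).c.b.b.a.b.d.a.c).b e) (N (L 0).a.a.b.c.b.b (N (L 9581).b.a.b.c (H 8583 (N e (L 
  7311).c (L 8553).b.a.b e)) e e).a e (N e (N e (L 9592).c.b.b.a.b.c.a.a (L 9663).c.b.b.a.b.c.a.d 
  e) (L 9510).b.a.b.d.a e))) (H 4864 (N e (L 0).c (L 0).b.a.b.c.b.b.a (N (L 0).b.a.b.c.b.b e (L 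
  4619).c.b.b.a.b.d.a.a.b.b e))) (N (N (L 0).c.a.b.c.b.b (L 0).a.b.c.b e (L 7374).b.c.b.b.a.b) e 
  (N (L 0).c.a.b.c.b.b e e (N (L 9217).b.b.a.b.c (L 9605).b.b.a.b.c e e)) (N (L 0).c.a.b.c.b.b (L 
  9256).c.b.b.a.b.c.b.a.c.c e (N e (L 9632).c.b.b.a.b.c.a.a (L 9516).c.b.b.a.b.c.a.d e).b)) (N (N 
  (L 0).d.a.b.c.b.b (L 0).a.b.c.b (L 7374).b.c.b.b.a.b e) (N (H 4864 (L 0).d.a).b.c.b.b (N (H 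
  9656 (L 9547).c.b).b.a.b.c.b e e (L 9706).c.b.b.a.b.c.b).c.c (N e (L 7362).b.c.b.b.a e (L 
  9579).b.a.b.c.a) e) (N (N e (L 0).d.a.b.c (L 9260).b.b.a.b e).b e (N e (L 9632).c.b.b.a.b.d.a.a 
  e (L 9516).c.b.b.a.b.d.a.c).b e) (N (L 0).d.a.b.c.b.b e (L 9217).b.b.a.b.d.a e))) (N (N (N (L 
  0).a.b.b.c.b.b (L 0).b.b.c.b (N e (N (L 9244).b.b.a.b.d (H 8458 (L 7311).b.c).b e e).a (L 
  9467).b.b.a.b.c.a.d e) (N e (N (L 9244).b.b.a.b.c (N e (H 8458 (L 7311).b.c) (L 9671).b.b.a.b 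
  e) e e).a (L 9694).b.b.a.b.c.b.a (L 9467).b.b.a.b.d.a.c)) (N e (L 0).b.c (H 8575 (L 
  7362).b.c).b.b.a.b e) (N (L 0).a.b.b.c.b.b (L 9260).b.b.a.b.d.a.c.d e e) (N (L 0).a.b.b.c.b.b 
  (L 9260).b.b.a.b.c.a.d.c e e)) (N (N (N e (L 0).b.b.b.c.b (N e (N (L 9244).c.b.b.a.b.d (L 9618) 
  e e).a (L 9467).c.b.b.a.b.c.a.d e) (N e (N (L 9244).c.b.b.a.b.c (L 9618) e e).a (L 
  9694).c.b.b.a.b.c.b.a (L 9467).c.b.b.a.b.d.a.c)) (L 0).b.b.c.b (L 9260).c.b.b.a.b.d.a.c.d.b (L 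
  9260).c.b.b.a.b.c.a.d.c.b) e (N (L 0).b.b.b.c.b.b e e (L 9513).c.b.b.a.b.c.a.a.b.b) (N (L 
  0).b.b.b.c.b.b e (L 9513).c.b.b.a.b.d.a.a.b.b (L 9694).c.b.b.a.b.c.b.d.c.a)) (N (N (N e e (L 
  9556).c.b.b.a.b.c.b.a (L 9669).c.b.b.a.b.d.a.c).d e e (L 7374).b.c.b.b.a.b) e (N (L 
  9193).b.b.a.b.c.b e e (N (L 9489).b.b.a.b.c (L 9193).b.b.a.b.c e e)) (N (L 
  9518).c.b.b.a.b.d.a.a.b.c (L 9513).b.b.a.b.c.a.a.b e (L 9556).c.b.b.a.b.c.b.d.c.a)) (N (N (N e 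
  (L 0).d.b.b.c.b (L 9669).c.b.b.a.b.c.a.d.c e) (L 0).b.b.c.b (L 7374).b.c.b.b.a.b e) (N (H 4864 
  (L 0).d.b).b.c.b.b e (L 7362).b.c.b.b.a.b e) (N (N e (L 0).d.b.b.c.b e (N (L 9518).c.b.b.a.b.c 
  (L 9705).c.b.b.a.b.c e e).a.b) (L 9513).b.b.a.b.d.a.a.b e e) (N (N e (L 0).d.b.b.c.b (L 
  9694).b.b.a.b.c.b.d e) e (L 9489).b.b.a.b.d.a e))) (N (N (N e e (L 7311).b.c.b.b.a.b (N e (H 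
  9268 (L 7311).b.c).b.b.a (L 9556).b.b.a.b.c.b.a (L 9669).b.b.a.b.d.a.c)) (N e e (L 
  7362).b.c.b.b.a.b (L 9578).c.b.b.a.b.c.b.d.c.a) e (N e (L 7374).c.b.b.a e (N e (L 
  9613).c.b.b.a.b.c.a.a (L 9703).c.b.b.a.b.c.a.d e).b)) (N (N e (N (L 9581).c.b.b.a.b.c (L 
  9704).c.b.b.a.b.c e e).a e (L 9510).c.b.b.a.b.d.a.c).d e e (L 9579).c.b.b.a.b.c.a.d.c.b).a (N 
  (N (N e (L 9717).c.b.b.a.b.c.a.a (L 9525).c.b.b.a.b.c.b.a (L 9629).c.b.b.a.b.d.a.c).d (L 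
  9570).c.b.b.a.b.c.b.d.c.c e (L 7374).b.c.b.b.a.b) (L 9530).c.b.b.a.b.c.a.d.c.c.a e (N (L 
  9502).c.b.b.a.b.d.a.a.b.c (L 9570).c.b.b.a.b.c.b.a.c.c e (N (L 9525).c.b.b.a.b.c.b.d.c (N e (L 
  9592).c.b.b.a.b.c.a.a (L 9493).c.b.b.a.b.c.a.d e) e e))) (N (N (L 9518).b.b.a.b.d (H 8590 (L 
  7374).b.c).b e e).a.b.c (N (N e e (L 9578).c.b.b.a.b.c.b.a (L 9217).c.b.b.a.b.d.a.c).d e (L 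
  7362).b.c.b.b.a.b e) e (L 9556).b.b.a.b.c.b.d.c.a)) (N (N (N (L 0).a.d.b.c.b.b (L 0).d.b.c.b (N 
  e (H 9268 (L 7311).b.c).b.b.a (L 9669).b.b.a.b.c.a.d e) (L 7311).b.c.b.b.a.b) (N e (N e (L 0) 
  (N (L 9706).c.b.b.a.b.c.b e e (H 9656 (L 9547).c.b).b.a.b.c.b) e).c (L 7362).b.c.b.b.a.b e) (N 
  (L 0).a.d.b.c.b.b (L 7374).c.b.b.a (N e (L 9613).c.b.b.a.b.d.a.a e (L 9703).c.b.b.a.b.d.a.c).b 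
  (L 9260).b.b.a.b.c.b) e) (N (N (N e (L 0).b.d.b.c.b (N e (L 9581).c.b.b.a.b.d.a.a (L 
  9510).c.b.b.a.b.c.a.d e) e) (H 4864 (L 0).d.b).c.b (L 9579).c.b.b.a.b.d.a.c.d.b e) (L 
  0).b.d.b.c.b.b.a (N (L 0).b.d.b.c.b.b (L 7362).c.b.b.a e e) e) (N (N (L 0).c.d.b.c.b.b (N e (L 
  0).d.b.c (L 9256).c.b.b.a.b.c.b.d.c e) e (N (L 9518).b.b.a.b.c (N e (H 8590 (L 7374).b.c) (L 
  9705).b.b.a.b e) e e).a.b) (N e (H 4864 (L 0).c.d).b.c.b (L 9217).c.b.b.a.b.c.a.d.c e).a (N e 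
  (L 0).c.d.b.c (L 9605).b.b.a.b e).b.a (L 0).c.d.b.c.b.b.a) (N (N (N e (L 0).d.d.b.c.b (N e (L 
  9717).c.b.b.a.b.d.a.a (L 9629).c.b.b.a.b.c.a.d e) e) (L 0).d.b.c.b (L 7374).b.c.b.b.a.b e) (N 
  (N e (H 4864 (L 0).d.d).b.c.b e (N e e (L 9260).c.b.b.a.b.c.b.a (L 9530).c.b.b.a.b.d.a.c)) (N 
  (L 9507).c.b.b.a.b.c.b e e (L 9666).c.b.b.a.b.c.b).c.c (L 7362).b.c.b.b.a.b e) (N (N e (L 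
  0).d.d.b.c.b e (N (L 9502).c.b.b.a.b.c (L 9685).c.b.b.a.b.c e e).a.b) e (N e (L 
  9592).c.b.b.a.b.d.a.a e (L 9493).c.b.b.a.b.d.a.c).b e) (L 0).d.d.b.c.b.b.a))) (N (N (N (N e (L 
  0).a.c.c.b (L 7311).c.c.b.b.a.b (L 7311).c.c.b.b.a.b) (N e e (N (L 9705).b.a.a.b e (L 0) e) (L 
  9546).b.a.a.b.a).b (N (L 0).a.a.c.c.b.b (L 7311).c.b.b.a (N e (L 9592).c.b.b.a.b.d.a.a e (L 
  9663).c.b.b.a.b.d.a.c).b e) (N (L 0).a.a.c.c.b.b (N (L 9717).b.a.b.c (H 9115 (L 7311).c.b) e 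
  e).a e (N e (N e (L 9592).c.b.b.a.b.c.a.a (L 9663).c.b.b.a.b.c.a.d e) (L 9629).b.a.b.d.a e))) 
  (N (N (L 0).b.a.c.c.b.b e e (L 7374).c.c.b.b.a.c) (N (N e e (L 9689).b.b.a.b (L 
  9689).b.b.a.b).a e (L 0) (L 9217).b.b.a.c.b.a) (N e (H 9518 (L 9259).b.a).c.b (H 9684 (L 
  9596).c.b.b.a).c.b.b.c.b.d (N (H 9609 (L 9260).b.a).c.d (H 9668 (H 9614 (L 
  9507).c.b).b.a).b.c.a.a e e).b) (N (L 0).b.a.c.c.b.b e (N (L 9354).c.b.b (L 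
  9507).c.b.b.a.b.d.a.a.b e e) (N e (N (L 9516).c.b.b.a.c.b (L 9596).c.b.b.a.c.b e e).d (L 
  9632).c.b.b.a.c.b.a.a e).c)) (N (L 7374).c.c.b.b.a.b.d (H 4864 (L 0).c.a).c.c.b.b.a e (N (L 
  0).c.a.c.c.b.b e e (N e (L 9632).c.b.b.a.b.c.a.a (L 9516).c.b.b.a.b.c.a.d e).b)) (N (N (L 
  0).d.a.c.c.b.b (L 0).a.c.c.b (L 7374).c.c.b.b.a.b e) (N (L 8625).b.b.a.b.c (H 7328 (H 4864 (L 
  0).d.a).c.c).b e e).a (N (H 8475 (L 0).d.a).c.c.b.b e (N e (L 9632).c.b.b.a.b.d.a.a e (H 9726 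
  (H 9628 (L 9516).c.b).b.a).b.d.a.c).b e) (N (L 0).d.a.c.c.b.b (N e (L 9613).b.b.a.b.c.a.a (L 
  9703).b.b.a.b.c.a.d e) e e))) (N (N (N (L 0).a.b.c.c.b.b (L 0).b.c.c.b (L 7311).c.c.b.b.a.b (N 
  e (N (L 9581).b.b.a.b.c (H 8583 (L 7311).c.c).b (L 9723).b.b.a.b.c e).a e (L 
  9510).b.b.a.b.d.a.c)) (H 4864 (L 0).c.c).b (N (L 0).a.b.c.c.b.b e (N e (L 7382).c.c.b.b.a e (L 
  9530).b.a.b.c.a) e) (N (L 0).a.b.c.c.b.b (N (L 9579).b.b.a.b.c e (L 9598).b.b.a.b.c e).d.c e 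
  e)) (N (N (N e (L 0).b.b.c.c.b (N e (N (H 9597 (L 9244).c.b).b.a.b.d (L 9434) e e).a (H 9659 (L 
  9467).c.b).b.a.b.c.a.d e) (N e (H 9715 (N (H 9582 (L 9228).c.b).b.a.b.c (L 9119) e e).a) e (H 
  9655 (L 9467).c.b).b.a.b.d.a.c)) (L 0).b.c.c.b (H 9609 (L 9260).c.b).b.a.b.d.a.c.d.b (H 9695 (L 
  9260).c.b).b.a.b.c.a.d.c.b) (N (N e e (L 9618).b.b.a.b (L 9618).b.b.a.b) (L 0).b.b.c.c.b e e).a 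
  (N (H 8475 (L 0).b.b).c.c.b.b e e (L 9513).c.b.b.a.b.c.a.a.b.b) (N (L 0).b.b.c.c.b.b e (L 
  9467).b.a.b.d.a.a.b.b e)) (N (N (N e (L 0).c.b.c.c.b e (L 9669).c.b.b.a.b.d.a.c.d) (H 8475 (L 
  0).b.c).c.b e (L 7374).c.c.b.b.a.b) e e (N e (L 0).c.b.c.c.b (L 9518).c.b.b.a.b.d.a.a.b e).a) 
  (N (N (N e (L 0).d.b.c.c.b (L 9669).c.b.b.a.b.c.a.d.c e) (L 0).b.c.c.b (L 7374).c.c.b.b.a.b e) 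
  (H 4864 (L 0).d.b).c.c.b.b.a (N e (H 8475 (L 0).d.b).c.c.b e (N (L 9472).b.a.b.c (L 8632) e 
  e).a.b).a (L 0).d.b.c.c.b.b.a)) (N (N (N (L 0).a.c.c.c.b.b (N (L 9705).b.b.a.a.b e (L 0).c 
  e).c.b (L 7311).c.c.b.b.a.b (N e (N (L 9717).b.b.a.b.c (H 9115 (L 7311).c.c).b e e).a e (L 
  9629).b.b.a.b.d.a.c)) (L 0).c.c.b e (N (L 0).a.c.c.c.b.b (L 7374).c.b.b.a e (N e (L 
  9613).c.b.b.a.b.c.a.a (L 9703).c.b.b.a.b.c.a.d e).b)) (N (N (N e (L 0).b.c.c.c.b e (N e (L 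
  9581).c.b.b.a.b.c.a.a e (L 9510).c.b.b.a.b.d.a.c)) (H 4864 (L 0).c.c).c.b (L 
  9530).b.b.a.b.c.a.d.c (L 9579).c.b.b.a.b.c.a.d.c.b) (N (N e e (L 9434).b.b.a.b (H 9720 (L 
  9119).b.b).a.b) (L 0).b.c.c.c.b e e).a (H 8475 (L 0).b.c).c.c.b.b.a (N (L 0).b.c.c.c.b.b e (L 
  8632).b.b.a.b.d.a e)) (N (N (N e (L 9717).c.b.b.a.b.c.a.a e (L 9629).c.b.b.a.b.d.a.c).d e e (L 
  7374).c.c.b.b.a.b) (L 9530).c.b.b.a.b.c.a.d.c.c.a e (N (L 9502).c.b.b.a.b.d.a.a.b.c e e (N e (L 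
  9592).c.b.b.a.b.c.a.a (L 9493).c.b.b.a.b.c.a.d e).b)) (N (N (L 0).d.c.c.c.b.b (L 0).c.c.c.b (N 
  (L 9502).b.b.a.b.d (H 8513 (L 7374).c.c).b e e).a.b e) (N e (H 4864 (L 0).d.c).c.c.b e (L 
  9217).c.b.b.a.b.d.a.c.d).a (H 8475 (L 0).d.c).c.c.b.b.a (N (L 0).d.c.c.c.b.b (N e (L 
  9592).b.b.a.b.c.a.a (L 9493).b.b.a.b.c.a.d e) e e))) (N (N (N (L 0).a.d.c.c.b.b (N (L 
  9586).b.b.a.a.b e (L 0).d e).c.b (L 7311).c.c.b.b.a.b (L 7311).c.c.b.b.a.b) (L 0).c.c.b (N (L 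
  0).a.d.c.c.b.b (H 9421 (N (H 9387 (L 9194).b.a).b.d (H 8513 (L 7374).c.b) e e).a) (N e (H 9725 
  (L 9613).c.b).b.a.b.d.a.a e (L 9703).c.b.b.a.b.d.a.c).b e) e) (N (N (N e (L 0).b.d.c.c.b (N e 
  (L 9581).c.b.b.a.b.d.a.a (L 9510).c.b.b.a.b.c.a.d e) e) (H 4864 (L 0).d.c).c.b (L 
  9579).c.b.b.a.b.d.a.c.d.b (L 9217).b.b.a.b.d.a.c.d) (N (N e e (L 9199).b.b.a.b (L 
  9512).b.b.a.b) (L 0).b.d.c.c.b e e).a (N (H 8475 (L 0).b.d).c.c.b.b e e (L 9201).c.c.b.b.a.b) 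
  (L 0).b.d.c.c.b.b.a) (N (N (L 0).c.d.c.c.b.b (H 8475 (L 0).d.c).c.b e (L 7374).c.c.b.b.a.b) (N 
  e (H 4864 (L 0).c.d).c.c.b (L 9217).c.b.b.a.b.c.a.d.c e).a (L 0).c.d.c.c.b.b.a e) (N (N (N e (L 
  0).d.d.c.c.b (N e (L 9717).c.b.b.a.b.d.a.a (L 9629).c.b.b.a.b.c.a.d e) e) (L 0).d.c.c.b (L 
  7374).c.c.b.b.a.b e) (N (N e (H 4864 (L 0).d.d).c.c.b e (H 9723 (L 9530).c.b).b.a.b.d.a.c.d) (L 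
  9592).b.a.b.c.a.a (H 9686 (L 9493).b.a).b.c.a.d e) (N (N e (H 8475 (L 0).d.d).c.c.b e (L 
  9502).c.b.b.a.b.c.a.a.b) e (N e (L 9592).c.b.b.a.b.d.a.a e (L 9493).c.b.b.a.b.d.a.c).b e) (L 
  0).d.d.c.c.b.b.a))) (N (N (N (N e (L 0).a.d.c.b (L 7311).d.c.b.b.a.b (L 7311).d.c.b.b.a.b) (N 
  (L 9586).b.a.a.b e e (L 0)).c.b (N (L 0).a.a.d.c.b.b (L 7311).c.b.b.a (N e (L 
  9592).c.b.b.a.b.d.a.a e (L 9663).c.b.b.a.b.d.a.c).b e) (N (L 0).a.a.d.c.b.b (L 7311).c.b.b.a e 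
  (N e (L 9592).c.b.b.a.b.c.a.a (L 9663).c.b.b.a.b.c.a.d e).b)) (N (L 0).b.a.d.c.b.b.a (N (N e e 
  (L 9689).b.b.a.b (L 9689).b.b.a.b).a e (L 0) (L 8534).d.c.b.b.a.d) (N (L 0).b.a.d.c.b.b e e (N 
  e (L 9507).c.b.b.a.b.c.a.a.b e (L 8837).d.c.b.b.a)) (H 9623 (L 9507).c.b).b.a.b.d.a.a.b.b.c) (N 
  (N (L 0).c.a.d.c.b.b (L 0).a.d.c.b e (L 7374).d.c.b.b.a.b) (H 8567 (N (H 8310 (L 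
  7456).b.b).a.b.d (H 7328 (H 4864 (L 0).c.a).d.c).b e e)).a (N (L 0).c.a.d.c.b.b (N e (H 9723 (L 
  9613).b.b).a.b.d.a.a e (L 9703).b.b.a.b.d.a.c) e e) (N e (L 9627).c.b.b.a.b.c.a.d.c.b e (N e (L 
  9632).c.b.b.a.b.c.a.a (L 9516).c.b.b.a.b.c.a.d e).b)) (N (L 7374).d.c.b.b.a.b.c (H 4864 (L 
  0).d.a).d.c.b.b.a (N (L 0).d.a.d.c.b.b e (N e (L 9632).c.b.b.a.b.d.a.a e (L 
  9516).c.b.b.a.b.d.a.c).b e) (L 0).d.a.d.c.b.b.a)) (N (N (N (L 0).a.b.d.c.b.b (H 9652 (L 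
  0).b.d).c.b (N e (N (L 9581).b.b.a.b.d (H 8583 (L 7311).d.c).b e e).a (L 9510).b.b.a.b.c.a.d e) 
  (L 7311).d.c.b.b.a.b) (H 4864 (L 0).d.c).b (N (L 0).a.b.d.c.b.b (L 9579).b.b.a.b.d.a.c.d e (L 
  7616).d.c.b.b.a.b) (N (L 0).a.b.d.c.b.b e e (N e (L 9698).b.c.a.a.b (H 9614 (L 9217).b.a).b.d.a 
  e))) (N (N (N e (L 0).b.b.d.c.b (N e (H 9467 (N (H 9411 (H 9354 (L 8981).c.b).b.a).b.d (L 9199) 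
  e e).a) (H 9675 (L 9467).c.b).b.a.b.c.a.d e) (N e (N (H 9673 (H 9616 (L 9244).c.b).b.a).b.c (L 
  9512) e e).a e (H 9726 (H 9670 (L 9467).c.b).b.a).b.d.a.c)) (L 0).b.d.c.b (H 9715 (L 
  9260).c.b).b.a.b.d.a.c.d.b (H 9677 (H 9621 (L 9260).c.b).b.a).b.c.a.d.c.b) (N (N e e (L 
  9618).b.b.a.b (L 9618).b.b.a.b) (L 0).b.b.d.c.b e e).a (N (L 0).b.b.d.c.b.b e e (N (L 
  9593).b.b.a.b.c (L 9513).c.b.b.a.b.c.a.a.b e e)) (N (L 0).b.b.d.c.b.b e (L 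
  9513).c.b.b.a.b.d.a.a.b.b e)) (N (N (N e (L 0).c.b.d.c.b e (L 9669).c.b.b.a.b.d.a.c.d) (L 
  0).b.d.c.b e (L 7374).d.c.b.b.a.b) (H 4864 (L 0).c.b).d.c.b.b.a (L 0).c.b.d.c.b.b.a (L 
  9518).c.b.b.a.b.d.a.a.b.c.a) (N (N (N e (L 0).d.b.d.c.b (L 9669).c.b.b.a.b.c.a.d.c e) (L 
  0).b.d.c.b (L 7374).d.c.b.b.a.b e) e (N e (L 0).d.b.d.c.b e (L 9518).c.b.b.a.b.c.a.a.b).a (L 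
  0).d.b.d.c.b.b.a)) (N (N (N (L 0).a.c.d.c.b.b (L 0).c.d.c.b (L 7311).d.c.b.b.a.b (L 
  7311).d.c.b.b.a.b) (L 0).d.c.b e (N (L 0).a.c.d.c.b.b (L 7374).c.b.b.a e (N e (L 
  9613).c.b.b.a.b.c.a.a (L 9703).c.b.b.a.b.c.a.d e).b)) (N (N (N e (L 0).b.c.d.c.b e (N e (L 
  9581).c.b.b.a.b.c.a.a e (L 9510).c.b.b.a.b.d.a.c)) (H 4864 (L 0).c.d).c.b (L 
  9217).b.b.a.b.c.a.d.c (L 9579).c.b.b.a.b.c.a.d.c.b) (N (N e e (L 9512).b.b.a.b (L 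
  9199).b.b.a.b) (L 0).b.c.d.c.b e e).a (L 0).b.c.d.c.b.b.a (L 0).b.c.d.c.b.b.a) (N (N (N e (L 
  0).c.c.d.c.b e (N e (L 9717).c.b.b.a.b.c.a.a e (L 9629).c.b.b.a.b.d.a.c)) (L 0).c.d.c.b e (L 
  7374).d.c.b.b.a.b) (N e (H 4864 (L 0).c.c).d.c.b (L 9530).c.b.b.a.b.c.a.d.c e).a (L 
  0).c.c.d.c.b.b.a (N (N e (L 0).c.c.d.c.b (L 9502).c.b.b.a.b.d.a.a.b e) e e (N e (L 
  9592).c.b.b.a.b.c.a.a (L 9493).c.b.b.a.b.c.a.d e).b)) (N (L 7374).d.c.b.b.a.b.c (L 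
  9217).c.b.b.a.b.d.a.c.d.d.a e e)) (N (N (N (L 0).a.d.d.c.b.b (N (L 9546).b.b.a.a.b e e (L 
  0).d).c.b (N e (N (L 9717).b.b.a.b.d (H 9115 (L 7311).d.c).b e e).a (L 9629).b.b.a.b.c.a.d e) 
  (L 7311).d.c.b.b.a.b) (N e e (N (L 9706).c.b.b.a.d.c.b e e (L 9547).c.b.b.a.d.c.b) (L 0)).c.b 
  (N (L 0).a.d.d.c.b.b (L 7374).c.b.b.a (N e (L 9613).c.b.b.a.b.d.a.a e (L 
  9703).c.b.b.a.b.d.a.c).b e) e) (N (N (N e (L 0).b.d.d.c.b (N e (L 9581).c.b.b.a.b.d.a.a (L 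
  9510).c.b.b.a.b.c.a.d e) e) (H 4864 (L 0).d.d).c.b (L 9579).c.b.b.a.b.d.a.c.d.b (L 
  9530).b.b.a.b.d.a.c.d) (N (N e e (L 9119).b.b.a.b (L 9434).b.b.a.b) (L 0).b.d.d.c.b e e).a (N 
  (L 0).b.d.d.c.b.b e e (L 8632).b.b.a.b.c.a) (L 0).b.d.d.c.b.b.a) (N (N (L 0).c.d.d.c.b.b (L 
  0).d.d.c.b e (N (L 9502).b.b.a.b.c (H 8513 (L 7374).d.c).b e e).a.b) (N e (H 4864 (L 
  0).c.d).d.c.b (L 9217).c.b.b.a.b.c.a.d.c e).a (N (L 0).c.d.d.c.b.b (N e (L 9592).b.b.a.b.d.a.a 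
  e (L 9493).b.b.a.b.d.a.c) e e) (L 0).c.d.d.c.b.b.a) (N (N (N e (L 0).d.d.d.c.b (N e (L 
  9717).c.b.b.a.b.d.a.a (L 9629).c.b.b.a.b.c.a.d e) e) (L 0).d.d.c.b (L 7374).d.c.b.b.a.b e) (N e 
  (H 4864 (L 0).d.d).d.c.b e (L 9530).c.b.b.a.b.d.a.c.d).a (N (N e (L 0).d.d.d.c.b e (L 
  9502).c.b.b.a.b.c.a.a.b) e (N e (L 9592).c.b.b.a.b.d.a.a e (L 9493).c.b.b.a.b.d.a.c).b e) e)))) 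
  e) (H 9652 (N (N (N (N (N (L 7238).a.a.c.b.a.c.d (N e (N e e (N (L 9513).a.c.b.a.c.d.a e e (L 
  9388).a.c.b.a.c.c.b) (L 9584).a.c.b.a.c.d.a.b).c e (L 9142).a.c.b.a.c.c.b.d.c.a) (L 
  9423).a.c.b.a.c.c.b.b.d.a.b (L 7238).a.c.b.a.c) (N (N (L 7401).a.a.c.b.a e (L 7392).a.a.c.b.a 
  e).d (N (L 0).b.a.a.a.c.b e (N (L 9232).c.b.a.a.b e (N (N (L 9513).c.b.a.c.d (H 8933 (L 
  7129).a.a).c e e) e e (L 9388).c.b.a.c.c.b) (L 9584).c.b.a.c.d.a.b) (L 9232).c.b.a.a.b.a) (N (L 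
  0) e (L 9595).a.c.b.a.a.b.a.c.b.d e) (N (N e (L 0).b.a.a.a.c (L 9142).c.b.a.c.c.b.d e) e (L 
  8736).a.a.c.b.a.c (L 9595).a.c.b.a.a.b.a.d.b.c)) (N (N (L 0).c.a.a.a.c.b (N (L 7401).a.a.c.b.a 
  e (L 0).a.a.a e) e (L 7401).a.a.c.b.a.a) (N e (L 0).c.a.a.a.c e (L 9423).c.b.a.c.c.b.b).a (N (H 
  4764 (L 0).c.a).a.a.c.b e e (L 9535).c.b.a.c.c.b) (N (L 0).c.a.a.a.c.b (L 
  9429).a.c.b.a.c.d.a.a.c.c e e)) (N (N (H 4903 (L 0).d.a).a.a.c.b (N (L 7401).a.a.c.b.a e (L 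
  0).a.a.a e) e e) (N (L 0).d.a.a.a.c.b (N e e (N (L 9544).a.c.b.a.c.d.a e e (L 
  9428).a.c.b.a.c.c.b) (N (L 9595).a.c.b.a e (L 9437).a.c.b.a e).d.a.b).c (N e e (L 
  7378).a.a.c.b.a (L 9637).a.c.b.a.c.c.b.b.d) e) (N (H 7193 (H 4887 (L 0).d.a).a.a).c.b e (L 
  9595).a.c.b.a.a.d.a.c.d.b e) (N (L 0).d.a.a.a.c.b (N (N (L 9232).c.b.a e (L 9093).c.b.a e).d (L 
  9288).c.b.a.c.c e e) (N (L 9232).c.b.a.a.d e (L 8433).a.a.c.b.a e) e))) (N (N (N (L 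
  0).a.b.a.a.c.b e e (L 7238).a.a.c.b.a.c) e (L 0).a.b.a.a.c.b.a (N (N (L 7401).a.c.b (L 
  0).a.b.a.a.c e e) e (L 7392).a.c.b.a e)) (N (N (N e (H 4903 (L 0).b.b).a.a.c e (N e (L 
  9567).a.c.b.a.c.d.a (L 9546).a.c.b.a.a.d.a e).d) (L 0).b.a.a.c (L 9299).a.c.b.a.a.d.a.c.d.b (N 
  (L 7401).a.a.c.b.a e (L 7392).a.a.c.b.a e)) (N (L 0).b.b.a.a.c.b e (H 9444 (L 
  7129).a.a).c.b.a.c e) (N (N (L 9232).b.a (L 9563).b.a.a.b.a.d e e).b e (N (N (L 9513).b.a.c.d 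
  (H 8933 (L 7129).a.c) e e) e e (N (L 9564).a.c.b.a.a.b e (H 9642 (L 9388).b.a) e).c.b) (L 
  9584).b.a.c.d.a.b) (N (N (L 9232).b.a (L 9563).b.a.a.b.a.c (N e (L 0).b e (H 9531 (L 
  9424).a.c).b.a.c).a.a e).b e (L 8736).a.a.c.b.a.c (N (L 9583).a.c.b.a.c.c.b.d.c e (L 
  9564).a.c.b.a.a.b.a.d.b e))) (L 0) (N (N (H 4903 (L 0).d.b).a.a.c.b (N (L 7401).a.a.c.b.a e (L 
  0).b.a.a e) (N e (N (L 9571).b.a.a.b e (L 9142).b.a e).c e (L 9639).a.c.b.a.c.c.b.b).d e) (N (L 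
  0).d.b.a.a.c.b e (L 7378).a.a.c.b.a.c e) (N (N e (H 4887 (L 0).d.b).a.a.c e (N (L 9295).a.c.b.a 
  e (L 9138).a.c.b.a e).d.a.b.d) e (L 8736).a.c.b.a e) (N (L 0).d.b.a.a.c.b (L 9625).c.b.a.c.c.b 
  (N (L 9644).c.b.a.a.d (L 9595).c.b.a.a.b.a.d (L 8433).a.a.c.b.a e) e))) (N (N (L 
  7238).a.a.c.b.a.c.d (N (L 7401).a.c.b.a e (L 0).a.a (L 9461).a.c.b.a.c.c.b.d.c.a) e (N (L 
  7401).a.c.b (L 0).a.c.a.a.c e e).a) (N (N (N e (H 4903 (L 0).b.c).a.a.c e (N e (L 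
  9607).a.c.b.a.c.d.a (L 9586).a.c.b.a.a.d.a e).d) (L 0).c.a.a.c e (N (L 7401).a.a.c.b.a (L 
  9423).b.a.c.c.b (L 7392).a.a.c.b.a e)) (N (L 0).b.c.a.a.c.b e (H 9434 (L 7129).a.a).c.b.a.c (L 
  9644).c.b.a.a.b.a) e (N (N e (L 9295).a.c.b.a.a.b.a.c (N e e (L 0).b (L 9440).a.c.b.a.c).a.a 
  e).b e (N (L 9299).c.b.a.a.d e (L 8736).a.a.c.b.a e) (L 9623).a.c.b.a.c.c.b.d.c.a)) (N (N (N e 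
  (N e (L 9546).a.c.b.a.a.b.a.d (N e e (L 0).c (L 9165).a.c.b.a.c).a.a e) e (N e e (L 9649) (N (L 
  9546).a.c.b.a e (L 9405).a.c.b.a e).d.a.b)) (N (L 7401).a.a.c.b.a e (N (H 4764 (L 0).c.a) e (L 
  9572).a.c.b.a.c.c.b.d (N (L 9299).a.c.b.a e (L 9262).a.c.b.a e).d.a.b) e) e (N (L 
  7401).a.a.c.b.a e (L 9299).a.c.b.a.a.b.a.d.b e)) (N (L 0).c.c.a.a.c.b (L 
  9606).a.c.b.a.c.c.b.b.d.a e e) (H 4764 (L 0).c.c).a.a.c.b.a (N (L 0).c.c.a.a.c.b (N (H 9633 (L 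
  9439).a.c).b.a.c.d (L 9535) e e).a.c.c e (H 9607 (L 9413).a.c).b.a.c.c.b.d.c.a)) (N (N (N e (L 
  9586).a.c.b.a.a.b.a.c (H 4903 (L 0).d.c).a.a e).b (N (L 7401).a.a.c.b.a e (L 0).c.a.a e) e e) 
  (N (N e (L 0).d.c.a.a.c e (L 9295).a.c.b.a.a.d.a.c.d) (L 9469).a.c.b.a.c.c.b.b.d.a (N (L 
  9299).c.b.a.a.b e (N (L 9429).c.b.a.c.d (L 7344).c e e).a e) e) (H 4887 (L 0).d.c).a.a.c.b.a (N 
  (L 0).d.c.a.a.c.b (N (N (L 9644).c.b.a e (L 9506).c.b.a e).d (L 9330).c.b.a.c.c e e) (L 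
  8433).a.a.c.b.a.c e))) (N (N (N (L 0).a.d.a.a.c.b (H 4903 (L 0).d.a).a.c e (L 
  7238).a.a.c.b.a.c) (N (L 7401).a.c.b.a (N e e (N (L 9534).a.c.b.a.c.d.a e e (L 
  9428).a.c.b.a.c.c.b) (L 9624).a.c.b.a.c.d.a.b).c (L 0).a.a e) (N (L 0).a.d.a.a.c.b (L 
  9441).a.c.b.a.c.c.b.b.d.a e e) e) (N (N (H 4903 (L 0).b.d).a.a.c.b (L 0).d.a.a.c (L 
  9571).b.a.a.d.a.c.d.b (N (L 7401).a.a.c.b.a e (L 7392).a.a.c.b.a e)) (N (H 9237 (L 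
  0).b.d).a.a.c.b e (N (L 9644).c.b.a.a.b e (N (N (L 9544).c.b.a.c.d (H 8471 (L 7129).a.a).c e e) 
  e e (L 9428).c.b.a.c.c.b) (N (L 9595).c.b.a e (L 9437).c.b.a e).d.a.b) e) (N (L 
  9295).a.c.b.a.a.b.a.d.b.b e (L 7378).a.c.b.a (L 9637).c.b.a.c.c.b.b.d) (N (L 0).b.d.a.a.c.b e 
  (L 8736).a.a.c.b.a.c e)) (H 8482 (N (N (L 0).c.d.a.a.c.b (H 7193 (N (H 4887 (L 0).d.a) e (H 
  7137 (H 7083 (L 6793).a.c).b.a).c.c.b.d (L 4887).c.d.a.b).c) e (L 7401).a.a.c.b.a.a) (N (L 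
  0).c.d.a.a.c.b (L 8470).a.c.b.a.c.c.b.b.d.a e e) (L 0).a.a.c.b.a (L 0).c.d.a.a.c.b.a)) (N (N (N 
  e (L 9546).a.c.b.a.a.b.a.c (H 4903 (L 0).d.d).a.a e).b (N (L 7401).a.a.c.b.a e (L 0).d.a.a e) 
  (N e (L 9299).a.c.b.a.a.b.a.c e (L 9644).a.c.b.a.c.c.b.b).d e) (N (N e (L 0).d.d.a.a.c e (N (H 
  9540 (L 9232).b.a) e (H 9385 (L 9093).b.a) (H 9647 (H 9618 (L 9430).b.a).a.d).a.c)) (N (H 9600 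
  (L 9132).a.c).b.a.c.c.b.b.d e (N e e (N (N (L 9505).a.c.b.a.c.d (L 9288) e e) e e (H 9582 (L 
  9389).a.c).b.a.c.c.b) (N (L 9564).a.c.b.a e (H 9594 (H 9526 (L 9414).a.c).b.a) e).d.a.b) e) (L 
  7378).a.a.c.b.a.c e) (N (N e (H 4887 (L 0).d.d).a.a.c e (N (L 9232).b.a e e (N (N (L 9563).b.a 
  e (H 9594 (L 9406).b.a) e).d (L 9634).b.a.c.c e e).b)) e (N (L 8433).a.c.b (L 
  9564).a.c.b.a.a.d.a.c.d e e) e) (N (L 0).d.d.a.a.c.b (L 9631).c.b.a.c.c.b (L 8433).a.a.c.b.a.c 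
  e)))) (L 0) (N (N (N (L 7238).c.a.c.b.a.c.d (N e (N e e (N (L 9513).a.c.b.a.c.d.a e e (L 
  9388).a.c.b.a.c.c.b) (L 9584).a.c.b.a.c.d.a.b).c e (L 9142).a.c.b.a.c.c.b.d.c.a) (L 
  9423).a.c.b.a.c.c.b.b.d.a.b (L 7238).a.c.b.a.c) (N (L 7392).c.a.c.b.a.c.d (L 
  7129).c.a.c.b.a.c.c e (N (L 9461).c.b.a.c.c.b.d.c e (L 8736).c.a.c.b.a.c e)) (L 
  9429).a.c.b.a.c.d.a.a.c.c.b.d (N e (N e (N e e (N (L 9544).a.c.b.a.c.d.a e e (L 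
  9428).a.c.b.a.c.c.b) (L 9437).a.c.b.a.c.d.a.b).c (N e e (L 7378).c.a.c.b.a (L 
  9637).a.c.b.a.c.c.b.b.d) e) e (N e (N (L 9138).c.b.a.c.d (L 9366).c.b.a.c.c e e) (L 
  8433).c.a.c.b.a.c e))) (N (N (N (L 0).a.b.c.a.c.b (L 0).b.c.a.c e (N e e (H 9195 (L 
  7238).c.a).c.b.a (L 9607).c.b.a.c.d.a.b)) (L 0).c.a.c (L 0).a.b.c.a.c.b.a (N (L 0).a.b.c.a.c.b 
  (L 9120).c.b.a.c.c.b (L 7392).a.c.b.a e)) (N (N (N e (L 0).b.b.c.a.c e (L 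
  9567).a.c.b.a.c.d.a.b.d) (L 0).b.c.a.c e (L 7392).c.a.c.b.a.c) (N (L 0).b.b.c.a.c.b e (H 9611 
  (L 7129).c.a).c.b.a.c e) (H 9434 (L 7129).a.c).b.a.c (N (N (H 9637 (L 9424).a.c).b.a.c.d e (L 
  0).b.b e).a.c.b e (L 8736).c.a.c.b.a.c (L 9583).a.c.b.a.c.c.b.d.c.a)) (N (N e (L 0).c.b.c.a.c e 
  (L 9431).a.c.b.a.c.d.a.b.d).a e (H 4764 (L 0).c.b).c.a.c.b.a (N (L 0).c.b.c.a.c.b e e (L 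
  9438).a.c.b.a.c.c.b.d.c.a)) (N (N (L 0).d.b.c.a.c.b (N (L 9440).c.b.a.c.d e (L 0).b e).a.c (L 
  9639).a.c.b.a.c.c.b.b.d.d e) (N (L 0).d.b.c.a.c.b e (L 7378).c.a.c.b.a.c e) (N (N e (H 4887 (L 
  0).d.b).c.a.c e (H 9544 (L 9138).a.c).b.a.c.d.a.b.d) e (L 8736).a.c.b.a e) (N (N e (L 
  0).d.b.c.a.c (L 9623).c.b.a.c.c.b.d e) (L 9625).c.b.a.c.c.b (L 8433).c.a.c.b.a.c e))) (N (N (N 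
  (L 0).a.c.c.a.c.b (N (L 9165).c.b.a.c.d e (L 0).c e).a.c e (N e e (H 8385 (L 7238).c.a).c.b.a 
  (L 9405).c.b.a.c.d.a.b)) (N e e (H 4764 (N (L 0).c e e (L 0).c.b.a.c.d.a.b)) (L 
  9461).a.c.b.a.c.c.b.d.c.a) e (L 0).a.c.c.a.c.b.a) (N (N (N e (L 0).b.c.c.a.c e (L 
  9607).a.c.b.a.c.d.a.b.d) (L 0).c.c.a.c e (L 7392).c.a.c.b.a.c) (N (N e (L 0).b.c.c.a.c e (L 
  9606).c.b.a.c.c.b.b) e (H 9591 (L 7129).c.a).c.b.a.c e) e (N (N (L 9440).a.c.b.a.c.d e (L 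
  0).b.c e).a.c.b e (L 8736).c.a.c.b.a.c (L 9623).a.c.b.a.c.c.b.d.c.a)) (N (N (N e (N (L 
  9165).a.c.b.a.c.d e (L 0).c.c e).a.c e (L 9405).a.c.b.a.c.d.a.b.d) (N (H 4764 (L 0).c.c) e (L 
  9572).a.c.b.a.c.c.b.d (L 9262).a.c.b.a.c.d.a.b).c e e) (N (L 0).c.c.c.a.c.b (L 
  9606).a.c.b.a.c.c.b.b.d.a e e) e (N (L 0).c.c.c.a.c.b (L 9439).a.c.b.a.c.d.a.a.c.c e (L 
  9413).a.c.b.a.c.c.b.d.c.a)) (N (N (L 0).d.c.c.a.c.b (L 0).c.c.a.c e e) (N (L 0).d.c.c.a.c.b (L 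
  9469).a.c.b.a.c.c.b.b.d.a (N (L 9439).c.b.a.c.d (H 8558 (L 7378).c.a).c e e).a.c e) (H 4887 (L 
  0).d.c).c.a.c.b.a (N (N e (L 0).d.c.c.a.c (L 9413).c.b.a.c.c.b.d e) (N (L 9428).c.b.a.c.d (L 
  9287).c.b.a.c.c e e) (L 8433).c.a.c.b.a.c e))) (N (N (N (L 0).a.d.c.a.c.b (L 0).d.c.a.c e (L 
  7238).c.a.c.b.a.c) (N e (N e e (N (L 9534).a.c.b.a.c.d.a e e (L 9428).a.c.b.a.c.c.b) (L 
  9624).a.c.b.a.c.d.a.b).c (L 0).c.a e) (N (L 0).a.d.c.a.c.b (L 9441).a.c.b.a.c.c.b.b.d.a e e) e) 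
  (N (N (L 0).b.d.c.a.c.b (L 0).d.c.a.c e (H 8592 (L 7392).c.a).c.b.a.c) (N (N e (L 0).b.d.c.a.c 
  e (L 9469).c.b.a.c.c.b.b) e (L 7129).c.a.c.b.a.c e) (H 9586 (N (L 9363).b.a.c.d (L 7344) e 
  e).a).c (N (L 0).b.d.c.a.c.b e (L 8736).c.a.c.b.a.c e)) (N (N (N (L 9502).a.c.b.a.c.d e (L 
  0).c.d e).a.c.b (N (H 4887 (L 0).d.c) e (L 9265).a.c.b.a.c.c.b.d (L 9581).a.c.b.a.c.d.a.b).c e 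
  e) (N (L 0).c.d.c.a.c.b (L 9645).a.c.b.a.c.c.b.b.d.a e e) (N (H 4764 (L 0).c.d).c.a.c.b e e (L 
  8760).c.a.c.b.a.c) e) (N (N (N (L 9639).a.c.b.a.c.d e (L 0).d.d e).a.c.b (L 0).d.c.a.c (L 
  9644).a.c.b.a.c.c.b.b.d.d e) (N (N e (L 0).d.d.c.a.c e (L 9506).b.a.c) (N (H 9540 (L 
  9132).a.c).b.a.c.c.b.b.d e (N e e (N (N (L 9505).a.c.b.a.c.d (L 9330) e e) e e (H 9541 (L 
  9389).a.c).b.a.c.c.b) (H 9627 (L 9414).a.c).b.a.c.d.a.b) e) (L 7378).c.a.c.b.a.c e) (N (N e (H 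
  4887 (L 0).d.d).c.a.c e (L 9451).a.c.b.a.c.d.a.b.d) e (L 8433).a.c.b.a e) (N (L 0).d.d.c.a.c.b 
  (L 9631).c.b.a.c.c.b (L 8433).c.a.c.b.a.c e)))) (N (N (N (N e (L 0).a.d.a.c e (L 
  7238).d.a.c.b.a.c) (N e (N e e (N (L 9513).a.c.b.a.c.d.a e e (L 9388).a.c.b.a.c.c.b) (L 
  9584).a.c.b.a.c.d.a.b).c (L 0).d.a (L 9142).a.c.b.a.c.c.b.d.c.a) (N (L 0).a.a.d.a.c.b (L 
  9423).a.c.b.a.c.c.b.b.d.a e e) (L 7238).a.c.b.a.c) (N (N (L 0).b.a.d.a.c.b e e (L 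
  7392).d.a.c.b.a.c) (N (L 0).b.a.d.a.c.b e (N e e (N (N (L 9534).c.b.a.c.d (H 9086 (L 
  7129).d.a).c e e) e e (L 9428).c.b.a.c.c.b) (L 9624).c.b.a.c.d.a.b) e) (L 0).a (L 
  8736).d.a.c.b.a.c.c) (N (N (L 0).c.a.d.a.c.b (L 0).a.d.a.c e e) (N e (L 0).c.a.d.a.c e (L 
  9441).c.b.a.c.c.b.b).a (N (L 9616).c.b.a.c.d (H 4764 (L 0).c.a).d.a.c e e).a (N (L 
  0).c.a.d.a.c.b (L 9429).a.c.b.a.c.d.a.a.c.c e e)) (N e (N e (N e e (N (L 9544).a.c.b.a.c.d.a e 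
  e (L 9428).a.c.b.a.c.c.b) (L 9437).a.c.b.a.c.d.a.b).c (N e e (L 7378).d.a.c.b.a (L 
  9637).a.c.b.a.c.c.b.b.d) e) e (L 8433).d.a.c.b.a.c.c)) (N (N (N (L 0).a.b.d.a.c.b (L 0).b.d.a.c 
  e (L 7238).d.a.c.b.a.c) (L 0).d.a.c (L 0).a.b.d.a.c.b.a (N (L 0).a.b.d.a.c.b e (L 7392).a.c.b.a 
  e)) (N (N (N e (L 0).b.b.d.a.c e (L 9567).a.c.b.a.c.d.a.b.d) (L 0).b.d.a.c e (L 
  7392).d.a.c.b.a.c) (N (L 0).b.b.d.a.c.b e (H 9444 (L 7129).d.a).c.b.a.c e) (N e e (H 9548 (N (N 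
  (L 9440).b.a.c.d (H 8471 (L 7129).a.c) e e) e e (L 9324).b.a.c.c.b)) (L 9437).b.a.c.d.a.b) (N 
  (N (L 9424).a.c.b.a.c.d e e (L 0).b.b).a.c.b e (L 8736).d.a.c.b.a.c (L 
  9583).a.c.b.a.c.c.b.d.c.a)) (N (N e (L 0).c.b.d.a.c e (L 9431).a.c.b.a.c.d.a.b.d).a (L 
  0).c.b.d.a.c.b.a (N (N (H 9639 (L 9125).c.b).a.c.d (H 7331 (H 4764 (L 0).c.b).d.a).c e e) (L 
  9638).c.b.a.c.c.b e e) (N (L 0).c.b.d.a.c.b e e (N (L 9392).b.a.c.c.b.d.c (L 9637).b.a.c.c.b e 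
  e))) (N (N (L 0).d.b.d.a.c.b (L 0).b.d.a.c (L 9639).a.c.b.a.c.c.b.b.d.d e) (L 
  7378).d.a.c.b.a.c.c (N (N e (H 4887 (L 0).d.b).d.a.c e (L 9138).a.c.b.a.c.d.a.b.d) e (L 
  8736).a.c.b.a e) (N (L 0).d.b.d.a.c.b e (L 8433).d.a.c.b.a.c e))) (N (N (N (L 0).a.c.d.a.c.b (N 
  (L 9502).c.b.a.c.d e e (L 0).c).a.c e (L 7238).d.a.c.b.a.c) (N e e (H 4887 (N (L 0).d e (L 
  4478).c.b.a.c.c.b.d e)) (L 9461).a.c.b.a.c.c.b.d.c.a) e (L 9618).c.b.a.c.c.b.b) (N (N (N e (L 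
  0).b.c.d.a.c e (L 9607).a.c.b.a.c.d.a.b.d) (L 0).c.d.a.c e (L 7392).d.a.c.b.a.c) (N (N e (L 
  0).b.c.d.a.c e (L 9645).c.b.a.c.c.b.b) e (H 9434 (L 7129).d.a).c.b.a.c e) e (N (N (H 9613 (H 
  9555 (L 9440).a.c).b.a).c.d e e (L 0).b.c).a.c.b e (L 8736).d.a.c.b.a.c (L 
  9623).a.c.b.a.c.c.b.d.c.a)) (N (N (N e (N (L 9165).a.c.b.a.c.d e e (L 0).c.c).a.c e (L 
  9405).a.c.b.a.c.d.a.b.d) (N (H 4764 (L 0).c.d) e (L 9572).a.c.b.a.c.c.b.d (L 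
  9262).a.c.b.a.c.d.a.b).c e e) (N (L 0).c.c.d.a.c.b (N e e (L 9627).a.c.b.a.c.c.d.b (L 
  9606).a.c.b.a.c.c.b.b).a e (L 9360).c.c) (N (L 9621).c.b.a.c.d (H 4764 (L 0).c.c).d.a.c e e).a 
  (N (L 0).c.c.d.a.c.b (L 9439).a.c.b.a.c.d.a.a.c.c e (L 9413).a.c.b.a.c.c.b.d.c.a)) (N (N (L 
  0).d.c.d.a.c.b (L 0).c.d.a.c e e) (N (L 0).d.c.d.a.c.b (L 9469).a.c.b.a.c.c.b.b.d.a (L 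
  7378).d.a.c.b.a.c e) e (N (L 0).d.c.d.a.c.b e (L 8433).d.a.c.b.a.c e))) (N (N (N (L 
  0).a.d.d.a.c.b (N (L 9639).c.b.a.c.d e e (L 0).d).a.c e (L 7238).d.a.c.b.a.c) (N e (N e e (N (L 
  9534).a.c.b.a.c.d.a e e (L 9428).a.c.b.a.c.c.b) (L 9624).a.c.b.a.c.d.a.b).c (L 0).d.a e) (N (L 
  0).a.d.d.a.c.b (L 9441).a.c.b.a.c.c.b.b.d.a e (N e (L 9110).c.b.a.c.c e (L 
  9644).c.b.a.c.c.b.b)) e) (N (N (L 0).b.d.d.a.c.b (L 0).d.d.a.c e (H 9073 (L 7358).c.b).a.c) (N 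
  (N e (L 0).b.d.d.a.c e (H 9620 (L 9132).c.b).a.c.c.b.b) e (N e e (N (H 9299 (N (L 
  9151).c.b.a.c.d (H 8313 (L 7129).d.a).c e e)) e e (H 9602 (L 9389).c.b).a.c.c.b) (H 9539 (L 
  9414).c.b).a.c.d.a.b) e) (L 7378).a.c.b.a.c (N (L 0).b.d.d.a.c.b e (L 8736).d.a.c.b.a.c e)) (N 
  (N (N (L 9502).a.c.b.a.c.d e e (L 0).c.d).a.c.b (N (H 4887 (L 0).d.d) e (L 
  9265).a.c.b.a.c.c.b.d (N (L 9581).a.c.b.a.c.d e e (L 9621).a.c.b.a.c.d).b).c e (L 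
  9451).c.b.a.c.d.a.b.d) (N (L 0).c.d.d.a.c.b (L 9645).a.c.b.a.c.c.b.b.d.a e e) (N (L 
  9361).c.b.a.c.d (H 8375 (H 4764 (L 0).c.d).d.a).c e e).a (N (L 0).c.d.d.a.c.b e e (L 
  8780).d.a.c.b.a.c)) (N (N (N (L 9639).a.c.b.a.c.d e e (L 0).d.d).a.c.b (L 0).d.d.a.c (L 
  9644).a.c.b.a.c.c.b.b.d.d e) (N (L 0).d.d.d.a.c.b (N (L 9132).a.c.b.a.c.c.b.b.d e (N e e (N (N 
  (L 9505).a.c.b.a.c.d (L 9631) e e) e e (L 9389).a.c.b.a.c.c.b) (L 9414).a.c.b.a.c.d.a.b) e) (L 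
  7378).d.a.c.b.a.c e) (N (N e (H 4887 (L 0).d.d).d.a.c e (L 9451).a.c.b.a.c.d.a.b.d) e (L 
  8433).a.c.b.a e) (L 8433).d.a.c.b.a.c.c)))) (N (N (N (N (N e (L 7810).a.b.c.b.a (L 
  7238).a.b.c.b.a e).d (N e (N e e (N (L 9513).b.c.b.a.c.d.a e e (L 9388).b.c.b.a.c.c.b) (L 
  9584).b.c.b.a.c.d.a.b).c (L 0).a.b (L 9142).b.c.b.a.c.c.b.d.c.a) (N (L 0).a.a.a.b.c.b (L 
  9423).b.c.b.a.c.c.b.b.d.a e e) (N (L 0).a.a.a.b.c.b (L 7810).b.c.b.a (L 7238).b.c.b.a e)) (N (N 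
  e e (L 7401).a.b.c.b.a.a (N (L 7401).a.b.c.b.a e (L 7392).a.b.c.b.a e)) (N (H 4864 (L 
  0).b.a).a.b.c.b e (N (H 9205 (L 7401).a.b).c.b.a e (N (N (L 9513).c.b.a.c.d (H 8933 (L 
  7129).a.b).c e e) e e (L 9388).c.b.a.c.c.b) (L 9584).c.b.a.c.d.a.b) e) (N (L 9165).c.b.a.c.d.a 
  (L 0) (L 9586).a.b.c.b.a.a e) (N (N e (L 0).b.a.a.b.c (N (L 9550).c.b.a e (L 9142).c.b.a 
  e).c.b.d e) e (L 8736).a.b.c.b.a.c e)) (N (N (L 0).c.a.a.b.c.b (L 0).a.a.b.c e (L 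
  7873).a.b.c.b.a.b) (N e (L 0).c.a.a.b.c e (L 9423).c.b.a.c.c.b.b).a (N (H 4764 (L 
  0).c.a).a.b.c.b (L 8534).a.b.c.b.a.b e (L 9535).c.b.a.c.c.b) (N (L 0).c.a.a.b.c.b (N e (L 
  8837).a.b.c.b.a (L 9429).b.c.b.a.c.d.a.a.c e) e e)) (N (N (L 0).d.a.a.b.c.b (L 0).a.a.b.c e e) 
  (N (H 9055 (N e (H 7761 (H 5360 (L 0).d.a).a.b).c (L 8822).a.b.b e)) (N e e (N (L 
  9544).b.c.b.a.c.d.a e e (L 9428).b.c.b.a.c.c.b) (L 9437).b.c.b.a.c.d.a.b).c (N e e (L 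
  7378).a.b.c.b.a (L 9637).b.c.b.a.c.c.b.b.d) e) (N (H 9164 (H 7193 (H 4887 (L 0).d.a).a.b).c.b) 
  (L 8837).a.b.c.b.a.b e e) (N (L 0).d.a.a.b.c.b (N (H 9560 (L 9093).c.b).a.c.d (N (L 
  8534).a.b.c.b e (L 9288).c.b.a.c e) e e) (L 8433).a.b.c.b.a.c e))) (N (N (N e (L 
  7810).a.b.c.b.a (L 7238).a.b.c.b.a e).d e e (L 7392).b.c.b.a.c) (N (N (N e (L 0).b.b.a.b.c e (L 
  9567).b.c.b.a.c.d.a.b.d) e e (L 7392).a.b.c.b.a.c) (N (H 4864 (L 0).b.b).a.b.c.b e (H 9444 (L 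
  7129).a.b).c.b.a.c e) (N (L 0).b.b.a.b.c.b e (L 7129).b.c.b.a e) (N (N (L 9424).b.c.b.a.c.d.a 
  (L 0).b.b.a e e).c.b e (L 8736).a.b.c.b.a.c (L 9583).b.c.b.a.c.c.b.d.c.a)) (L 0) (N (N (L 
  0).d.b.a.b.c.b (L 0).b.a.b.c (L 9639).b.c.b.a.c.c.b.b.d.d e) (N (H 5360 (L 0).d.b).a.b.c.b e (L 
  7378).a.b.c.b.a.c e) (N (N e (H 4887 (L 0).d.b).a.b.c e (L 9138).b.c.b.a.c.d.a.b.d) (L 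
  8837).a.b.c.b.a.b (L 8736).b.c.b.a e) (N (L 0).d.b.a.b.c.b (N (L 8534).a.b.c.b e (L 
  9625).c.b.a.c e).b (L 8433).a.b.c.b.a.c e))) (N (N (N (L 0).a.c.a.b.c.b (L 0).c.a.b.c e (N e (L 
  7810).a.b.c.b.a (L 7238).a.b.c.b.a e)) (N e e (L 0).a.b (L 9461).b.c.b.a.c.c.b.d.c.a) e (N (L 
  0).a.c.a.b.c.b (L 7873).b.c.b.a e e)) (N (N (L 9607).b.c.b.a.c.d.a.b.d.d e e (L 
  7392).a.b.c.b.a.c) (N (H 4864 (L 0).b.c).a.b.c.b e (H 9434 (L 7129).a.b).c.b.a.c e) (L 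
  0).b.c.a.b.c.b.a (N (N (L 9440).b.c.b.a.c.d.a (L 0).b.c.a e e).c.b e (L 8736).a.b.c.b.a.c (L 
  9623).b.c.b.a.c.c.b.d.c.a)) (N (N (N e (N (L 9165).b.c.b.a.c.d.a (L 0).c.c.a e e).c e (N e e (L 
  9616).b.a (L 9405).b.c.b.a.c.d.a.b)) (N e (H 4764 (L 0).c.a) (L 9572).b.c.b.a.c.c.b.d (L 
  9262).b.c.b.a.c.d.a.b).c e (L 7873).a.b.c.b.a.b) (N (L 0).c.c.a.b.c.b (N e (L 8534).b.c e (L 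
  9606).b.c.b.a.c.c.b.b).a e e) (N (H 4764 (L 0).c.c).a.b.c.b (L 8534).a.b.c.b.a.b e e) (N (L 
  0).c.c.a.b.c.b (N e (L 8837).a.b.c.b.a (N (L 9439).b.c.b.a.c.d (L 9613) e e).a.c e) e (H 9627 
  (L 9413).b.c).b.a.c.c.b.d.c.a)) (N (N (L 0).d.c.a.b.c.b (L 0).c.a.b.c e e) (N (H 5360 (L 
  0).d.c).a.b.c.b (N e (L 8837).b.c e (L 9469).b.c.b.a.c.c.b.b).a (N (L 9429).c.b.a.c.d (L 
  7344).c e e).a.c e) (N (H 4887 (L 0).d.c).a.b.c.b (L 8837).a.b.c.b.a.b e e) (N (L 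
  0).d.c.a.b.c.b (N (L 9506).c.b.a.c.d (N (L 8534).a.b.c.b e (L 9330).c.b.a.c e) e e) (L 
  8433).a.b.c.b.a.c e))) (N (N (N (L 0).a.d.a.b.c.b (L 0).d.a.b.c e (N e (L 7810).a.b.c.b.a (L 
  7238).a.b.c.b.a e)) (N e (N e e (N (L 9534).b.c.b.a.c.d.a e e (L 9428).b.c.b.a.c.c.b) (L 
  9624).b.c.b.a.c.d.a.b).c (L 0).a.b e) (N (L 0).a.d.a.b.c.b (L 9441).b.c.b.a.c.c.b.b.d.a e e) e) 
  (N (N (L 0).b.d.a.b.c.b (H 5360 (L 0).d.a).b.c e (L 7392).a.b.c.b.a.c) (N (H 4864 (L 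
  0).b.d).a.b.c.b e (H 9618 (N e e (N (H 9055 (N (L 8944).c.b.a.c.d (H 8471 (L 7129).a.b).c e e)) 
  e e (H 9506 (L 9394).c.b).a.c.c.b) (L 9357).a.c.d.a.b)) e) (N (L 0).b.d.a.b.c.b (L 
  9616).b.c.b.a.c.c.b.b.d.a (L 7378).b.c.b.a (L 9590).a.c.c.b.b.d) (N (L 0).b.d.a.b.c.b e (L 
  8736).a.b.c.b.a.c e)) (N (N (N (L 9456).b.a.c.d.a (L 0).c.d.a e e).c.b (H 7346 (N e (H 4887 (L 
  0).d.a) (H 7237 (L 6947).b.c).b.a.c.c.b.d e).c) e (L 7873).a.b.c.b.a.b) (N (L 0).c.d.a.b.c.b (N 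
  e (L 8837).b.c e (L 9645).b.c.b.a.c.c.b.b).a e e) (N (H 4764 (L 0).c.d).a.b.c.b (L 
  8534).a.b.c.b.a.b e e) (N (L 0).c.d.a.b.c.b (L 8837).a.b.c.b.a.b e e)) (N (N (N (L 
  9639).b.c.b.a.c.d.a (L 0).d.d.a e e).c.b (L 0).d.a.b.c (L 9644).b.c.b.a.c.c.b.b.d.d e) (N (H 
  5360 (L 0).d.d).a.b.c.b (N (N e (L 8534).b.c e (L 9132).b.c.b.a.c.c.b.b) e (N e e (N (L 
  9505).b.c.b.a.c.d.a e e (L 9389).b.c.b.a.c.c.b) (L 9414).b.c.b.a.c.d.a.b) e) (L 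
  7378).a.b.c.b.a.c e) (N (N e (H 4887 (L 0).d.d).a.b.c e (H 9575 (L 9451).b.c).b.a.c.d.a.b.d) (L 
  8837).a.b.c.b.a.b (L 8433).b.c.b.a e) (N (L 0).d.d.a.b.c.b (N (L 8534).a.b.c.b e (L 
  9631).c.b.a.c e).b (L 8433).a.b.c.b.a.c e)))) (N (N (N (N e (L 0).a.b.b.c e (L 
  7238).b.b.c.b.a.c) (N e (N e e (N (L 9513).b.c.b.a.c.d.a e e (L 9388).b.c.b.a.c.c.b) (L 
  9584).b.c.b.a.c.d.a.b).c (L 0).b.b (L 9142).b.c.b.a.c.c.b.d.c.a) (N (L 0).a.a.b.b.c.b (H 9530 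
  (L 9423).b.c).b.a.c.c.b.b.d.a e e) (N (L 0).a.a.b.b.c.b e (H 9041 (L 7238).b.c).b.a (L 
  9567).b.a.c.d.a.b)) (N (L 7392).b.b.c.b.a.c.d (N e (L 7362).b.b.c.b.a (L 7129).b.b.c.b.a e).c 
  (N e (L 0) e (L 9507).b.c.b.a.b.c.a.a.b.b) (N (L 0).b.a.b.b.c.b e (N e (L 
  9507).b.c.b.a.b.d.a.a.b (L 8736).b.b.c.b.a e) e)) (N (N (L 0).c.a.b.b.c.b (L 0).a.b.b.c e e) (L 
  0).c.a.b.b.c.b.a (N (N (L 9616).c.b.a.c.d (H 4764 (L 0).c.a).b.b.c e e) e e (L 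
  9613).c.b.a.c.c.b) (N (L 0).c.a.b.b.c.b (L 9429).b.c.b.a.c.d.a.a.c.c e e)) (N (N (L 
  0).d.a.b.b.c.b (L 0).a.b.b.c e e) (N (L 0).d.a.b.b.c.b (N e e (N (N (L 9544).b.c.b.a.c.d (L 
  9132) e e) e e (H 9541 (L 9428).b.c).b.a.c.c.b) (H 9549 (L 9437).b.c).b.a.c.d.a.b).c (N e e (L 
  7378).b.b.c.b.a (L 9590).b.a.c.c.b.b.d) e) (H 7346 (H 4887 (L 0).d.a).b.b).c.b.a (N (L 
  0).d.a.b.b.c.b e (L 8433).b.b.c.b.a.c e))) (N (N (N (L 0).a.b.b.b.c.b (L 0).b.b.b.c e (N e e (H 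
  9041 (L 7238).b.b).c.b.a (L 9567).c.b.a.c.d.a.b)) (L 0).b.b.c (L 0).a.b.b.b.c.b.a (N (L 
  0).a.b.b.b.c.b (L 9132).c.b.a.c.c.b (L 7392).b.c.b.a e)) (N (N (L 9567).b.c.b.a.c.d.a.b.d.d e e 
  (L 7392).b.b.c.b.a.c) (L 7129).b.b.c.b.a.c.c (L 7129).b.c.b.a.c (N (L 9424).b.c.b.a.c.d.a.a.c.b 
  e (L 8736).b.b.c.b.a.c (L 9583).b.c.b.a.c.c.b.d.c.a)) (N (N (N e (L 0).c.b.b.b.c e (L 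
  9431).b.c.b.a.c.d.a.b.d) (L 0).b.b.b.c e e) (L 0).c.b.b.b.c.b.a (N (H 9576 (N (H 9566 (L 
  8964).c.b).a.c.d (H 7084 (H 4764 (L 0).c.b).b.b).c e e)) e e (L 8600).c.b.a.c.c.b) (N (L 
  0).c.b.b.b.c.b (L 8633).c.b.a.c.d.a e (L 9438).b.c.b.a.c.c.b.d.c.a)) (N (N (L 0).d.b.b.b.c.b (N 
  (L 9424).c.b.a.c.d.a (L 0).b.b e e).c (L 9639).b.c.b.a.c.c.b.b.d.d e) (N (L 0).d.b.b.b.c.b e (L 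
  7378).b.b.c.b.a.c e) (N (N e (H 4887 (L 0).d.b).b.b.c e (L 9138).b.c.b.a.c.d.a.b.d) e (L 
  8736).b.c.b.a e) (N (N e (L 0).d.b.b.b.c (L 9583).c.b.a.c.c.b.d e) (L 9623).c.b.a.c.c.b (L 
  8433).b.b.c.b.a.c e))) (N (N (N (L 0).a.c.b.b.c.b (L 0).c.b.b.c e (N e e (H 8506 (L 
  7238).b.b).c.b.a (L 9431).c.b.a.c.d.a.b)) (N e e (L 0).b.b (L 9415).b.a.c.c.b.d.c.a) e (N (L 
  0).a.c.b.b.c.b (L 9618).c.b.a.c.c.b e e)) (N (N (L 9607).b.c.b.a.c.d.a.b.d.d e e (L 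
  7392).b.b.c.b.a.c) (L 7129).b.b.c.b.a.c.c e (N (L 9440).b.c.b.a.c.d.a.a.c.b e (L 
  8736).b.b.c.b.a.c (L 9623).b.c.b.a.c.c.b.d.c.a)) (N (N (N e (N (H 9519 (L 9165).b.c).b.a.c.d.a 
  (L 0).c.c.b e e).c e (N e e (L 9040).b.a (H 9518 (L 9405).b.c).b.a.c.d.a.b)) (H 7084 (N e (H 
  4764 (L 0).c.b) (L 4764).b.a.c.c.b.d (H 6963 (L 6682).b.c).b.a.c.d.a.b).c) e e) (N (L 
  0).c.c.b.b.c.b (L 9606).b.c.b.a.c.c.b.b.d.a e e) (N (L 9621).c.b.a.c.d (H 4764 (L 0).c.c).b.b.c 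
  e e).a (N (L 0).c.c.b.b.c.b (N (L 9394).b.a.c.d (L 8600) e e).a.c.c e (H 9518 (L 
  9413).b.c).b.a.c.c.b.d.c.a)) (N (N (L 0).d.c.b.b.c.b (L 0).c.b.b.c e e) (N (N e (L 0).d.c.b.b.c 
  e (N e e (L 8633).b.a (L 9628).b.a.c.c.b.b)) (H 9574 (L 9469).b.c).b.a.c.c.b.b.d.a (L 
  7378).b.b.c.b.a.c e) (H 4887 (L 0).d.c).b.b.c.b.a (N (N e (L 0).d.c.b.b.c (L 
  9438).c.b.a.c.c.b.d e) (L 9637).c.b.a.c.c.b (L 8433).b.b.c.b.a.c e))) (N (N (N (L 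
  0).a.d.b.b.c.b (L 0).d.b.b.c e (L 7238).b.b.c.b.a.c) (N e (N e e (N (H 9646 (L 
  9534).b.c).b.a.c.d.a e e (H 9541 (L 9428).b.c).b.a.c.c.b) (L 9624).b.c.b.a.c.d.a.b).c (N (L 
  9424).b.a.c.d.a (L 0).b e e) e) (N (L 0).a.d.b.b.c.b (L 9441).b.c.b.a.c.c.b.b.d.a e (N e (L 
  9142).c.b.a.c.c e (L 9639).c.b.a.c.c.b.b)) e) (N (N (L 0).b.d.b.b.c.b (L 0).d.b.b.c e (L 
  7392).b.b.c.b.a.c) (N (L 0).b.d.b.b.c.b e (L 7129).b.b.c.b.a.c e) (N (L 0).b.d.b.b.c.b e (L 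
  7378).b.c.b.a e) (L 8736).b.b.c.b.a.c.c) (N (N (N (L 9502).b.c.b.a.c.d.a (L 0).c.d.b e e).c.b 
  (N e (H 4887 (L 0).d.b) (L 9265).b.c.b.a.c.c.b.d (L 9581).b.c.b.a.c.d.a.b).c e (L 
  9138).c.b.a.c.d.a.b.d) (N (L 0).c.d.b.b.c.b (L 9645).b.c.b.a.c.c.b.b.d.a e e) (N (L 
  9439).c.b.a.c.d (H 8676 (H 4764 (L 0).c.d).b.b).c e e).a (L 0).c.d.b.b.c.b.a) (N (N (N (L 
  9639).b.c.b.a.c.d.a (L 0).d.d.b e e).c.b (L 0).d.b.b.c (N e (L 9583).b.a.c.c e (L 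
  9644).b.c.b.a.c.c.b.b).d e) (N (L 0).d.d.b.b.c.b (N (L 9132).b.c.b.a.c.c.b.b.d e (N e e (N (N 
  (L 9505).b.c.b.a.c.d (L 9623) e e) e e (L 9389).b.c.b.a.c.c.b) (L 9414).b.c.b.a.c.d.a.b) e) (L 
  7378).b.b.c.b.a.c e) (N (N e (H 4887 (L 0).d.d).b.b.c e (H 9645 (L 9451).b.c).b.a.c.d.a.b.d) e 
  (L 8433).b.c.b.a e) (N (L 0).d.d.b.b.c.b (L 9633).c.b.a.c.c.b (L 8433).b.b.c.b.a.c e)))) (N (N 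
  (N (L 7238).c.b.c.b.a.c.d (N e (N e e (N (L 9513).b.c.b.a.c.d.a e e (H 9642 (L 
  9388).b.c).b.a.c.c.b) (L 9584).b.c.b.a.c.d.a.b).c e (L 9142).b.c.b.a.c.c.b.d.c.a) (L 
  9423).b.c.b.a.c.c.b.b.d.a.b (N e e (H 8506 (L 7238).b.c).b.a (L 9431).b.a.c.d.a.b)) (N (L 
  7392).c.b.c.b.a.c.d (L 7129).c.b.c.b.a.c.c e (N (L 9461).c.b.a.c.c.b.d.c e (L 8736).c.b.c.b.a.c 
  e)) (L 9429).b.c.b.a.c.d.a.a.c.c.b.d (N e (N e (N e e (N (N (L 9544).b.c.b.a.c.d (L 9618) e e) 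
  e e (L 9428).b.c.b.a.c.c.b) (L 9437).b.c.b.a.c.d.a.b).c (N e e (L 7378).c.b.c.b.a (L 
  9637).b.c.b.a.c.c.b.b.d) e) e (N e (N (L 9138).c.b.a.c.d (L 9366).c.b.a.c.c e e) (L 
  8433).c.b.c.b.a.c e))) (N (N (N e e (H 9195 (L 7238).c.b).c.b.a (L 9607).c.b.a.c.d.a.b).d e e 
  (N e (L 9120).c.b.a.c.c.b (L 7392).b.c.b.a e)) (N (N (L 9567).b.c.b.a.c.d.a.b.d.d e e (L 
  7392).c.b.c.b.a.c) (H 9611 (L 7129).c.b).c.b.a.c.c (L 7129).b.c.b.a.c (N (L 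
  9424).b.c.b.a.c.d.a.a.c.b e (L 8736).c.b.c.b.a.c (L 9583).b.c.b.a.c.c.b.d.c.a)) (N (L 
  9431).b.c.b.a.c.d.a.b.d.d.a e e (L 9438).b.c.b.a.c.c.b.d.c.a.d) (N (N e (L 
  9440).c.b.a.c.d.a.a.c (L 9639).b.c.b.a.c.c.b.b.d.d e) (L 7378).c.b.c.b.a.c.c (N (L 
  9138).b.c.b.a.c.d.a.b.d.d e (L 8736).b.c.b.a e) (N (L 9623).c.b.a.c.c.b.d.c (L 
  9625).c.b.a.c.c.b (L 8433).c.b.c.b.a.c e))) (N (N (N e (L 9165).c.b.a.c.d.a.a.c e (N e e (H 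
  8385 (L 7238).c.b).c.b.a (L 9405).c.b.a.c.d.a.b)) (N e e (N e e (L 9572).c.b.a.c.c.b.d (L 
  9262).c.b.a.c.d.a.b) (L 9461).b.c.b.a.c.c.b.d.c.a) e e) (N (N (L 9607).b.c.b.a.c.d.a.b.d.d e e 
  (L 7392).c.b.c.b.a.c) (N (L 9606).c.b.a.c.c.b.b.d e (H 9591 (L 7129).c.b).c.b.a.c e) e (N (L 
  9440).b.c.b.a.c.d.a.a.c.b e (L 8736).c.b.c.b.a.c (L 9623).b.c.b.a.c.c.b.d.c.a)) (N (N (N e (L 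
  9165).b.c.b.a.c.d.a.a.c e (N e e (L 9621).b.a (L 9405).b.c.b.a.c.d.a.b)) (N e e (L 
  9572).b.c.b.a.c.c.b.d (L 9262).b.c.b.a.c.d.a.b).c e e) (L 9606).b.c.b.a.c.c.b.b.d.a.b e (N e (L 
  9439).b.c.b.a.c.d.a.a.c.c e (L 9413).b.c.b.a.c.c.b.d.c.a)) (N e (N e (L 
  9469).b.c.b.a.c.c.b.b.d.a (N (L 9439).c.b.a.c.d (H 8558 (L 7378).c.b).c e e).a.c e) e (N (L 
  9413).c.b.a.c.c.b.d.c (N (L 9428).c.b.a.c.d (L 9287).c.b.a.c.c e e) (L 8433).c.b.c.b.a.c e))) 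
  (N (N (L 7238).c.b.c.b.a.c.d (N e e (N (L 9534).b.c.b.a.c.d.a e e (L 9428).b.c.b.a.c.c.b) (L 
  9624).b.c.b.a.c.d.a.b).c.b (H 9556 (L 9441).b.c).b.a.c.c.b.b.d.a.b e) (N (H 8592 (L 
  7392).c.b).c.b.a.c.d (N (L 9469).c.b.a.c.c.b.b.d e (L 7129).c.b.c.b.a.c e) (L 7378).b.c.b.a.c 
  (L 8736).c.b.c.b.a.c.c) (N (N (L 9502).b.c.b.a.c.d.a.a.c.b (N e e (L 9265).b.c.b.a.c.c.b.d (L 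
  9581).b.c.b.a.c.d.a.b).c e e) (L 9645).b.c.b.a.c.c.b.b.d.a.b e e) (N (N (L 
  9639).b.c.b.a.c.d.a.a.c.b e (N e (L 9438).b.a.c.c e (L 9644).b.c.b.a.c.c.b.b).d e) (N e (N (L 
  9132).b.c.b.a.c.c.b.b.d e (N e e (N (N (L 9505).b.c.b.a.c.d (L 9637) e e) e e (H 9619 (L 
  9389).b.c).b.a.c.c.b) (L 9414).b.c.b.a.c.d.a.b) e) (L 7378).c.b.c.b.a.c e) (N (L 
  9451).b.c.b.a.c.d.a.b.d.d e (L 8433).b.c.b.a e) (N e (L 9631).c.b.a.c.c.b (L 8433).c.b.c.b.a.c 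
  e)))) (N (N (N (N e (L 0).a.d.b.c e (L 7238).d.b.c.b.a.c) (N e (N e e (N (L 9513).b.c.b.a.c.d.a 
  e e (L 9388).b.c.b.a.c.c.b) (L 9584).b.c.b.a.c.d.a.b).c (L 0).d.b (L 9142).b.c.b.a.c.c.b.d.c.a) 
  (N (L 0).a.a.d.b.c.b (H 9636 (L 9423).b.c).b.a.c.c.b.b.d.a e e) (N (L 0).a.a.d.b.c.b e (L 
  7238).b.c.b.a e)) (N (N (L 0).b.a.d.b.c.b e (L 7873).d.b.c.b.a.d (L 7392).d.b.c.b.a.c) (N (L 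
  0).b.a.d.b.c.b e (N e e (N (N (H 9644 (L 9534).c.b).a.c.d (H 9086 (L 7129).d.b).c e e) e e (H 
  9538 (L 9428).c.b).a.c.c.b) (N (L 7861).d.b.c.b (L 9624).c.b.a.c.d.a e e)) (L 
  8534).d.b.c.b.a.d) (N (H 9394 (L 8547).c.b).a.c.d.a (L 0) e (L 8837).d.b.c.b.a.d) (L 
  8736).d.b.c.b.a.c.c) (N (N (L 0).c.a.d.b.c.b (L 0).a.d.b.c e e) (N e (L 0).c.a.d.b.c e (L 
  9441).c.b.a.c.c.b.b).a (N (L 9616).c.b.a.c.d (H 4764 (L 0).c.a).d.b.c e e).a (N (L 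
  0).c.a.d.b.c.b (N (H 9545 (L 9429).b.c).b.a.c.d (L 9142) e e).a.c.c e (L 9639).b.a.c.c.b.b)) (N 
  e (N (L 0).d.a.d.b.c.b (N e e (N (L 9544).b.c.b.a.c.d.a e e (L 9428).b.c.b.a.c.c.b) (L 
  9437).b.c.b.a.c.d.a.b).c (N e e (L 7378).d.b.c.b.a (L 9637).b.c.b.a.c.c.b.b.d) e) (H 4887 (L 
  0).d.a).d.b.c.b.a (N (L 0).d.a.d.b.c.b e (L 8433).d.b.c.b.a.c e))) (N (N (N (L 0).a.b.d.b.c.b 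
  (L 0).b.d.b.c e (L 7238).d.b.c.b.a.c) (L 0).d.b.c (L 0).a.b.d.b.c.b.a (N (L 0).a.b.d.b.c.b e (L 
  7392).b.c.b.a e)) (N (N (N e (L 0).b.b.d.b.c e (L 9567).b.c.b.a.c.d.a.b.d) (L 0).b.d.b.c e (L 
  7392).d.b.c.b.a.c) (N (L 0).b.b.d.b.c.b e (H 9444 (L 7129).d.b).c.b.a.c e) (N (L 0).b.b.d.b.c.b 
  e (L 7129).b.c.b.a e) (N (N (L 9424).b.c.b.a.c.d.a (L 0).b.b.d e e).c.b e (L 8736).d.b.c.b.a.c 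
  (L 9583).b.c.b.a.c.c.b.d.c.a)) (N (N (N e (L 0).c.b.d.b.c e (L 9431).b.c.b.a.c.d.a.b.d) (L 
  0).b.d.b.c e e) (L 0).c.b.d.b.c.b.a (N (N (L 9125).c.b.a.c.d (H 7331 (H 4764 (L 0).c.b).d.b).c 
  e e) (L 9638).c.b.a.c.c.b e e) (N (L 0).c.b.d.b.c.b e e (L 9438).b.c.b.a.c.c.b.d.c.a)) (N (L 
  9639).b.c.b.a.c.c.b.b.d.d.c (L 7378).d.b.c.b.a.c.c (N (L 9138).b.c.b.a.c.d.a.b.d.d e (L 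
  8736).b.c.b.a e) (L 8433).d.b.c.b.a.c.c)) (N (N (N (L 0).a.c.d.b.c.b (N (L 9502).c.b.a.c.d.a (L 
  0).c.d e e).c e (L 7238).d.b.c.b.a.c) (N e e (H 4887 (N e (L 0).d (L 4478).c.b.a.c.c.b.d e)) (N 
  (L 9461).b.c.b.a.c.c.b.d.c e (L 7639).d.b.c.b.a e)) e (N (L 0).a.c.d.b.c.b (L 9618).c.b.a.c.c.b 
  e (L 9138).b.a.c.d.a.b)) (N (N (N e (L 0).b.c.d.b.c e (L 9607).b.c.b.a.c.d.a.b.d) (L 0).c.d.b.c 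
  e (L 7392).d.b.c.b.a.c) (N (N e (L 0).b.c.d.b.c e (L 9645).c.b.a.c.c.b.b) e (H 9434 (L 
  7129).d.b).c.b.a.c e) (L 0).b.c.d.b.c.b.a (N (L 9440).b.c.b.a.c.d.a.a.c.b e (L 
  8736).d.b.c.b.a.c (L 9623).b.c.b.a.c.c.b.d.c.a)) (N (N (N e (N (H 9539 (L 9165).b.c).b.a.c.d.a 
  (L 0).c.c.d e e).c e (N e e (L 9439).b.a (H 9608 (L 9405).b.c).b.a.c.d.a.b)) (H 8676 (N e (H 
  4764 (L 0).c.d) e (H 8660 (L 8281).b.c).b.a.c.d.a.b).c) e e) (N (L 0).c.c.d.b.c.b (L 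
  9606).b.c.b.a.c.c.b.b.d.a e e) (N (L 9621).c.b.a.c.d (H 4764 (L 0).c.c).d.b.c e e).a (N (L 
  0).c.c.d.b.c.b (L 9439).b.c.b.a.c.d.a.a.c.c e (L 9413).b.c.b.a.c.c.b.d.c.a)) (N (N (L 
  0).d.c.d.b.c.b (L 0).c.d.b.c e e) (N (L 0).d.c.d.b.c.b (L 9469).b.c.b.a.c.c.b.b.d.a (L 
  7378).d.b.c.b.a.c e) e (N (L 0).d.c.d.b.c.b e (L 8433).d.b.c.b.a.c e))) (N (N (N (L 
  0).a.d.d.b.c.b (N (L 9639).c.b.a.c.d.a (L 0).d.d e e).c e (L 7238).d.b.c.b.a.c) (N e (N e e (N 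
  (L 9534).b.c.b.a.c.d.a e e (L 9428).b.c.b.a.c.c.b) (L 9624).b.c.b.a.c.d.a.b).c (L 0).d.b e) (N 
  (L 0).a.d.d.b.c.b (L 9441).b.c.b.a.c.c.b.b.d.a e (N e (H 9576 (L 9110).c.b).a.c.c e (L 
  9644).c.b.a.c.c.b.b)) e) (N (N (L 0).b.d.d.b.c.b (L 0).d.d.b.c e (L 7358).c.b.a.c) (N (N e (L 
  0).b.d.d.b.c e (L 9132).c.b.a.c.c.b.b) e (N e e (N (H 9555 (N (L 9408).c.b.a.c.d (H 8313 (L 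
  7129).d.b).c e e)) e e (L 9389).c.b.a.c.c.b) (L 9414).c.b.a.c.d.a.b) e) (N (L 0).b.d.d.b.c.b e 
  (L 7378).b.c.b.a e) (N (L 0).b.d.d.b.c.b e (L 8736).d.b.c.b.a.c e)) (N (N (N (L 
  9502).b.c.b.a.c.d.a (L 0).c.d.d e e).c.b (N e (H 4887 (L 0).d.d) (L 9265).b.c.b.a.c.c.b.d (L 
  9581).b.c.b.a.c.d.a.b).c e (L 9451).c.b.a.c.d.a.b.d) (N (L 0).c.d.d.b.c.b (L 
  9645).b.c.b.a.c.c.b.b.d.a e e) (N (L 9361).c.b.a.c.d (H 8375 (H 4764 (L 0).c.d).d.b).c e e).a 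
  (L 0).c.d.d.b.c.b.a) (N (N (N (L 9639).b.c.b.a.c.d.a (L 0).d.d.d e e).c.b (L 0).d.d.b.c (L 
  9644).b.c.b.a.c.c.b.b.d.d e) (N (L 0).d.d.d.b.c.b (N (L 9132).b.c.b.a.c.c.b.b.d e (N e e (N (N 
  (L 9505).b.c.b.a.c.d (L 9633) e e) e e (L 9389).b.c.b.a.c.c.b) (L 9414).b.c.b.a.c.d.a.b) e) (L 
  7378).d.b.c.b.a.c e) (N (N e (H 4887 (L 0).d.d).d.b.c e (L 9451).b.c.b.a.c.d.a.b.d) e (L 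
  8433).b.c.b.a e) (L 8433).d.b.c.b.a.c.c)))) (N (H 4764 (N (N (N (L 0).a.c.c.b.a.c.d (N e (N e e 
  (L 4601).c.c.b.a.c.d.a.a (L 4674).c.c.b.a.c.d.a.b).c (L 0).a.c e) (L 0).a.a.a.c.c.b.a (N (L 
  0).a.a.a.c.c.b e (L 0).c.c.b.a e)) (N (L 0).a.c.c.b.a.c.d (N (L 0).b.a.a.c.c.b e (N e e (L 
  4601).c.b.a.c.d.a.a (L 4674).c.b.a.c.d.a.b) e) (N (L 0).a.c.d.a e (L 0) e) (L 0).b.a.a.c.c.b.a) 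
  (N (L 0).a.a.c.c.b (N (L 0).c.a.a.c.c.b (L 4762).c.c.b.a.c.d.a.a.c.c e e) (L 0).c.a.a.c.c.b.a 
  (N (L 0).c.a.a.c.c.b (L 4519).c.c.b.a.c.d.a.a.c.c e e)) (N (N (L 0).d.a.a.c.c.b (L 0).a.a.c.c e 
  e) (N (L 0).d.a.a.c.c.b (N e e (L 4631).c.c.b.a.c.d.a.a (L 4524).c.c.b.a.c.d.a.b).c e e) (L 
  0).a (N (L 0).d.a.a.c.c.b (H 4472 (L 0).c.b).a.c.d.a e e))) (N (N (N (L 0).a.b.a.c.c.b (L 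
  0).b.a.c.c e (L 0).a.c.c.b.a.c) e (L 0).a.b.a.c.c.b.a (N (L 0).a.b.a.c.c.b e (L 0).c.c.b.a e)) 
  (N (N (N e (L 0).b.b.a.c.c e (L 4657).c.c.b.a.c.d.a.b.d) (L 0).b.a.c.c e (L 0).a.c.c.b.a.c) (L 
  0).b.b.a.c.c.b.a (N (L 0).b.b.a.c.c.b e (L 4738).b.a.c.d.a.a e) (N (H 4656 (L 
  4513).c.c).b.a.c.d.a e (L 0).b.b.a e).c.b.a) (L 0) (N (N (L 0).d.b.a.c.c.b (L 0).b.a.c.c e e) 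
  (L 0).d.b.a.c.c.b.a (N e (L 0).a.c.c e (L 0).c.c.b.a.c.d.a.b.d).a (L 0).d.b.a.c.c.b.a)) (N (N 
  (L 0).a.c.c.b.a.c.d (L 4738).c.c.b.a.c.d.a.a.c.c.b e e) (N (N (N e (L 0).b.c.a.c.c e (L 
  4696).c.c.b.a.c.d.a.b.d) (L 0).c.a.c.c e (L 0).a.c.c.b.a.c) (N (L 0).b.c.a.c.c.b e (L 
  4762).c.b.a.c.d.a.a.c e) (L 0).b.c.a.c.c.b.a (N (L 4527).c.c.b.a.c.d.a e (L 0).b.c.a e).c.b.a) 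
  (N (N (N e (L 0).c.c.b.a.c.d.a.a.c e (L 4492).c.c.b.a.c.d.a.b.d) (L 0).c.c.b.a.c.d.a.b.d.c e e) 
  (L 0).c.c.a.c.c.b.a (L 0).c.c.a.c.c.b.a (N (L 0).c.c.a.c.c.b (L 4529).c.c.b.a.c.d.a.a.c.c e e)) 
  (N (N (L 0).d.c.a.c.c.b (L 0).c.a.c.c e e) (N (L 0).d.c.a.c.c.b e (L 4519).c.b.a.c.d.a.a.c e) 
  (L 0).a.c.c.b.a (N (L 0).d.c.a.c.c.b (L 4595).c.b.a.c.d.a e e))) (N (N (N (L 0).a.d.a.c.c.b (L 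
  0).d.a.c.c e (L 0).a.c.c.b.a.c) (N e (N e e (L 4582).c.c.b.a.c.d.a.a (L 
  4697).c.c.b.a.c.d.a.b).c (L 0).a.c e) (L 0).a.d.a.c.c.b.a e) (N (N (L 0).b.d.a.c.c.b (L 
  0).d.a.c.c e (L 0).a.c.c.b.a.c) (N (L 0).b.d.a.c.c.b e (N e e (L 4631).c.b.a.c.d.a.a (L 
  4524).c.b.a.c.d.a.b) e) (L 0).b.d.a.c.c.b.a (L 0).b.d.a.c.c.b.a) (N (N (N (L 
  4590).c.c.b.a.c.d.a e (L 0).c.d.a e).c.b (N e e (L 0) (L 4670).c.c.b.a.c.d.a.b).c e e) (N (L 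
  0).c.d.a.c.c.b (L 4762).c.c.b.a.c.d.a.a.c.c e e) (L 0).c.d.a.c.c.b.a (L 0).c.d.a.c.c.b.a) (N (N 
  (N (L 4729).c.c.b.a.c.d.a e (L 0).d.d.a e).c.b (L 0).d.a.c.c e e) (N (N e (L 0).d.d.a.c.c e (L 
  0).b.a.c) (N e e (L 4591).c.c.b.a.c.d.a.a (H 4652 (L 4504).c.c).b.a.c.d.a.b).c e e) (N e (L 
  0).a.c.c e (L 4541).c.c.b.a.c.d.a.b.d).a (L 0).d.d.a.c.c.b.a)))) (N (N (N (N e (L 0).a.b.c.c e 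
  (L 7238).b.c.c.b.a.c) (N e (N e e (N (L 9513).c.c.b.a.c.d.a e e (L 9388).c.c.b.a.c.c.b) (L 
  9584).c.c.b.a.c.d.a.b).c (L 0).b.c (L 9142).c.c.b.a.c.c.b.d.c.a) (N (L 0).a.a.b.c.c.b (L 
  9423).c.c.b.a.c.c.b.b.d.a e e) (N (L 0).a.a.b.c.c.b e (H 9195 (L 7238).c.c).b.a (L 
  9607).b.a.c.d.a.b)) (N (L 7392).b.c.c.b.a.c.d (L 7129).b.c.c.b.a.c.c (L 0).c (N (L 
  0).b.a.b.c.c.b e (L 8736).b.c.c.b.a.c e)) (N (N (L 0).c.a.b.c.c.b (L 0).a.b.c.c e e) e (N (N (L 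
  9616).c.b.a.c.d (H 4764 (L 0).c.a).b.c.c e e) e e (L 9613).c.b.a.c.c.b) (N (L 0).c.a.b.c.c.b (L 
  9429).c.c.b.a.c.d.a.a.c.c e e)) (N (N (L 0).d.a.b.c.c.b (L 0).a.b.c.c e e) (N (L 0).d.a.b.c.c.b 
  (N e e (N (N (L 9544).c.c.b.a.c.d (L 9120) e e) e e (H 9539 (L 9428).c.c).b.a.c.c.b) (L 
  9391).b.a.c.d.a.b).c (N e e (L 7378).b.c.c.b.a (L 9590).b.a.c.c.b.b.d) e) (H 7346 (H 4887 (L 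
  0).d.a).b.c).c.b.a (N (L 0).d.a.b.c.c.b e (L 8433).b.c.c.b.a.c e))) (N (N (N (L 0).a.b.b.c.c.b 
  (L 0).b.b.c.c e (N e e (H 9041 (L 7238).b.c).c.b.a (L 9567).c.b.a.c.d.a.b)) (L 0).b.c.c (L 
  0).a.b.b.c.c.b.a (N (L 0).a.b.b.c.c.b (H 9559 (L 9132).c.b).a.c.c.b (L 7392).c.c.b.a e)) (N (N 
  (N e (L 0).b.b.b.c.c e (L 9567).c.c.b.a.c.d.a.b.d) (L 0).b.b.c.c e (L 7392).b.c.c.b.a.c) (L 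
  7129).b.c.c.b.a.c.c (N (L 0).b.b.b.c.c.b e (H 9611 (L 7129).c.c).b.a e) (N (N (L 
  9424).c.c.b.a.c.d.a e (L 0).b.b.b e).c.b e (L 8736).b.c.c.b.a.c (L 9583).c.c.b.a.c.c.b.d.c.a)) 
  (N (N (N e (L 0).c.b.b.c.c e (L 9431).c.c.b.a.c.d.a.b.d) (L 0).b.b.c.c e e) (L 0).c.b.b.c.c.b.a 
  (N (H 9556 (N (H 9541 (L 8944).c.b).a.c.d (H 7084 (H 4764 (L 0).c.b).b.c).c e e)) e e (H 9647 
  (L 8600).c.b.a.c).c.b) (N (L 0).c.b.b.c.c.b (L 8633).c.b.a.c.d.a e (L 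
  9438).c.c.b.a.c.c.b.d.c.a)) (N (N (L 0).d.b.b.c.c.b (N (H 9617 (L 9424).c.b).a.c.d.a e (L 
  0).b.b e).c (L 9639).c.c.b.a.c.c.b.b.d.d e) (N (L 0).d.b.b.c.c.b e (L 7378).b.c.c.b.a.c e) (N 
  (N e (H 4887 (L 0).d.b).b.c.c e (L 9138).c.c.b.a.c.d.a.b.d) e (L 8736).c.c.b.a e) (N (N e (L 
  0).d.b.b.c.c (L 9583).c.b.a.c.c.b.d e) (L 9623).c.b.a.c.c.b (L 8433).b.c.c.b.a.c e))) (N (N (N 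
  (L 0).a.c.b.c.c.b (L 0).c.b.c.c e (N e e (H 8506 (L 7238).b.c).c.b.a (L 9431).c.b.a.c.d.a.b)) 
  (N e e (L 0).b.c (L 9461).c.c.b.a.c.c.b.d.c.a) e (N (L 0).a.c.b.c.c.b (L 9618).c.b.a.c.c.b e 
  e)) (N (N (L 9607).c.c.b.a.c.d.a.b.d.d e e (L 7392).b.c.c.b.a.c) (L 7129).b.c.c.b.a.c.c e (N (L 
  9440).c.c.b.a.c.d.a.a.c.b e (L 8736).b.c.c.b.a.c (L 9623).c.c.b.a.c.c.b.d.c.a)) (N (N (N e (L 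
  9165).c.c.b.a.c.d.a.a.c e (L 9405).c.c.b.a.c.d.a.b.d) (N e e (L 9572).c.c.b.a.c.c.b.d (L 
  9262).c.c.b.a.c.d.a.b).c e e) (L 9606).c.c.b.a.c.c.b.b.d.a.b (L 9621).c.b.a.c.d.a.a (N e (L 
  9439).c.c.b.a.c.d.a.a.c.c e (L 9413).c.c.b.a.c.c.b.d.c.a)) (N (N (L 0).d.c.b.c.c.b (L 
  0).c.b.c.c e e) (N (L 0).d.c.b.c.c.b (L 9469).c.c.b.a.c.c.b.b.d.a (L 7378).b.c.c.b.a.c e) (H 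
  4887 (L 0).d.c).b.c.c.b.a (N (N e (L 0).d.c.b.c.c (L 9438).c.b.a.c.c.b.d e) (L 
  9637).c.b.a.c.c.b (L 8433).b.c.c.b.a.c e))) (N (N (N (L 0).a.d.b.c.c.b (L 0).d.b.c.c e (L 
  7238).b.c.c.b.a.c) (N e (N e e (N (H 9644 (L 9534).c.c).b.a.c.d.a e e (H 9538 (L 
  9428).c.c).b.a.c.c.b) (L 9624).c.c.b.a.c.d.a.b).c (N (L 9440).b.a.c.d.a e (L 0).b e) e) (N (L 
  0).a.d.b.c.c.b (L 9441).c.c.b.a.c.c.b.b.d.a e (N e (L 9142).c.b.a.c.c e (L 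
  9639).c.b.a.c.c.b.b)) e) (N (N (L 0).b.d.b.c.c.b (L 0).d.b.c.c e (L 7392).b.c.c.b.a.c) (N (L 
  0).b.d.b.c.c.b e (L 7129).b.c.c.b.a.c e) (N (L 0).b.d.b.c.c.b e (L 7378).c.c.b.a e) (L 
  8736).b.c.c.b.a.c.c) (N (N (N (L 9502).c.c.b.a.c.d.a e (L 0).c.d.b e).c.b (N e e (H 4887 (N e 
  (L 0).d e (L 4478).c.c.b.a.c.c.b)) (L 9581).c.c.b.a.c.d.a.b).c e (H 9536 (L 
  9138).c.b).a.c.d.a.b.d) (N (L 0).c.d.b.c.c.b (L 9645).c.c.b.a.c.c.b.b.d.a e e) (N (L 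
  9439).c.b.a.c.d (H 8676 (H 4764 (L 0).c.d).b.c).c e e).a (L 0).c.d.b.c.c.b.a) (N (N (N (L 
  9639).c.c.b.a.c.d.a e (L 0).d.d.b e).c.b (L 0).d.b.c.c (N e (L 9623).b.a.c.c e (L 
  9644).c.c.b.a.c.c.b.b).d e) (N (L 0).d.d.b.c.c.b (N (L 9132).c.c.b.a.c.c.b.b.d e (N e e (N (N 
  (L 9505).c.c.b.a.c.d (L 9625) e e) e e (L 9389).c.c.b.a.c.c.b) (L 9414).c.c.b.a.c.d.a.b) e) (L 
  7378).b.c.c.b.a.c e) (N (N e (H 4887 (L 0).d.d).b.c.c e (L 9451).c.c.b.a.c.d.a.b.d) e (L 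
  8433).c.c.b.a e) (N (L 0).d.d.b.c.c.b (L 9633).c.b.a.c.c.b (L 8433).b.c.c.b.a.c e)))) (N (N (N 
  (N e (L 0).a.c.c.c e (L 7238).c.c.c.b.a.c) (N e (N e e (N (L 9513).c.c.b.a.c.d.a e e (H 9581 (L 
  9388).c.c).b.a.c.c.b) (L 9584).c.c.b.a.c.d.a.b).c (N (N (L 9165).b.a.c.d e (L 9463).b.a.c.c e) 
  e (L 0).c e) (N e (H 9617 (L 9142).c.c).b.a.c.c (L 9477).c.c.b.a.c.c e).d.c.a) (N (L 
  0).a.a.c.c.c.b (L 9423).c.c.b.a.c.c.b.b.d.a (L 7282).c.c.c.b.a.c e) (N (L 0).a.a.c.c.c.b e (H 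
  9552 (N e (H 8385 (L 7238).c.c) (L 9363).b.a.c.c e).a) (N (L 9405).b.a.c.d e (L 
  9632).c.c.b.a.c.c.c.d e).b)) (H 4764 (N (N (L 0).b.a.c.c.c.b e e (L 0).c.c.c.b.a.c) (L 
  0).b.a.c.c.c.b.a (N e e (L 0) (L 0).b.a.c.d.a.b) (L 0).b.a.c.c.c.b.a)) (N e (L 0).c.a.c.c.c.b.a 
  (L 7282).c.c.b.a.c (N (L 0).c.a.c.c.c.b (L 9429).c.c.b.a.c.d.a.a.c.c e (L 
  9495).c.c.b.a.c.c.c.d.c.b)) (N (N (L 0).d.a.c.c.c.b (L 0).a.c.c.c e e) (N (L 0).d.a.c.c.c.b (N 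
  e e (N (L 9544).c.c.b.a.c.d.a e e (L 9428).c.c.b.a.c.c.b) (L 9437).c.c.b.a.c.d.a.b).c (N e e (L 
  7378).c.c.c.b.a (L 9637).c.c.b.a.c.c.b.b.d) e) (N (H 4887 (L 0).d.a).c.c.c.b e (L 
  7282).c.c.c.b.a.c e) (N (L 0).d.a.c.c.c.b (N (L 9138).c.b.a.c.d (L 9366).c.b.a.c.c e e) (L 
  8433).c.c.c.b.a.c e))) (N (N (N (L 0).a.b.c.c.c.b (L 0).b.c.c.c e (N e e (H 9195 (L 
  7238).c.c).c.b.a (L 9607).c.b.a.c.d.a.b)) (L 0).c.c.c (N (L 0).a.b.c.c.c.b e (L 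
  7282).c.c.c.b.a.c e) (N (L 0).a.b.c.c.c.b (N e (L 9120).c.b.a.c.c (L 9497).c.b.a.c.c.c.d e) (L 
  7392).c.c.b.a e)) (N (N (N e (L 0).b.b.c.c.c e (N e e (L 9632).c.c.b.a.c.c.c.a (L 
  9567).c.c.b.a.c.d.a.b)) (L 0).b.c.c.c e (N e (N e (L 9606).b.a.c.c (L 9477).c.c.b.a.c.c.c.d e) 
  (L 7392).c.c.c.b.a e)) (N (L 0).b.b.c.c.c.b e (H 9611 (L 7129).c.c).c.b.a.c e) (N (L 
  0).b.b.c.c.c.b e (H 9591 (L 7129).c.c).b.a e) (N (N (N (H 9617 (L 9424).c.c).b.a.c.d e (L 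
  9477).c.c.b.a.c.c e) e (L 0).b.b.c e).c.b e (L 8736).c.c.c.b.a.c (N e (L 9583).c.c.b.a.c.c (L 
  9632).c.c.b.a.c.c e).d.c.a)) (N (N (N e (L 0).c.b.c.c.c e (N e e (L 9495).c.c.b.a.c.c.c.a (L 
  9431).c.c.b.a.c.d.a.b)) (L 0).b.c.c.c e e) e (H 4764 (L 0).c.b).c.c.c.b.a (N (L 0).c.b.c.c.c.b 
  e e (N e (L 9438).c.c.b.a.c.c (L 9495).c.c.b.a.c.c e).d.c.a)) (N (N (L 0).d.b.c.c.c.b (N (N (L 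
  9440).c.b.a.c.d e (L 9497).c.b.a.c.c e) e (L 0).b.c e).c (L 9639).c.c.b.a.c.c.b.b.d.d e) (N (L 
  0).d.b.c.c.c.b e (L 7378).c.c.c.b.a.c e) (N (N e (H 4887 (L 0).d.b).c.c.c e (H 9536 (L 
  9138).c.c).b.a.c.d.a.b.d) e (N (L 8736).c.c.b e (L 7282).c.c.c.b.a e) e) (N (N e (L 
  0).d.b.c.c.c (L 9623).c.b.a.c.c.b.d e) (L 9625).c.b.a.c.c.b (L 8433).c.c.c.b.a.c e))) (N (N (N 
  e (N (L 9165).c.b.a.c.d e (L 9463).c.b.a.c.c e).a.c e (N e e (N e (H 8385 (L 7238).c.c).c (L 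
  9463).c.b.a.c.c e).a (L 9405).c.b.a.c.d.a.b)) (N e e (N e e (L 4764).c.b.a.c.c.b.d (L 
  9262).c.b.a.c.d.a.b) (N e (L 9461).c.c.b.a.c.c (L 9497).c.c.b.a.c.c e).d.c.a) (L 
  7282).c.c.c.b.a.c.c e) (N (N (L 9607).c.c.b.a.c.d.a.b.d.d e e (N e (L 9497).c.c.b.a.c.c.c.d.c 
  (L 7392).c.c.c.b.a e)) (N (L 9606).c.b.a.c.c.b.b.d e (H 9591 (L 7129).c.c).c.b.a.c e) e (N (N 
  (L 9440).c.c.b.a.c.d e (L 9497).c.c.b.a.c.c e).a.c.b e (L 8736).c.c.c.b.a.c (L 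
  9623).c.c.b.a.c.c.b.d.c.a)) (N (N (N e (N (L 9165).c.c.b.a.c.d e (L 9463).c.c.b.a.c.c e).a.c e 
  (N e e (L 9463).c.c.b.a.c.c.c.a (L 9405).c.c.b.a.c.d.a.b)) (N e e (L 9572).c.c.b.a.c.c.b.d (L 
  9262).c.c.b.a.c.d.a.b).c e e) (L 9606).c.c.b.a.c.c.b.b.d.a.b e (N e (L 
  9439).c.c.b.a.c.d.a.a.c.c e (N (N e (L 9413).c.c.b.a.c.c (L 9463).c.c.b.a.c.c e).d.c (L 
  9463).c.c.b.a.c.c.c.d.c e e))) (N e (N (L 9497).c.c.b.a.c.c.c.a.c.d (L 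
  9469).c.c.b.a.c.c.b.b.d.a (N (L 9439).c.b.a.c.d (H 8558 (L 7378).c.c).c e e).a.c e) (L 
  7282).c.c.c.b.a.c.c (N (N e (L 9413).c.b.a.c.c (L 9463).c.b.a.c.c e).d.c (N (L 9428).c.b.a.c.d 
  (L 9287).c.b.a.c.c (L 9463).c.b.a.c.c.c.d e) (L 8433).c.c.c.b.a.c e))) (N (N (N (L 
  0).a.d.c.c.c.b (L 0).d.c.c.c e (L 7238).c.c.c.b.a.c) (N e (N e e (N (L 9534).c.c.b.a.c.d.a e e 
  (L 9428).c.c.b.a.c.c.b) (L 9624).c.c.b.a.c.d.a.b).c (L 0).c.c e) (N (L 0).a.d.c.c.c.b (L 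
  9396).b.a.c.c.b.b.d.a (L 7282).c.c.c.b.a.c e) e) (N (N (L 0).b.d.c.c.c.b (L 0).d.c.c.c e (N e 
  (H 8592 (L 7392).c.c).c (L 9497).c.b.a.c.c e).a.c) (N (N e (L 0).b.d.c.c.c e (L 
  9469).c.b.a.c.c.b.b) e (L 7129).c.c.c.b.a.c e) (N (L 0).b.d.c.c.c.b e (N (L 9439).b.a.c.d (H 
  8558 (L 7378).c.c) e e).a e) (N (L 0).b.d.c.c.c.b e (L 8736).c.c.c.b.a.c e)) (N (N (N (N (L 
  9502).c.c.b.a.c.d e (L 9495).c.c.b.a.c.c e) e (L 0).c.d.c e).c.b (N e e (H 4887 (N e e (L 0).d 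
  (L 4478).c.c.b.a.c.c.b)) (L 9581).c.c.b.a.c.d.a.b).c e e) (N (L 0).c.d.c.c.c.b (L 
  9645).c.c.b.a.c.c.b.b.d.a e e) (N (H 4764 (L 0).c.d).c.c.c.b e (L 7282).c.c.b.a e) e) (N (N (N 
  (N (L 9639).c.c.b.a.c.d e (L 9632).c.c.b.a.c.c e) e (L 0).d.d.c e).c.b (L 0).d.c.c.c (N e (L 
  9413).b.a.c.c (L 9463).b.a.c.c (L 9598).b.a.c.c.b.b).d e) (N (N e (L 0).d.d.c.c.c e (N e (L 
  9428) (L 9477).c.c.b.a.c.c e).a.c) (N (H 9520 (L 9132).c.c).b.a.c.c.b.b.d e (N e e (N (N (L 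
  9505).c.c.b.a.c.d (L 9287) e e) e e (H 9581 (L 9389).c.c).b.a.c.c.b) (H 9608 (L 
  9414).c.c).b.a.c.d.a.b) e) (N e e (L 7378).c.c.c.b.a (L 9463).b.a.c.c.c) e) (N (N e (H 4887 (L 
  0).d.d).c.c.c e (L 9451).c.c.b.a.c.d.a.b.d) e (N (L 8433).c.c.b e (L 7282).c.c.c.b.a e) e) (N 
  (L 0).d.d.c.c.c.b (L 9631).c.b.a.c.c.b (L 8433).c.c.c.b.a.c e)))) (H 9450 (N (N (N (N e (L 
  0).a.d.c.c e (L 7046).d.c.c.b.a.c) (N e (N e e (N (L 9310).c.c.b.a.c.d.a e e (H 9399 (L 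
  9184).c.c).b.a.c.c.b) (L 9381).c.c.b.a.c.d.a.b).c (L 0).d.c (H 9339 (L 
  8937).c.c).b.a.c.c.b.d.c.a) (N (L 0).a.a.d.c.c.b (L 9218).c.c.b.a.c.c.b.b.d.a e (L 
  9184).d.c.c.b.a.c) (N (L 0).a.a.d.c.c.b e (L 7046).c.c.b.a e)) (N (N (L 0).b.a.d.c.c.b e e (L 
  7190).d.c.c.b.a.c) (N (L 0).b.a.d.c.c.b e (N e e (N (N (L 9330).c.b.a.c.d (H 8884 (L 
  4775).d.c).c e e) e e (L 9225).c.b.a.c.c.b) (L 9421).c.b.a.c.d.a.b) (L 8534).d.c.c.b.a.d) (N (L 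
  8344).c.b.a.c.d.a e (L 0) (N e e (L 9175).d.c.c.b.a (L 8100).d.c.c.b.a)) (L 
  8727).d.c.c.b.a.c.c) (N (N (L 0).c.a.d.c.c.b (L 0).a.d.c.c e e) (N e (L 0).c.a.d.c.c e (H 9443 
  (L 9193).a.c).c.b.b).a (N (L 9423).c.b.a.c.d (H 4754 (L 0).c.a).d.c.c e e).a (N e (L 
  9226).c.c.b.a.c.d.a.a.c.c (L 9184).c.c.b.a e)) (N e (N (L 0).d.a.d.c.c.b (N e e (N (L 
  9340).c.c.b.a.c.d.a e e (L 9221).c.c.b.a.c.c.b) (L 9234).c.c.b.a.c.d.a.b).c (N e e (L 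
  7368).d.c.c.b.a (L 9321).c.c.b.a.c.c.b.b.d) e) (H 4696 (L 0).d.a).d.c.c.b.a (N (L 
  0).d.a.d.c.c.b e (L 8423).d.c.c.b.a.c e))) (N (N (N (L 0).a.b.d.c.c.b (L 0).b.d.c.c e (L 
  7046).d.c.c.b.a.c) (L 0).d.c.c (N (L 0).a.b.d.c.c.b e e (L 9184).d.c.c.b.a.c) (N (L 
  0).a.b.d.c.c.b e (H 8391 (L 7190).c.c).b.a e)) (N (N (N e (L 0).b.b.d.c.c e (L 
  9364).c.c.b.a.c.d.a.b.d) (L 0).b.d.c.c e (N e (L 9265).b.a.c.c.b (L 7190).d.c.c.b.a e)) (N (L 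
  0).b.b.d.c.c.b e (H 9241 (L 4775).d.c).c.b.a.c e) (N (L 0).b.b.d.c.c.b e (N (L 4775).c.c.b e e 
  (L 9400).c.c.b.a.c.c.b.b.d) (L 9175).d.c.c.b.a.c) (N (N (L 9220).c.c.b.a.c.d.a e (L 0).b.b.d 
  e).c.b e (L 8727).d.c.c.b.a.c (L 9403).c.c.b.a.c.c.b.d.c.a)) (H 9134 (N (N (N e (L 0).c.b.d.c.c 
  e (L 8910).c.c.b.a.c.d.a.b.d) (L 0).b.d.c.c e e) (L 0).c.b.d.c.c.b.a (N (H 8380 (N (N e (H 8359 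
  (H 8293 (L 8014).c.b).a.c).c.b e (H 8243 (L 7968).c.b).a.c) (H 7200 (H 4643 (L 0).c.b).d.c).c e 
  e)) (L 9115).c.b.a.c.c.b e e) (N (L 0).c.b.d.c.c.b e (L 8874).c.c.b.a (L 
  8912).c.c.b.a.c.c.b.d.c.a))) (N (N (L 0).d.b.d.c.c.b (L 0).b.d.c.c (L 9323).c.c.b.a.c.c.b.b.d.d 
  e) (L 7368).d.c.c.b.a.c.c (N (N e (H 4696 (L 0).d.b).d.c.c e (L 8935).c.c.b.a.c.d.a.b.d) e (L 
  8727).c.c.b.a e) (N (L 0).d.b.d.c.c.b e (L 8423).d.c.c.b.a.c e))) (N (N (N (L 0).a.c.d.c.c.b (N 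
  (L 9299).c.b.a.c.d.a e (L 0).c.d e).c e (L 7046).d.c.c.b.a.c) (N e e (H 4696 (L 0).d.c) (L 
  9255).c.c.b.a.c.c.b.d.c.a) (L 7192).d.c.c.b.a.c.d (N (L 0).a.c.d.c.c.b (L 9414).c.b.a.c.c.b e 
  e)) (N (N (N e (L 0).b.c.d.c.c e (L 9404).c.c.b.a.c.d.a.b.d) (L 0).c.d.c.c e (L 
  7190).d.c.c.b.a.c) (N (N e (L 0).b.c.d.c.c e (L 9441).c.b.a.c.c.b.b) e (H 9231 (L 
  4775).d.c).c.b.a.c e) (N (L 0).b.c.d.c.c.b e e (L 9175).d.c.c.b.a.c) (N (N (L 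
  9237).c.c.b.a.c.d.a e (L 0).b.c.d e).c.b e (L 8727).d.c.c.b.a.c (L 9442).c.c.b.a.c.c.b.d.c.a)) 
  (N (N (N e (N (L 8962).c.c.b.a.c.d.a e (L 0).c.c.d e).c e (L 9202).c.c.b.a.c.d.a.b.d) (N e e (H 
  4754 (L 0).c.d) (L 9059).c.c.b.a.c.d.a.b).c e e) (N (L 0).c.c.d.c.c.b (L 
  9402).c.c.b.a.c.c.b.b.d.a e e) (N (L 9428).c.b.a.c.d (H 4754 (L 0).c.c).d.c.c e e).a (N e (L 
  9246).c.c.b.a.c.d.a.a.c.c e (L 9234).c.c.b.a.c.c.b.d.c.a)) (N e (N e (L 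
  9265).c.c.b.a.c.c.b.b.d.a (L 7368).d.c.c.b.a.c e) e (L 8423).d.c.c.b.a.c.c)) (N (N (N (L 
  0).a.d.d.c.c.b (N (L 9436).c.b.a.c.d.a e (L 0).d.d e).c e (L 7046).d.c.c.b.a.c) (N e (N e e (N 
  (L 9330).c.c.b.a.c.d.a e e (L 9225).c.c.b.a.c.c.b) (L 9421).c.c.b.a.c.d.a.b).c (L 0).d.c e) (N 
  (L 0).a.d.d.c.c.b (L 9237).c.c.b.a.c.c.b.b.d.a e (H 9415 (N e (H 9345 (H 9189 (L 
  8929).c.b).a.c).c (L 9150).d.c.c.b.a (L 9251).a.c.c.b.b))) e) (N (N (L 0).b.d.d.c.c.b (L 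
  0).d.d.c.c e (H 9158 (L 7155).c.b).a.c) (N (H 9429 (N e (L 0).b.d.d.c.c e (H 9406 (H 9317 (L 
  8928).c.b).a.c).c.b.b)) e (H 9393 (N e e (N (H 9012 (N (L 8860).c.b.a.c.d (H 8105 (L 
  4775).d.c).c e e)) e e (H 9376 (H 9305 (L 9133).c.b.a.c).c.b)) (H 9349 (L 
  9155).c.b).a.c.d.a.b)) e) (N (L 0).b.d.d.c.c.b e (L 7368).c.c.b.a (L 9175).d.c.c.b.a.c) (N (L 
  0).b.d.d.c.c.b e (L 8727).d.c.c.b.a.c e)) (N (N (N (L 9299).c.c.b.a.c.d.a e (L 0).c.d.d e).c.b 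
  (N e e (H 4696 (N e (L 4451).c.c.b.a.c.c e (L 0)).d) (N (L 9377).c.c.b.a.c.d e e (L 
  9428).c.c.b.a.c.d).b).c e (L 9248).c.b.a.c.d.a.b.d) (N (L 0).c.d.d.c.c.b (L 
  9441).c.c.b.a.c.c.b.b.d.a e e) (N (L 9168).c.b.a.c.d (H 8365 (H 4754 (L 0).c.d).d.c).c e e).a 
  (L 0).c.d.d.c.c.b.a) (N (N (N (L 9436).c.c.b.a.c.d.a e (L 0).d.d.d e).c.b (L 0).d.d.c.c (L 
  9330).c.c.b.a.c.c.b.b.d.d e) (N (L 0).d.d.d.c.c.b (N (L 8928).c.c.b.a.c.c.b.b.d e (N e e (N (N 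
  (L 9301).c.c.b.a.c.d (L 9427) e e) e e (L 9185).c.c.b.a.c.c.b) (L 9211).c.c.b.a.c.d.a.b) e) (L 
  7368).d.c.c.b.a.c e) (N (N e (H 4696 (L 0).d.d).d.c.c e (L 9248).c.c.b.a.c.d.a.b.d) e (L 
  8423).c.c.b.a e) (L 8423).d.c.c.b.a.c.c))))) (N (N (N (N (N e (L 7810).a.d.c.b.a.d e (L 
  7238).a.d.c.b.a.c) (N e (N e e (N (L 9513).d.c.b.a.c.d.a e e (L 9388).d.c.b.a.c.c.b) (L 
  9584).d.c.b.a.c.d.a.b).c (L 0).a.d (N e (L 7810).d.c (L 9142).d.c.b.a.c.c.b.d e).a) (N (L 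
  0).a.a.a.d.c.b (L 9423).d.c.b.a.c.c.b.b.d.a e e) (N (L 0).a.a.a.d.c.b e (L 7238).d.c.b.a e)) (N 
  (N e e (L 7401).a.d.c.b.a.a (L 7392).a.d.c.b.a.c) (N (L 0).b.a.a.d.c.b e (N (N (H 9205 (L 
  7401).a.d).c.b (H 9540 (L 9232).c.b).a.a e e) e (N (N (L 9513).c.b.a.c.d (H 8933 (L 
  7129).a.d).c e e) e e (H 9601 (L 9388).c.b).a.c.c.b) (L 9584).c.b.a.c.d.a.b) (N (L 
  9232).c.b.a.a.b e e (L 8534).a.d.c.b.a)) (N (H 9632 (L 9165).c.b).a.c.d.a e (N (L 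
  9586).a.d.c.b.a e e (L 9595).d.c.b.a.a.b.a.c.b) (L 0)) (N (H 9055 (N e (H 7761 (H 5360 (L 
  0).b.a).a.d).c (L 8822).a.d.d e)) e (L 8736).a.d.c.b.a.c (L 9595).d.c.b.a.a.b.a.d.b.c)) (N (N 
  (L 0).c.a.a.d.c.b (N e e (L 0).a.a.d (L 7873).a.d.c.b.a) e e) (N (N e (L 0).c.a.a.d.c e (L 
  9423).c.b.a.c.c.b.b) e e (L 8837).a.d.c.b.a.d) (N (H 4764 (L 0).c.a).a.d.c.b e e (N e (L 
  9535).c.b.a.c.c e (L 8534).a.d.c.b.a)) (N (L 0).c.a.a.d.c.b (L 9429).d.c.b.a.c.d.a.a.c.c e e)) 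
  (N (L 0).a.a.d.c.b (N (L 0).d.a.a.d.c.b (N e e (N (L 9544).d.c.b.a.c.d.a e e (L 
  9428).d.c.b.a.c.c.b) (L 9437).d.c.b.a.c.d.a.b).c (N e e (L 7378).a.d.c.b.a (L 
  9637).d.c.b.a.c.c.b.b.d) e) (H 7193 (H 4887 (L 0).d.a).a.d).c.b.a (N (H 4864 (L 0).d.a).a.d.c.b 
  (N (H 9649 (L 9093).c.b).a.c.d (L 9288).c.b.a.c.c e e) (L 8433).a.d.c.b.a.c e))) (N (N (N (L 
  0).a.b.a.d.c.b (N e e (L 0).b.a.d (L 7810).a.d.c.b.a) e (L 7238).a.d.c.b.a.c) e (L 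
  0).a.b.a.d.c.b.a (N (L 0).a.b.a.d.c.b e (L 7392).d.c.b.a e)) (N (N (N e (L 0).b.b.a.d.c e (L 
  9567).d.c.b.a.c.d.a.b.d) (L 0).b.a.d.c e (L 7392).a.d.c.b.a.c) (N (L 0).b.b.a.d.c.b e (H 9444 
  (L 7129).a.d).c.b.a.c (L 8534).a.d.c.b.a.d) (N (L 0).b.b.a.d.c.b e (N (N (L 9534).b.a.c.d (H 
  9086 (L 7129).d.c) e e) e e (L 9428).b.a.c.c.b) (N e (L 9624).b.a.c.d.a e (L 8837).a.d.c.b.a)) 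
  (N (N (L 9424).d.c.b.a.c.d.a e e (H 5360 (L 0).b.b).a).c.b e (L 8736).a.d.c.b.a.c (N e (L 
  8534).d.c (L 9583).d.c.b.a.c.c.b.d e).a)) (L 0) (N (N (L 0).d.b.a.d.c.b e (L 
  9639).d.c.b.a.c.c.b.b.d.d e) (N (L 0).d.b.a.d.c.b e (L 7378).a.d.c.b.a.c e) (N (N e (H 4887 (L 
  0).d.b).a.d.c e (L 9138).d.c.b.a.c.d.a.b.d) e (L 8736).d.c.b.a e) (N (H 4864 (L 0).d.b).a.d.c.b 
  (L 9625).c.b.a.c.c.b (L 8433).a.d.c.b.a.c e))) (N (N (N (L 0).a.c.a.d.c.b (N e e (L 0).c.a.d (L 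
  7810).a.d.c.b.a) e (L 7238).a.d.c.b.a.c) (N e e (L 0).a.d (N e (L 7873).d.c (L 
  9461).d.c.b.a.c.c.b.d e).a) e (L 0).a.c.a.d.c.b.a) (N (N (N e (L 0).b.c.a.d.c e (L 
  9607).d.c.b.a.c.d.a.b.d) (L 0).c.a.d.c e (N e (H 9556 (L 9441).b.a).c.c.b (L 7392).a.d.c.b.a 
  e)) (N (H 8567 (L 0).b.c).a.d.c.b e (H 9434 (L 7129).a.d).c.b.a.c (L 8534).a.d.c.b.a.d) (N (L 
  0).b.c.a.d.c.b e e (L 8837).a.d.c.b.a.d) (N (N (L 9440).d.c.b.a.c.d.a e e (H 5360 (L 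
  0).b.c).a).c.b e (L 8736).a.d.c.b.a.c (N e (L 8837).d.c (L 9623).d.c.b.a.c.c.b.d e).a)) (N (N 
  (N e (N (L 9165).d.c.b.a.c.d.a e e (L 0).c.c.a).c e (N e e (L 9616).b.a (L 
  9405).d.c.b.a.c.d.a.b)) (N e e (N e e (L 9572).d.c.b.a.c.c.b.d (H 4764 (N (L 0).c (L 
  0).d.c.b.a.c.d.a e e))) (L 7873).a.d.c.b.a) e e) (N (L 0).c.c.a.d.c.b (L 
  9606).d.c.b.a.c.c.b.b.d.a e (L 8837).a.d.c.b.a.d) (N (H 4764 (L 0).c.c).a.d.c.b e e (L 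
  8534).a.d.c.b.a.d) (N (L 0).c.c.a.d.c.b (L 9439).d.c.b.a.c.d.a.a.c.c e (N e (L 8534).d.c (L 
  9413).d.c.b.a.c.c.b.d e).a)) (N e (N (L 0).d.c.a.d.c.b (L 9469).d.c.b.a.c.c.b.b.d.a (N (L 
  9429).c.b.a.c.d (L 7344).c e e).a.c e) (H 4887 (L 0).d.c).a.d.c.b.a (N (H 4864 (L 
  0).d.c).a.d.c.b (N (L 9506).c.b.a.c.d (L 9330).c.b.a.c.c e e) (L 8433).a.d.c.b.a.c e))) (N (N 
  (N e (L 7810).a.d.c.b.a.d e (L 7238).a.d.c.b.a.c) (N e e (N (L 9534).d.c.b.a.c.d.a e e (L 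
  9428).d.c.b.a.c.c.b) (L 9624).d.c.b.a.c.d.a.b).c.b (L 9441).d.c.b.a.c.c.b.b.d.a.b e) (N (N (L 
  0).b.d.a.d.c.b (L 0).d.a.d.c e (L 7392).a.d.c.b.a.c) (N (L 0).b.d.a.d.c.b e (N e e (N (N (L 
  9544).c.b.a.c.d (H 8471 (L 7129).a.d).c e e) e e (L 9428).c.b.a.c.c.b) (L 9437).c.b.a.c.d.a.b) 
  (L 8534).a.d.c.b.a.d) (N (L 0).b.d.a.d.c.b e (L 7378).d.c.b.a (N (L 8837).a.d.c.b (L 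
  9637).c.b.a.c.c.b e e).d) (N (H 5360 (L 0).b.d).a.d.c.b e (L 8736).a.d.c.b.a.c e)) (N (N (N (L 
  9502).d.c.b.a.c.d.a e e (L 0).c.d.a).c.b (N e e (N e e (L 9265).d.c.b.a.c.c.b.d (H 4887 (L 
  0).d.a)) (L 7873).a.d.c.b.a) e e) (N (L 0).c.d.a.d.c.b (L 9645).d.c.b.a.c.c.b.b.d.a e (L 
  8837).a.d.c.b.a.d) (N (H 4764 (L 0).c.d).a.d.c.b e e (L 8534).a.d.c.b.a.d) (L 0).c.d.a.d.c.b.a) 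
  (N (N (N (L 9639).d.c.b.a.c.d.a e e (L 0).d.d.a).c.b (H 4864 (L 0).d.a).d.c (L 
  9644).d.c.b.a.c.c.b.b.d.d e) (N (L 0).d.d.a.d.c.b (N (L 9132).d.c.b.a.c.c.b.b.d e (N e e (N (L 
  9505).d.c.b.a.c.d.a e e (L 9389).d.c.b.a.c.c.b) (L 9414).d.c.b.a.c.d.a.b) e) (L 
  7378).a.d.c.b.a.c e) (N (N e (H 4887 (L 0).d.d).a.d.c e (L 9451).d.c.b.a.c.d.a.b.d) e (L 
  8433).d.c.b.a e) (N (H 4864 (L 0).d.d).a.d.c.b (L 9631).c.b.a.c.c.b (L 8433).a.d.c.b.a.c e)))) 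
  (H 9453 (N (N (N (N e (L 0).a.b.d.c e (L 4902).b.d.c.b.a.c) (N e (N e e (N (L 
  9346).d.c.b.a.c.d.a e e (L 9188).d.c.b.a.c.c.b) (L 9382).d.c.b.a.c.d.a.b).c (L 0).b.d (L 
  8942).d.c.b.a.c.c.b.d.c.a) (N (L 0).a.a.b.d.c.b (H 9346 (L 9223).d.c).b.a.c.c.b.b.d.a e e) (N 
  (L 0).a.a.b.d.c.b e (L 4902).d.c.b.a e)) (N (L 7350).b.d.c.b.a.c.d (N e (L 7603).b.d.c.b.a (L 
  6939).b.d.c.b.a e).c (L 0).d (N (L 0).b.a.b.d.c.b e (L 8546).b.d.c.b.a.c e)) (N (N (L 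
  0).c.a.b.d.c.b (L 0).a.b.d.c e e) (L 0).c.a.b.d.c.b.a (N (N (L 9448).c.b.a.c.d (H 4575 (L 
  0).c.a).b.d.c e e) e e (L 9414).c.b.a.c.c.b) (N (L 0).c.a.b.d.c.b (L 9228).d.c.b.a.c.d.a.a.c.c 
  e e)) (H 9077 (N (N (L 0).d.a.b.d.c.b (L 0).a.b.d.c e e) (N e (N e e (N (L 8848).d.c.b.a.c.d.a 
  e e (L 8851).d.c.b.a.c.c.b) (L 8526).d.c.b.a.c.d.a.b).c (L 6800).b.d.c.b.a.c e) (H 8461 (H 7238 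
  (H 4813 (L 0).d.a).b.d).c.b).a (N (L 0).d.a.b.d.c.b e (L 7929).b.d.c.b.a.c e)))) (N (H 9433 (N 
  (N (L 0).a.b.b.d.c.b (L 0).b.b.d.c e (N e e (H 8854 (L 4880).b.d).c.b.a (L 
  9346).c.b.a.c.d.a.b)) (L 0).b.d.c (L 0).a.b.b.d.c.b.a (N (L 0).a.b.b.d.c.b (H 9400 (H 9212 (L 
  8941).c.b.a.c).c.b) (L 7331).d.c.b.a e))) (N (N (N e (L 0).b.b.b.d.c e (L 
  9366).d.c.b.a.c.d.a.b.d) (L 0).b.b.d.c e (L 7350).b.d.c.b.a.c) (L 6939).b.d.c.b.a.c.c (N (L 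
  0).b.b.b.d.c.b e (H 9255 (L 6939).d.c).b.a e) (N (N (L 9223).d.c.b.a.c.d.a e e (L 0).b.b.b).c.b 
  e (L 8546).b.d.c.b.a.c (L 9384).d.c.b.a.c.c.b.d.c.a)) (N (N (N e (L 0).c.b.b.d.c e (L 
  9230).d.c.b.a.c.d.a.b.d) (L 0).b.b.d.c e e) (L 0).c.b.b.d.c.b.a (N (N (L 8873).c.b.a.c.d (H 
  6895 (H 4575 (L 0).c.b).b.d).c e e) e e (L 8400).c.b.a.c.c.b) (N (L 0).c.b.b.d.c.b (L 
  8591).c.b.a.c.d.a e (L 9239).d.c.b.a.c.c.b.d.c.a)) (N (N (L 0).d.b.b.d.c.b (N (L 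
  9223).c.b.a.c.d.a e e (L 0).b.b).c (L 9437).d.c.b.a.c.c.b.b.d.d e) (N (L 0).d.b.b.d.c.b e (L 
  7179).b.d.c.b.a.c e) (N (N e (H 4878 (L 0).d.b).b.d.c e (L 8936).d.c.b.a.c.d.a.b.d) e (L 
  8546).d.c.b.a e) (N (N e (L 0).d.b.b.d.c (L 9384).c.b.a.c.c.b.d e) (L 9424).c.b.a.c.c.b (L 
  8242).b.d.c.b.a.c e))) (N (N (N (L 0).a.c.b.d.c.b (L 0).c.b.d.c e (N e e (H 8305 (L 
  4902).b.d).c.b.a (L 9230).c.b.a.c.d.a.b)) (N e e (L 0).b.d (H 9377 (L 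
  9261).d.c).b.a.c.c.b.d.c.a) e (N (L 0).a.c.b.d.c.b (L 9428).c.b.a.c.c.b e e)) (N (N (N e (L 
  0).b.c.b.d.c e (L 9404).d.c.b.a.c.d.a.b.d) (L 0).c.b.d.c e (L 7350).b.d.c.b.a.c) (N (L 
  0).b.c.b.d.c.b e (L 6939).b.d.c.b.a.c e) e (N (N (L 9240).d.c.b.a.c.d.a e e (L 0).b.c.b).c.b e 
  (L 8546).b.d.c.b.a.c (L 9423).d.c.b.a.c.c.b.d.c.a)) (N (N (N e (N (H 9339 (L 
  8965).d.c).b.a.c.d.a e e (L 0).c.c.b).c e (N e e (L 8924).b.a (H 9338 (L 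
  9204).d.c).b.a.c.d.a.b)) (H 7133 (H 4575 (N (L 0).b.a.c.d e (L 0) e).b).d.c) e e) (N (L 
  0).c.c.b.d.c.b (N (L 9415).d.c.b.a.c.c.b.b.d e (L 9447).b.a.c e) e e) (H 4575 (L 
  0).c.c).b.d.c.b.a (N (L 0).c.c.b.d.c.b (L 9239).d.c.b.a.c.d.a.a.c.c e (L 
  9214).d.c.b.a.c.c.b.d.c.a)) (N e (N e (L 9278).d.c.b.a.c.c.b.b.d.a (L 7179).b.d.c.b.a.c e) e (N 
  (L 9239).c.b.a.c.c.b.d.c (L 9435).c.b.a.c.c.b (L 8242).b.d.c.b.a.c e))) (N (N (N (L 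
  0).a.d.b.d.c.b (L 0).d.b.d.c e (L 4902).b.d.c.b.a.c) (N e (N e e (N (L 9367).d.c.b.a.c.d.a e e 
  (L 9229).d.c.b.a.c.c.b) (L 9421).d.c.b.a.c.d.a.b).c (L 0).b.d e) (N (L 0).a.d.b.d.c.b (L 
  9242).d.c.b.a.c.c.b.b.d.a e (N e (L 8942).c.b.a.c.c e (L 9437).c.b.a.c.c.b.b)) e) (N (L 
  7350).b.d.c.b.a.c.d (L 6939).b.d.c.b.a.c.c (L 7179).d.c.b.a.c (L 8546).b.d.c.b.a.c.c) (N (N (N 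
  (L 9301).d.c.b.a.c.d.a e e (L 0).c.d.b).c.b (N e e (L 9065).d.c.b.a.c.c.b.d (H 4878 (L 
  0).d.b)).c e (L 8936).c.b.a.c.d.a.b.d) (L 0).c.d.b.d.c.b.a (N (L 9272).c.b.a.c.d (H 8486 (H 
  4575 (L 0).c.d).b.d).c e e).a (L 0).c.d.b.d.c.b.a) (N (N (N (L 9439).d.c.b.a.c.d.a e e (L 
  0).d.d.b).c.b (L 0).d.b.d.c (L 9442).d.c.b.a.c.c.b.b.d.d e) (N (L 0).d.d.b.d.c.b (N (L 
  8941).d.c.b.a.c.c.b.b.d e (N e e (N (L 9188).d.c.b.a.c.d.a e e (L 9189).d.c.b.a.c.c.b) (L 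
  9212).d.c.b.a.c.d.a.b) e) (L 7179).b.d.c.b.a.c e) (N (N e (H 4878 (L 0).d.d).b.d.c e (L 
  9250).d.c.b.a.c.d.a.b.d) e (L 8242).d.c.b.a e) (N (L 0).d.d.b.d.c.b (L 9434).c.b.a.c.c.b (L 
  8242).b.d.c.b.a.c e))))) (N (N (N (N e (L 0).a.c.d.c e (L 7238).c.d.c.b.a.c) (N e (N e e (N (L 
  9513).d.c.b.a.c.d.a e e (H 9564 (L 9388).d.c).b.a.c.c.b) (L 9584).d.c.b.a.c.d.a.b).c (N (L 
  9502).b.a.c.d.a e e (L 0).c) (H 9637 (L 9142).d.c).b.a.c.c.b.d.c.a) (N (L 0).a.a.c.d.c.b (L 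
  9423).d.c.b.a.c.c.b.b.d.a e (L 7507).c.d.c.b.a.c) (N (L 0).a.a.c.d.c.b e (L 7238).d.c.b.a e)) 
  (H 4887 (N (L 0).b.a.c.d.c.b.a (N (L 0).b.a.c.d.c.b (L 4875).d.c.b.a.c.c.b.d.c.c (L 
  0).c.d.c.b.a.c e) (N e e (N e (L 4478).b.a.c.c e (L 4872).b.a.c.c.b.b).d (L 0)) (N (N e (L 
  0).b.a.c.d.c (L 4674).c.b.a.c.c.b.d e) e (L 0).c.d.c.b.a.c e))) (N e (L 0).c.a.c.d.c.b.a (N (H 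
  4764 (L 0).c.a).c.d.c.b e e (L 7385).c.d.c.b.a.c) (N (L 0).c.a.c.d.c.b (L 
  9429).d.c.b.a.c.d.a.a.c.c (L 7507).d.c.b.a e)) (N (N (L 0).d.a.c.d.c.b (L 0).a.c.d.c e e) (N (L 
  0).d.a.c.d.c.b (N e e (N (N (L 9544).d.c.b.a.c.d (L 9618) e e) e e (L 9428).d.c.b.a.c.c.b) (L 
  9437).d.c.b.a.c.d.a.b).c (N e e (L 7378).c.d.c.b.a (N (L 9401).d.c.b.a.c.d.c (L 
  9637).d.c.b.a.c.c.b e e).d) e) e (N (L 0).d.a.c.d.c.b (N (L 9138).c.b.a.c.d (L 9366).c.b.a.c.c 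
  e e) (L 8433).c.d.c.b.a.c e))) (N (N (N (L 0).a.b.c.d.c.b (L 0).b.c.d.c e (N e e (H 9195 (L 
  7238).c.d).c.b.a (L 9607).c.b.a.c.d.a.b)) (L 0).c.d.c (N (L 0).a.b.c.d.c.b e e (L 
  7507).c.d.c.b.a.c) (N (L 0).a.b.c.d.c.b (L 9120).c.b.a.c.c.b (L 7392).d.c.b.a e)) (N (N (N e (L 
  0).b.b.c.d.c e (L 9567).d.c.b.a.c.d.a.b.d) (L 0).b.c.d.c e (N e (L 9645).b.a.c.c.b (L 
  7392).c.d.c.b.a e)) (N (L 0).b.b.c.d.c.b e (H 9611 (L 7129).c.d).c.b.a.c e) (N (N e e (L 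
  0).b.b.c.d (L 9405).d.c.b.a.c.d.c.a).b e (H 9434 (N e e (L 9167).d.c.b.a.c.d (L 7129)).c).b.a 
  e) (N (N (L 9424).d.c.b.a.c.d.a e e (L 0).b.b.c).c.b e (L 8736).c.d.c.b.a.c (L 
  9583).d.c.b.a.c.c.b.d.c.a)) (N (N (N e (L 0).c.b.c.d.c e (L 9431).d.c.b.a.c.d.a.b.d) (L 
  0).b.c.d.c e e) e (N (H 4764 (L 0).c.b).c.d.c.b e e (L 7385).c.d.c.b.a.c) (N (L 0).c.b.c.d.c.b 
  e e (L 9438).d.c.b.a.c.c.b.d.c.a)) (N (N (L 0).d.b.c.d.c.b (N (L 9440).c.b.a.c.d.a e e (L 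
  0).b.c).c (N e (L 9377).d.c.b.a.c.d.c.c e (L 9639).d.c.b.a.c.c.b.b).d e) (N (L 0).d.b.c.d.c.b e 
  (L 7378).c.d.c.b.a.c e) (N (N e (H 4887 (L 0).d.b).c.d.c e (L 9138).d.c.b.a.c.d.a.b.d) e (N e e 
  (L 9387).d.c.b.a.c.d (L 8736)).c.b.a e) (N (N e (L 0).d.b.c.d.c (L 9623).c.b.a.c.c.b.d e) (L 
  9625).c.b.a.c.c.b (L 8433).c.d.c.b.a.c e))) (N (N (N (L 0).a.c.c.d.c.b (N (L 9165).c.b.a.c.d.a 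
  e e (L 0).c.c).c e (N e e (H 8385 (L 7238).c.d).c.b.a (L 9405).c.b.a.c.d.a.b)) (N e e (H 4764 
  (N e e (L 4476).c.b.a.c.d (N e (L 0).c.b.a.c.d.a (L 0) e))) (L 9461).d.c.b.a.c.c.b.d.c.a) (H 
  8719 (L 7507).c.d).c.b.a.c.d (L 0).a.c.c.d.c.b.a) (N (N (N e (L 0).b.c.c.d.c e (L 
  9607).d.c.b.a.c.d.a.b.d) (L 0).c.c.d.c e (L 7392).c.d.c.b.a.c) (N (N e (L 0).b.c.c.d.c e (L 
  9606).c.b.a.c.c.b.b) e (H 9591 (L 7129).c.d).c.b.a.c e) (L 0).b.c.c.d.c.b.a (N (N (L 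
  9440).d.c.b.a.c.d.a e e (L 0).b.c.c).c.b e (L 8736).c.d.c.b.a.c (L 9623).d.c.b.a.c.c.b.d.c.a)) 
  (N (N (N e (N (L 9165).d.c.b.a.c.d.a e e (L 0).c.c.c).c e (N e e (L 9621).b.a (L 
  9405).d.c.b.a.c.d.a.b)) (N e e (L 9572).d.c.b.a.c.c.b.d (H 4764 (N e (L 0).d.c.b.a.c.d.a (L 
  0).c e))).c e e) (N (L 0).c.c.c.d.c.b (L 9606).d.c.b.a.c.c.b.b.d.a e e) (L 7385).c.d.c.b.a.c.d 
  (N (L 0).c.c.c.d.c.b (L 9439).d.c.b.a.c.d.a.a.c.c (L 7385).d.c.b.a (L 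
  9413).d.c.b.a.c.c.b.d.c.a)) (N (N (L 0).d.c.c.d.c.b (L 0).c.c.d.c e e) (N (L 0).d.c.c.d.c.b (L 
  9469).d.c.b.a.c.c.b.b.d.a (N (L 9439).c.b.a.c.d (H 8558 (L 7378).c.d).c e e).a.c e) e (N (N e 
  (L 0).d.c.c.d.c (N e (L 9413).c.b.a.c.c (L 9337).c.b.a e).d e) (N (L 9428).c.b.a.c.d (L 
  9287).c.b.a.c.c e e) (L 8433).c.d.c.b.a.c e))) (N (N (L 7238).c.d.c.b.a.c.d (N e e (N (L 
  9534).d.c.b.a.c.d.a e e (L 9428).d.c.b.a.c.c.b) (L 9624).d.c.b.a.c.d.a.b).c.b (N e (L 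
  9441).d.c.b.a.c.c.b.b.d.a e (L 7507).c.d.c.b.a.c) e) (N (H 8592 (L 7392).c.d).c.b.a.c.d (N (L 
  9469).c.b.a.c.c.b.b.d e (L 7129).c.d.c.b.a.c e) (N e e (L 9387).d.c.b.a.c.d (L 7378)).c.b.a.c 
  (L 8736).c.d.c.b.a.c.c) (N (N (L 9502).d.c.b.a.c.d.a.a.c.b (N e e (L 9265).d.c.b.a.c.c.b.d (L 
  9581).d.c.b.a.c.d.a.b).c e e) (L 9645).d.c.b.a.c.c.b.b.d.a.b (L 7385).c.d.c.b.a.c.d e) (N (N (L 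
  9639).d.c.b.a.c.d.a.a.c.b e (N e (L 9377).d.c.b.a.c.d.c.c e (L 9644).d.c.b.a.c.c.b.b).d e) (N e 
  (N (L 9132).d.c.b.a.c.c.b.b.d e (N e e (N (L 9505).d.c.b.a.c.d.a e e (L 9389).d.c.b.a.c.c.b) (L 
  9414).d.c.b.a.c.d.a.b) e) (L 7378).c.d.c.b.a.c e) (N (L 9451).d.c.b.a.c.d.a.b.d.d e (N e e (L 
  9387).d.c.b.a.c.d (L 8433)).c.b.a e) (N e (L 9631).c.b.a.c.c.b (L 8433).c.d.c.b.a.c e)))) (N (N 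
  (N (N e (L 0).a.d.d.c e (L 7238).d.d.c.b.a.c) (N e (N e e (N (L 9513).d.c.b.a.c.d.a e e (H 9581 
  (L 9388).d.c).b.a.c.c.b) (L 9584).d.c.b.a.c.d.a.b).c (N (L 9639).b.a.c.d.a e e (L 0).d) (H 9595 
  (H 9532 (L 9142).d.c).b.a).c.c.b.d.c.a) (N (L 0).a.a.d.d.c.b (H 9616 (L 
  9423).d.c).b.a.c.c.b.b.d.a e e) (N (L 0).a.a.d.d.c.b e (L 7238).d.c.b.a e)) (N (N (L 
  0).b.a.d.d.c.b e (L 7374).d.d.c.b.a.d (L 7392).d.d.c.b.a.c) (N (L 0).b.a.d.d.c.b e (N (L 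
  9217).c.b.a.d.b e (N (N (L 9534).c.b.a.c.d (H 9086 (L 7129).d.d).c e e) e e (L 
  9428).c.b.a.c.c.b) (N (H 9319 (L 7362).d.d).c.b (L 9624).c.b.a.c.d.a e e)) e) (N (L 
  8547).c.b.a.c.d.a e (N e (L 9516).d.c.b.a.d.b.a.c e (L 9632).d.c.b.a.d.b.a.a).d (L 0)) (N e (L 
  9260).b.a.d.c.a (L 8736).d.d.c.b.a e).c) (N (N (L 0).c.a.d.d.c.b (L 0).a.d.d.c e e) (N e (L 
  0).c.a.d.d.c e (L 9441).c.b.a.c.c.b.b).a (N (L 9616).c.b.a.c.d (H 4764 (L 0).c.a).d.d.c e e).a 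
  (N (H 8776 (L 0).c.a).d.d.c.b (H 9392 (N (H 9338 (H 9276 (L 9169).d.c).b.a).c.d (L 9110) e 
  e).a).c.c e (L 9644).b.a.c.c.b.b)) (N e (N (L 0).d.a.d.d.c.b (N e e (N (L 9544).d.c.b.a.c.d.a e 
  e (L 9428).d.c.b.a.c.c.b) (L 9437).d.c.b.a.c.d.a.b).c (N e e (L 7378).d.d.c.b.a (L 
  9637).d.c.b.a.c.c.b.b.d) e) (H 4887 (L 0).d.a).d.d.c.b.a (L 8433).d.d.c.b.a.c.c)) (N (N (N (L 
  0).a.b.d.d.c.b (L 0).b.d.d.c e (L 7238).d.d.c.b.a.c) (L 0).d.d.c (L 0).a.b.d.d.c.b.a (N (L 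
  0).a.b.d.d.c.b e (L 7358).b.a e)) (N (N (N e (L 0).b.b.d.d.c e (L 9567).d.c.b.a.c.d.a.b.d) (L 
  0).b.d.d.c e (N e (L 9132).b.a.c.c.b (L 7392).d.d.c.b.a e)) (N (L 0).b.b.d.d.c.b e (H 9444 (L 
  7129).d.d).c.b.a.c e) (N (L 0).b.b.d.d.c.b e (H 9567 (N (N (L 9418).b.a.c.d (H 8313 (L 
  7129).d.c) e e) e e (H 9533 (L 9302).b.a).c.c.b)) (L 9414).b.a.c.d.a.b) (N (N (L 
  9424).d.c.b.a.c.d.a e e (H 8776 (L 0).b.b).d).c.b e (L 8736).d.d.c.b.a.c (L 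
  9583).d.c.b.a.c.c.b.d.c.a)) (N (N (N e (L 0).c.b.d.d.c e (L 9431).d.c.b.a.c.d.a.b.d) (L 
  0).b.d.d.c e e) (L 0).c.b.d.d.c.b.a (N (N (L 9125).c.b.a.c.d (H 7331 (H 4764 (L 0).c.b).d.d).c 
  e e) (L 9638).c.b.a.c.c.b e e) (N (H 8776 (L 0).c.b).d.d.c.b e e (H 9550 (L 
  9438).d.c).b.a.c.c.b.d.c.a)) (N (N (L 0).d.b.d.d.c.b (H 8776 (L 0).b.d).d.c (L 
  9639).d.c.b.a.c.c.b.b.d.d e) (L 7378).d.d.c.b.a.c.c (N (N e (H 4887 (L 0).d.b).d.d.c e (L 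
  9138).d.c.b.a.c.d.a.b.d) e (L 8736).d.c.b.a e) (N (L 0).d.b.d.d.c.b e (L 8433).d.d.c.b.a.c e))) 
  (N (N (N (L 0).a.c.d.d.c.b (N (L 9502).c.b.a.c.d.a e e (L 0).c.d).c e (L 7238).d.d.c.b.a.c) (N 
  e e (H 4887 (N e e (L 4478).c.b.a.c.c.b.d (L 0).d)) (L 9461).d.c.b.a.c.c.b.d.c.a) e (N (L 
  0).a.c.d.d.c.b (L 9618).c.b.a.c.c.b e (N e (L 9451).b.a.c.d.a (L 7405).d.d.c.b.a e))) (N (N (N 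
  e (L 0).b.c.d.d.c e (L 9607).d.c.b.a.c.d.a.b.d) (L 0).c.d.d.c e (L 7392).d.d.c.b.a.c) (N (N e 
  (L 0).b.c.d.d.c e (L 9645).c.b.a.c.c.b.b) e (H 9434 (L 7129).d.d).c.b.a.c e) (L 
  0).b.c.d.d.c.b.a (N (N (L 9394).b.a.c.d.a e e (H 8776 (L 0).b.c).d).c.b e (L 8736).d.d.c.b.a.c 
  (L 9623).d.c.b.a.c.c.b.d.c.a)) (N (N (N e (N (H 9518 (L 9165).d.c).b.a.c.d.a e e (L 0).c.c.d).c 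
  e (N e e (L 9361).b.a (H 9598 (L 9405).d.c).b.a.c.d.a.b)) (H 8375 (H 4764 (N e (H 4728 (L 
  0).d.c).b.a.c.d.a e (L 0).c)).d.c) e e) (N (L 0).c.c.d.d.c.b (L 9606).d.c.b.a.c.c.b.b.d.a e e) 
  (N (L 9621).c.b.a.c.d (H 4764 (L 0).c.c).d.d.c e e).a (N (H 8776 (L 0).c.c).d.d.c.b (L 
  9439).d.c.b.a.c.d.a.a.c.c e (L 9413).d.c.b.a.c.c.b.d.c.a)) (N (N (L 0).d.c.d.d.c.b (H 8776 (L 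
  0).c.d).d.c e e) (N (L 0).d.c.d.d.c.b (L 9469).d.c.b.a.c.c.b.b.d.a (L 7378).d.d.c.b.a.c e) e (L 
  8433).d.d.c.b.a.c.c)) (N (N (N (L 0).a.d.d.d.c.b (N (L 9639).c.b.a.c.d.a e e (L 0).d.d).c e (L 
  7238).d.d.c.b.a.c) (N e (N e e (N (L 9534).d.c.b.a.c.d.a e e (L 9428).d.c.b.a.c.c.b) (L 
  9624).d.c.b.a.c.d.a.b).c (L 0).d.d e) (N (L 0).a.d.d.d.c.b (L 9441).d.c.b.a.c.c.b.b.d.a e (N e 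
  (L 9110).c.b.a.c.c e (L 9644).c.b.a.c.c.b.b)) e) (N (N (L 0).b.d.d.d.c.b (L 0).d.d.d.c e (L 
  7358).c.b.a.c) (N (N e (L 0).b.d.d.d.c e (L 9132).c.b.a.c.c.b.b) e (N e e (N (H 9561 (N (L 
  9414).c.b.a.c.d (H 8313 (L 7129).d.d).c e e)) e e (L 9389).c.b.a.c.c.b) (L 9414).c.b.a.c.d.a.b) 
  e) (N (L 0).b.d.d.d.c.b e (L 7378).d.c.b.a e) (N (H 8776 (L 0).b.d).d.d.c.b e (L 
  8736).d.d.c.b.a.c e)) (N (N (N (L 9502).d.c.b.a.c.d.a e e (L 0).c.d.d).c.b (N e e (L 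
  9265).d.c.b.a.c.c.b.d (H 4887 (L 0).d.d)).c e (L 9451).c.b.a.c.d.a.b.d) (N (L 0).c.d.d.d.c.b (L 
  9645).d.c.b.a.c.c.b.b.d.a e e) (N (L 9361).c.b.a.c.d (H 8375 (H 4764 (L 0).c.d).d.d).c e e).a 
  (H 8776 (L 0).c.d).d.d.c.b.a) (N (N (L 9639).d.c.b.a.c.d.a.a.c.b e (L 9644).d.c.b.a.c.c.b.b.d.d 
  e) (N e (N (L 9132).d.c.b.a.c.c.b.b.d e (N e e (N (L 9505).d.c.b.a.c.d.a e e (L 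
  9389).d.c.b.a.c.c.b) (L 9414).d.c.b.a.c.d.a.b) e) (L 7378).d.d.c.b.a.c e) (N (L 
  9451).d.c.b.a.c.d.a.b.d.d e (L 8433).d.c.b.a e) (L 8433).d.d.c.b.a.c.c)))))) e)) e e).a 

theorem W1 : goW trie = true := by decide +kernel
theorem A1 : goA trie = true := by decide +kernel
open Sch in theorem D1 : goD (z <| s <| s <| z <| n <| w 20 <| s <| n <| w 20 <| s <| z <| n <| w 20 <| s <| n <| w 20 <| s <| z <| n <| w 20 <| s <| n <| w 20 <| s <| n <| w 20 <| nil) trie = true := by decide +kernel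

open Sch in theorem B1 : goB (s <| p <| s <| p <| n <| s <| s <| n <| s <| s <| n <| s <| n <| w 6 <| s <| n <| w 6 <| nil) trie = true := by decide +kernel

open Sch in theorem B2 : goB (s <| p <| s <| p <| n <| s <| p <| n <| s <| p <| n <| s <| s <| n <| s <| n <| w 6 <| s <| n <| w 6 <| nil) trie = true := by decide +kernel

open Sch in theorem B3 : goB (s <| p <| s <| p <| n <| s <| p <| n <| s <| p <| n <| s <| p <| n <| s <| s <| n <| s <| n <| w 6 <| s <| n <| w 6 <| s <| n <| w 6 <| nil) trie = true := by decide +kernel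

theorem T0 : 0 < TW trie [.la] := by decide +kernel

end SF

/-- Over the alphabet `Fin 4` with `p = 15`, there exist nonnegative coefficients
`(C_w)_{w ∈ Λ}` with `C_[0] > 0`, every coefficient at most `10635` and either `0` or at
least `4441`, such that for every `v ∈ Λ` and every letter `a`,
`(12914/6541)·C_v ≤ Σ_{b, vab square-free of period 2..15} C_{Λ(vab)}`. -/
theorem stmt_5 :
    ∃ C : List (Fin 4) → ℝ,
      (∀ v ∈ Lam 2 15, 0 ≤ C v) ∧
      0 < C [0] ∧
      (∀ v ∈ Lam 2 15, C v ≤ 10635 ∧ (C v = 0 ∨ 4441 ≤ C v)) ∧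
      (∀ v ∈ Lam 2 15, ∀ a : Fin 4,
        (12914 / 6541 : ℝ) * C v ≤
          ∑ b : Fin 4,
            if ¬ HasSq 2 15 (v ++ [a, b]) then C (lamOf 2 15 (v ++ [a, b])) else 0) := by
  exact SF.final (SF.mkHy SF.W1 SF.A1 SF.D1 SF.B1 SF.B2 SF.B3 SF.T0)
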